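/- For every integer n ≥ 1 there exists ε > 0 with the following property: every C¹ tangent vector field X on the unit sphere S^{2n+1} ⊂ ℂ^{n+1} satisfying ‖X(z) − iz‖ < ε for all z ∈ S^{2n+1} has at least one periodic orbit. (Seifert's theorem for n = 1 and, in general, Fuller's theorem applied to the Hopf fibration S^{2n+1} → ℂP^n, whose base has nonzero Euler characteristic.) -/

import Mathlib

open scoped RealInnerProductSpace

namespace HopfOrbit

open Module

section

/-- A model of the algebra of constant-coefficient differential forms on `V`, together with the
contractions by vectors. -/
structure FormAlgebra (V 𝓐 : Type*) [NormedAddCommGroup V] [NormedSpace ℝ V] [NormedRing 𝓐]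
    [NormedAlgebra ℝ 𝓐] where
  c : (V →L[ℝ] ℝ) →L[ℝ] 𝓐
  ι : V → 𝓐
  c_sq : ∀ a, c a * c a = 0
  ι_c : ∀ v a, ι v * c a + c a * ι v = algebraMap ℝ 𝓐 (a v)
  range_pow : (LinearMap.range c.toLinearMap) ^ (finrank ℝ V + 1) = ⊥

section Existence

variable (V : Type*) [NormedAddCommGroup V] [NormedSpace ℝ V] [FiniteDimensional ℝ V]

/-- The dimension of the exterior algebra of the dual of `V`. -/
noncomputable abbrev extDim : ℕ := finrank ℝ (ExteriorAlgebra ℝ (V →L[ℝ] ℝ))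

/-- The carrier of the form algebra: operators on (a copy of) the exterior algebra. -/
abbrev FormOp : Type := (Fin (extDim V) → ℝ) →L[ℝ] (Fin (extDim V) → ℝ)

instance finite_exteriorAlgebra : Module.Finite ℝ (ExteriorAlgebra ℝ (V →L[ℝ] ℝ)) :=
  Module.Finite.of_basis (Module.finBasis ℝ (V →L[ℝ] ℝ)).ExteriorAlgebra

/-- Operators on the exterior algebra as continuous operators on coordinates. -/
noncomputable def toFormOp :
    (ExteriorAlgebra ℝ (V →L[ℝ] ℝ) →ₗ[ℝ] ExteriorAlgebra ℝ (V →L[ℝ] ℝ)) ≃ₐ[ℝ] FormOp V :=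
  ((LinearEquiv.ofFinrankEq _ (Fin (extDim V) → ℝ) (by simp)).conjAlgEquiv ℝ).trans
    (AlgEquiv.ofLinearEquiv LinearMap.toContinuousLinearMap rfl (fun _ _ => rfl))

theorem exteriorPower_eq_bot {M : Type*} [AddCommGroup M] [Module ℝ M] [Module.Finite ℝ M] :
    (LinearMap.range (ExteriorAlgebra.ι ℝ (M := M))) ^ (finrank ℝ M + 1) = ⊥ := by
  have := exteriorPower.finrank_eq (R := ℝ) (M := M) (finrank ℝ M + 1)
  rw [Nat.choose_succ_self] at this
  exact Submodule.finrank_eq_zero.1 this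

/-- The form algebra of a finite-dimensional space. -/
noncomputable def formAlgebra : FormAlgebra V (FormOp V) where
  c := LinearMap.toContinuousLinearMap
    ((toFormOp V).toLinearMap ∘ₗ (Algebra.lmul ℝ _).toLinearMap ∘ₗ ExteriorAlgebra.ι ℝ)
  ι v := toFormOp V (CliffordAlgebra.contractLeft
    ((LinearMap.applyₗ v : (V →ₗ[ℝ] ℝ) →ₗ[ℝ] ℝ) ∘ₗ ContinuousLinearMap.coeLM ℝ))
  c_sq a := by
    have : (Algebra.lmul ℝ _ (ExteriorAlgebra.ι ℝ a)) * (Algebra.lmul ℝ _ (ExteriorAlgebra.ι ℝ a))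
      = 0 := by
      rw [← map_mul, ExteriorAlgebra.ι_sq_zero, map_zero]
    have h2 := congrArg (toFormOp V) this
    rw [map_mul, map_zero] at h2
    exact h2
  ι_c v a := by
    set d : Module.Dual ℝ (V →L[ℝ] ℝ) :=
      ((LinearMap.applyₗ v : (V →ₗ[ℝ] ℝ) →ₗ[ℝ] ℝ) ∘ₗ ContinuousLinearMap.coeLM ℝ)
    have h : (CliffordAlgebra.contractLeft (Q := 0) d) * (Algebra.lmul ℝ _ (ExteriorAlgebra.ι ℝ a))
      + (Algebra.lmul ℝ _ (ExteriorAlgebra.ι ℝ a)) * (CliffordAlgebra.contractLeft (Q := 0) d)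
      = algebraMap ℝ _ (a v) := by
      refine LinearMap.ext fun x => ?_
      have := CliffordAlgebra.contractLeft_ι_mul (Q := (0 : QuadraticForm ℝ (V →L[ℝ] ℝ))) (d := d) a x
      change CliffordAlgebra.contractLeft (Q := 0) d (ExteriorAlgebra.ι ℝ a * x) + ExteriorAlgebra.ι ℝ a * (CliffordAlgebra.contractLeft (Q := 0) d x) = _ 
      erw [this]
      simp [d, Module.algebraMap_end_apply]
    have h2 := congrArg (toFormOp V) h
    rw [map_add, map_mul, map_mul, AlgEquiv.commutes] at h2
    exact h2
  range_pow := by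
    have h := exteriorPower_eq_bot (M := V →L[ℝ] ℝ)
    have hd : finrank ℝ (V →L[ℝ] ℝ) = finrank ℝ V := by
      rw [← LinearEquiv.finrank_eq (LinearMap.toContinuousLinearMap (𝕜 := ℝ) (E := V) (F' := ℝ))]
      exact Subspace.dual_finrank_eq
    rw [hd] at h
    have h2 := congrArg (Submodule.map ((toFormOp V).toAlgHom.comp (Algebra.lmul ℝ _)).toLinearMap) h
    rw [Submodule.map_pow, Submodule.map_bot, ← LinearMap.range_comp] at h2
    exact h2

end Existence

end

section

section SquareZero

variable {𝓐 : Type*} [Ring 𝓐]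

theorem add_sq_zero_pow {e ρ : 𝓐} (h : Commute e ρ) (he : e * e = 0) (k : ℕ) :
    (e + ρ) ^ (k + 1) = ρ ^ (k + 1) + (k + 1) • (ρ ^ k * e) := by
  induction k with
  | zero => simp [add_comm]
  | succ k ih =>
    have h1 : e * ρ = ρ * e := h
    rw [pow_succ, ih]
    have h2 : ρ ^ k * e * ρ = ρ ^ (k + 1) * e := by
      rw [mul_assoc, h1, ← mul_assoc, ← pow_succ]
    have h3 : ρ ^ k * e * e = 0 := by rw [mul_assoc, he, mul_zero]
    rw [add_mul, mul_add, smul_mul_assoc, mul_add, h2, h3, pow_succ ρ (k + 1)]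
    simp only [zero_add, add_smul, one_smul]
    abel

variable {J : Type*} [DecidableEq J] {e : J → 𝓐}

theorem sum_sq_zero_pow (hc : ∀ i j, Commute (e i) (e j)) (hs : ∀ i, e i * e i = 0)
    (s : Finset J) : (∑ i ∈ s, e i) ^ (s.card + 1) = 0 := by
  induction s using Finset.induction_on with
  | empty => simp
  | insert a s ha ih =>
    rw [Finset.sum_insert ha, Finset.card_insert_of_notMem ha,
      add_sq_zero_pow (Commute.sum_right _ _ _ fun i _ => hc a i) (hs a), pow_succ, ih]
    simp

theorem mul_sum_sq_zero_pow (hc : ∀ i j, Commute (e i) (e j)) (hs : ∀ i, e i * e i = 0)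
    (s : Finset J) {i : J} (hi : i ∈ s) {y : 𝓐} (hy : y * e i = 0) :
    y * (∑ i ∈ s, e i) ^ s.card = 0 := by
  have h1 : (s.erase i).card + 1 = s.card := Finset.card_erase_add_one hi
  have hcomm : Commute (e i) (∑ j ∈ s.erase i, e j) := Commute.sum_right _ _ _ fun j _ => hc i j
  rw [← Finset.add_sum_erase s e hi, ← h1, add_sq_zero_pow hcomm (hs i),
    sum_sq_zero_pow hc hs, zero_add, mul_smul_comm, ← (hcomm.pow_right _).eq, ← mul_assoc, hy]
  simp

theorem card_smul_sum_pow_mul (hc : ∀ i j, Commute (e i) (e j)) (hs : ∀ i, e i * e i = 0)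
    (s : Finset J) {N : ℕ} (hN : s.card = N + 1) {i : J} (hi : i ∈ s) :
    (N + 1) • ((∑ i ∈ s, e i) ^ N * e i) = (∑ i ∈ s, e i) ^ (N + 1) := by
  have h1 : (s.erase i).card = N := by rw [Finset.card_erase_of_mem hi, hN]; simp
  have hcomm : Commute (e i) (∑ j ∈ s.erase i, e j) := Commute.sum_right _ _ _ fun j _ => hc i j
  have h0 := sum_sq_zero_pow hc hs (s.erase i)
  rw [h1] at h0
  rw [← Finset.add_sum_erase s e hi, add_sq_zero_pow hcomm (hs i), h0, zero_add]
  congr 1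
  cases N with
  | zero => simp
  | succ N =>
    rw [add_sq_zero_pow hcomm (hs i), add_mul, smul_mul_assoc, mul_assoc _ (e i), hs i]
    simp

end SquareZero

section Pairs

variable {𝓐 : Type*} [Ring 𝓐] [Algebra ℝ 𝓐] {J : Type*} {L : Submodule ℝ 𝓐}

/-- Elements of square zero in a subspace consisting of such elements anticommute. -/
theorem anticomm (hL : ∀ a ∈ L, a * a = 0) {a b : 𝓐} (ha : a ∈ L) (hb : b ∈ L) :
    a * b = -(b * a) := by
  have := hL (a + b) (L.add_mem ha hb)
  rw [add_mul, mul_add, mul_add, hL a ha, hL b hb] at this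
  simpa [eq_neg_iff_add_eq_zero] using this

theorem commute_mul (hL : ∀ a ∈ L, a * a = 0) {a b y : 𝓐} (ha : a ∈ L) (hb : b ∈ L) (hy : y ∈ L) :
    Commute (a * b) y := by
  change a * b * y = y * (a * b)
  rw [mul_assoc, anticomm hL hb hy, mul_neg, ← mul_assoc, anticomm hL ha hy, neg_mul, neg_neg,
    mul_assoc]

theorem mul_mul_self (hL : ∀ a ∈ L, a * a = 0) {a b : 𝓐} (ha : a ∈ L) (hb : b ∈ L) :
    (a * b) * (a * b) = 0 := by
  rw [← mul_assoc, (commute_mul hL ha hb ha).eq, ← mul_assoc, hL a ha]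
  simp

variable [DecidableEq J] {X Y : J → 𝓐}

/-- Away from the diagonal, products of elements of two different planes are killed. -/
theorem mul_mul_omega_pow_eq_zero (hL : ∀ a ∈ L, a * a = 0) (hX : ∀ i, X i ∈ L) (hY : ∀ i, Y i ∈ L)
    (s : Finset J) {N : ℕ} (hN : s.card = N + 1) {i j : J} (hi : i ∈ s) (hj : j ∈ s) (hij : i ≠ j)
    {U V : 𝓐} (hU : U ∈ L) (hV : V ∈ L)
    (hUi : U * (X i * Y i) = 0) (hVj : V * (X j * Y j) = 0) :
    U * V * (∑ i ∈ s, X i * Y i) ^ N = 0 := by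
  have hc : ∀ i j, Commute (X i * Y i) (X j * Y j) := fun i j =>
    (commute_mul hL (hX i) (hY i) (hX j)).mul_right (commute_mul hL (hX i) (hY i) (hY j))
  have hs : ∀ i, (X i * Y i) * (X i * Y i) = 0 := fun i => mul_mul_self hL (hX i) (hY i)
  obtain _ | N := N
  · exact absurd (Finset.card_eq_one.1 hN) (by
      rintro ⟨a, rfl⟩; simp at hi hj; exact hij (hi.trans hj.symm))
  have hcard : (s.erase j).card = N + 1 := by rw [Finset.card_erase_of_mem hj, hN]; simp
  have hcomm : Commute (X j * Y j) (∑ i ∈ s.erase j, X i * Y i) :=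
    Commute.sum_right _ _ _ fun i _ => hc j i
  rw [← Finset.add_sum_erase s (fun i => X i * Y i) hj, add_sq_zero_pow hcomm (hs j), mul_add,
    mul_smul_comm, ← (hcomm.pow_right _).eq]
  have h1 : U * V * (X j * Y j * (∑ i ∈ s.erase j, X i * Y i) ^ N) = 0 := by
    rw [← mul_assoc, mul_assoc U V, hVj]; simp
  have h2 : U * V * (∑ i ∈ s.erase j, X i * Y i) ^ (N + 1) = 0 := by
    rw [anticomm hL hU hV, neg_mul, mul_assoc, ← hcard,
      mul_sum_sq_zero_pow hc hs _ (Finset.mem_erase.2 ⟨hij, hi⟩) hUi]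
    simp
  rw [h1, h2]; simp

end Pairs

end

section

section Weighted

variable {𝓐 : Type*} [Ring 𝓐] [Algebra ℝ 𝓐] {J : Type*} [Fintype J] {L : Submodule ℝ 𝓐}

/-- `Σ (x dy - y dx)`. -/
def liouville (x y : J → ℝ) (X Y : J → 𝓐) : 𝓐 := ∑ j, (x j • Y j - y j • X j)

/-- The differential of `Σ k (x² + y²)`. -/
def normDiff (k x y : J → ℝ) (X Y : J → 𝓐) : 𝓐 := ∑ j, (2 * k j) • (x j • X j + y j • Y j)

/-- `Σ dx dy`. -/
def area (X Y : J → 𝓐) : 𝓐 := ∑ j, X j * Y j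

/-- `Σ k (x² + y²)`. -/
def wnorm (k x y : J → ℝ) : ℝ := ∑ j, k j * (x j ^ 2 + y j ^ 2)

/-- The differential of `ν(D) A`, where `D` is the weighted norm and `A` the Liouville form. -/
def curvature (ν ν' : ℝ) (k x y : J → ℝ) (X Y : J → 𝓐) : 𝓐 :=
  ν' • (normDiff k x y X Y * liouville x y X Y) + (2 * ν) • area X Y

variable {k x y : J → ℝ} {X Y : J → 𝓐}

theorem liouville_mem (hX : ∀ i, X i ∈ L) (hY : ∀ i, Y i ∈ L) : liouville x y X Y ∈ L :=
  L.sum_mem fun j _ => L.sub_mem (L.smul_mem _ (hY j)) (L.smul_mem _ (hX j))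

theorem normDiff_mem (hX : ∀ i, X i ∈ L) (hY : ∀ i, Y i ∈ L) : normDiff k x y X Y ∈ L :=
  L.sum_mem fun j _ => L.smul_mem _ (L.add_mem (L.smul_mem _ (hX j)) (L.smul_mem _ (hY j)))

theorem area_mem (hX : ∀ i, X i ∈ L) (hY : ∀ i, Y i ∈ L) : area X Y ∈ L ^ 2 := by
  rw [pow_two]
  exact Submodule.sum_mem _ fun j _ => Submodule.mul_mem_mul (hX j) (hY j)

theorem curvature_mem {ν ν' : ℝ} (hX : ∀ i, X i ∈ L) (hY : ∀ i, Y i ∈ L) :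
    curvature ν ν' k x y X Y ∈ L ^ 2 := by
  refine Submodule.add_mem _ (Submodule.smul_mem _ _ ?_) (Submodule.smul_mem _ _ (area_mem hX hY))
  rw [pow_two]
  exact Submodule.mul_mem_mul (normDiff_mem hX hY) (liouville_mem hX hY)

theorem area_commute (hL : ∀ a ∈ L, a * a = 0) (hX : ∀ i, X i ∈ L) (hY : ∀ i, Y i ∈ L)
    {a : 𝓐} (ha : a ∈ L) : Commute (area X Y) a :=
  Commute.sum_left _ _ _ fun j _ => commute_mul hL (hX j) (hY j) ha

theorem curvature_commute (hL : ∀ a ∈ L, a * a = 0) (hX : ∀ i, X i ∈ L) (hY : ∀ i, Y i ∈ L)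
    {ν ν' : ℝ} {a : 𝓐} (ha : a ∈ L) : Commute (curvature ν ν' k x y X Y) a :=
  ((commute_mul hL (normDiff_mem hX hY) (liouville_mem hX hY) ha).smul_left _).add_left
    ((area_commute hL hX hY ha).smul_left _)

theorem normDiff_mul_liouville_mul_area_pow [DecidableEq J] (hL : ∀ a ∈ L, a * a = 0)
    (hX : ∀ i, X i ∈ L) (hY : ∀ i, Y i ∈ L) {N : ℕ} (hN : Fintype.card J = N + 1) :
    (N + 1) • (normDiff k x y X Y * liouville x y X Y * area X Y ^ N) =
      (2 * wnorm k x y) • area X Y ^ (N + 1) := by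
  have hc : ∀ i j, Commute (X i * Y i) (X j * Y j) := fun i j =>
    (commute_mul hL (hX i) (hY i) (hX j)).mul_right (commute_mul hL (hX i) (hY i) (hY j))
  have hs : ∀ i, (X i * Y i) * (X i * Y i) = 0 := fun i => mul_mul_self hL (hX i) (hY i)
  have hXk : ∀ i, X i * (X i * Y i) = 0 := fun i => by
    rw [← mul_assoc, hL _ (hX i), zero_mul]
  have hYk : ∀ i, Y i * (X i * Y i) = 0 := fun i => by
    rw [anticomm hL (hX i) (hY i), mul_neg, ← mul_assoc, hL _ (hY i), zero_mul, neg_zero]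
  have hdiag : ∀ i, ((2 * k i) • (x i • X i + y i • Y i)) * (x i • Y i - y i • X i) =
      (2 * (k i * (x i ^ 2 + y i ^ 2))) • (X i * Y i) := fun i => by
    have h := anticomm hL (hY i) (hX i)
    simp only [smul_mul_assoc, add_mul, mul_sub, mul_smul_comm, hL _ (hX i), hL _ (hY i), h]
    module
  have key : ∀ i, ((2 * k i) • (x i • X i + y i • Y i)) * liouville x y X Y * area X Y ^ N =
      (2 * (k i * (x i ^ 2 + y i ^ 2))) • (area X Y ^ N * (X i * Y i)) := by
    intro i
    rw [liouville, Finset.mul_sum, Finset.sum_mul, Finset.sum_eq_single i]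
    · rw [hdiag, smul_mul_assoc]
      congr 1
      exact ((Commute.sum_right _ _ _ fun j _ => hc i j : Commute (X i * Y i) (area X Y)).pow_right _)
    · intro j _ hji
      refine mul_mul_omega_pow_eq_zero hL hX hY Finset.univ (by simpa using hN) (Finset.mem_univ i)
        (Finset.mem_univ j) (Ne.symm hji) (L.smul_mem _ (L.add_mem (L.smul_mem _ (hX i))
          (L.smul_mem _ (hY i)))) (L.sub_mem (L.smul_mem _ (hY j)) (L.smul_mem _ (hX j))) ?_ ?_
      · simp [add_mul, hXk, hYk]
      · simp [sub_mul, hXk, hYk]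
    · simp
  have h2 : ∀ i, (N + 1) • (area X Y ^ N * (X i * Y i)) = area X Y ^ (N + 1) := fun i =>
    card_smul_sum_pow_mul hc hs Finset.univ (by simpa using hN) (Finset.mem_univ i)
  conv_lhs => rw [normDiff, Finset.sum_mul, Finset.sum_mul, Finset.smul_sum]
  rw [wnorm, Finset.mul_sum, Finset.sum_smul]
  refine Finset.sum_congr rfl fun i _ => ?_
  rw [key, smul_comm, h2]

theorem normDiff_mul_liouville_sq (hL : ∀ a ∈ L, a * a = 0)
    (hX : ∀ i, X i ∈ L) (hY : ∀ i, Y i ∈ L) :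
    (normDiff k x y X Y * liouville x y X Y) * (normDiff k x y X Y * liouville x y X Y) = 0 :=
  mul_mul_self hL (normDiff_mem hX hY) (liouville_mem hX hY)

theorem curvature_pow_eq_zero [DecidableEq J] (hL : ∀ a ∈ L, a * a = 0)
    (hX : ∀ i, X i ∈ L) (hY : ∀ i, Y i ∈ L) {N : ℕ} (hN : Fintype.card J = N + 1) {ν ν' : ℝ}
    (hν : ν + ν' * wnorm k x y = 0) : curvature ν ν' k x y X Y ^ (N + 1) = 0 := by
  have hcomm : Commute (ν' • (normDiff k x y X Y * liouville x y X Y)) ((2 * ν) • area X Y) := by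
    refine Commute.smul_left (Commute.smul_right (Commute.symm ?_) _) _
    exact (area_commute hL hX hY (normDiff_mem hX hY)).mul_right
      (area_commute hL hX hY (liouville_mem hX hY))
  have hA : Commute (normDiff k x y X Y * liouville x y X Y) (area X Y ^ N) :=
    (((area_commute hL hX hY (normDiff_mem hX hY)).mul_right
      (area_commute hL hX hY (liouville_mem hX hY))).symm).pow_right _
  rw [curvature, add_sq_zero_pow hcomm (by
    rw [smul_mul_smul_comm, normDiff_mul_liouville_sq hL hX hY, smul_zero]), smul_pow, smul_pow,
    smul_mul_smul_comm, ← hA.eq, smul_comm, normDiff_mul_liouville_mul_area_pow hL hX hY hN,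
    smul_smul, ← add_smul]
  have : (2 * ν) ^ (N + 1) + (2 * ν) ^ N * ν' * (2 * wnorm k x y) = 0 := by
    linear_combination 2 * (2 * ν) ^ N * hν
  rw [this, zero_smul]

theorem normDiff_mul_liouville_mul_curvature_pow [DecidableEq J] (hL : ∀ a ∈ L, a * a = 0)
    (hX : ∀ i, X i ∈ L) (hY : ∀ i, Y i ∈ L) {N : ℕ} (hN : Fintype.card J = N + 1) {ν ν' : ℝ} :
    (N + 1) • (normDiff k x y X Y * liouville x y X Y * curvature ν ν' k x y X Y ^ N) =
      ((2 * ν) ^ N * (2 * wnorm k x y)) • area X Y ^ (N + 1) := by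
  have hq := normDiff_mul_liouville_sq (k := k) (x := x) (y := y) hL hX hY
  have hcomm : Commute (ν' • (normDiff k x y X Y * liouville x y X Y)) ((2 * ν) • area X Y) := by
    refine Commute.smul_left (Commute.smul_right (Commute.symm ?_) _) _
    exact (area_commute hL hX hY (normDiff_mem hX hY)).mul_right
      (area_commute hL hX hY (liouville_mem hX hY))
  have h : normDiff k x y X Y * liouville x y X Y * curvature ν ν' k x y X Y ^ N =
      (2 * ν) ^ N • (normDiff k x y X Y * liouville x y X Y * area X Y ^ N) := by
    cases N with
    | zero => simp
    | succ N =>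
      rw [curvature, add_sq_zero_pow hcomm (by rw [smul_mul_smul_comm, hq, smul_zero]),
        ← (hcomm.pow_right N).eq, mul_add, mul_smul_comm, ← mul_assoc _ (ν' • _), mul_smul_comm ν',
        hq, smul_pow, mul_smul_comm]
      simp
  rw [h, smul_comm, normDiff_mul_liouville_mul_area_pow hL hX hY hN, smul_smul]

section Contraction

variable {i : 𝓐} (hiX : ∀ j, i * X j + X j * i = algebraMap ℝ 𝓐 (-(k j * y j)))
  (hiY : ∀ j, i * Y j + Y j * i = algebraMap ℝ 𝓐 (k j * x j))
include hiX hiY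

theorem contract_liouville :
    i * liouville x y X Y + liouville x y X Y * i = algebraMap ℝ 𝓐 (wnorm k x y) := by
  rw [liouville, Finset.mul_sum, Finset.sum_mul, ← Finset.sum_add_distrib, wnorm, map_sum]
  refine Finset.sum_congr rfl fun j _ => ?_
  have : i * (x j • Y j - y j • X j) + (x j • Y j - y j • X j) * i =
    x j • (i * Y j + Y j * i) - y j • (i * X j + X j * i) := by
    simp only [mul_sub, sub_mul, mul_smul_comm, smul_mul_assoc]; module
  rw [this, hiX, hiY, Algebra.algebraMap_eq_smul_one, Algebra.algebraMap_eq_smul_one,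
    Algebra.algebraMap_eq_smul_one]
  module

theorem contract_normDiff : i * normDiff k x y X Y = -(normDiff k x y X Y * i) := by
  rw [eq_neg_iff_add_eq_zero, normDiff, Finset.mul_sum, Finset.sum_mul, ← Finset.sum_add_distrib]
  refine Finset.sum_eq_zero fun j _ => ?_
  have : i * ((2 * k j) • (x j • X j + y j • Y j)) + ((2 * k j) • (x j • X j + y j • Y j)) * i =
    (2 * k j) • (x j • (i * X j + X j * i) + y j • (i * Y j + Y j * i)) := by
    simp only [mul_add, add_mul, mul_smul_comm, smul_mul_assoc]; module
  rw [this, hiX, hiY, Algebra.algebraMap_eq_smul_one, Algebra.algebraMap_eq_smul_one]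
  module

theorem contract_area :
    i * area X Y = area X Y * i - (1 / 2 : ℝ) • normDiff k x y X Y := by
  rw [eq_sub_iff_add_eq, area, normDiff, Finset.mul_sum, Finset.sum_mul, Finset.smul_sum,
    ← Finset.sum_add_distrib]
  refine Finset.sum_congr rfl fun j _ => ?_
  have h1 : i * X j = algebraMap ℝ 𝓐 (-(k j * y j)) - X j * i := eq_sub_of_add_eq (hiX j)
  have h2 : i * Y j = algebraMap ℝ 𝓐 (k j * x j) - Y j * i := eq_sub_of_add_eq (hiY j)
  rw [← mul_assoc, h1, sub_mul, mul_assoc, h2, Algebra.algebraMap_eq_smul_one,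
    Algebra.algebraMap_eq_smul_one, mul_sub, smul_mul_assoc, one_mul, mul_smul_comm, mul_one,
    mul_assoc]
  module

theorem contract_curvature {ν ν' : ℝ} (hν : ν + ν' * wnorm k x y = 0) :
    Commute i (curvature ν ν' k x y X Y) := by
  have h1 : i * (normDiff k x y X Y * liouville x y X Y) =
      (normDiff k x y X Y * liouville x y X Y) * i - wnorm k x y • normDiff k x y X Y := by
    rw [← mul_assoc, contract_normDiff hiX hiY, neg_mul, mul_assoc,
      eq_sub_of_add_eq (contract_liouville hiX hiY), Algebra.algebraMap_eq_smul_one, mul_sub,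
      mul_smul_comm, mul_one, mul_assoc]
    abel
  change i * curvature ν ν' k x y X Y = _
  rw [curvature, mul_add, add_mul, mul_smul_comm, mul_smul_comm, h1, contract_area hiX hiY,
    smul_mul_assoc, smul_mul_assoc]
  have : ν = - (ν' * wnorm k x y) := by linarith
  rw [this]
  module

end Contraction

end Weighted

end

section

section Peel

variable {𝓐 : Type*} [Ring 𝓐]

/-- If a plane is dual to a pair of contractions commuting with `z`, multiplication by the
plane does not kill `z`. -/
theorem eq_zero_of_mul_mul_eq_zero {a b ia ib z : 𝓐} (haa : ia * a + a * ia = 1)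
    (hab : ia * b + b * ia = 0) (hbb : ib * b + b * ib = 1)
    (hza : Commute ia z) (hzb : Commute ib z) (h : a * b * z = 0) : z = 0 := by
  have h1 : b * z = 0 := by
    have e1 : ia * a = 1 - a * ia := eq_sub_of_add_eq haa
    have e2 : ia * b = -(b * ia) := eq_neg_of_add_eq_zero_left hab
    have : ia * (a * b * z) = b * z + a * b * z * ia := by
      calc ia * (a * b * z) = ia * a * (b * z) := by noncomm_ring
        _ = b * z - a * (ia * b) * z := by rw [e1]; noncomm_ring
        _ = b * z + a * b * (ia * z) := by rw [e2]; noncomm_ring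
        _ = _ := by rw [hza.eq]; noncomm_ring
    rw [h] at this
    simpa using this.symm
  have e1 : ib * b = 1 - b * ib := eq_sub_of_add_eq hbb
  have : ib * (b * z) = z - b * z * ib := by
    calc ib * (b * z) = ib * b * z := by noncomm_ring
      _ = z - b * (ib * z) := by rw [e1]; noncomm_ring
      _ = _ := by rw [hzb.eq]; noncomm_ring
  rw [h1] at this
  simpa using this.symm

variable [Algebra ℝ 𝓐] {J : Type*} [DecidableEq J] {L : Submodule ℝ 𝓐} {X Y iX iY : J → 𝓐}

theorem eq_zero_of_area_pow_mul_eq_zero (hL : ∀ a ∈ L, a * a = 0) (hX : ∀ i, X i ∈ L)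
    (hY : ∀ i, Y i ∈ L)
    (hXX : ∀ i j, iX i * X j + X j * iX i = if i = j then 1 else 0)
    (hXY : ∀ i j, iX i * Y j + Y j * iX i = 0)
    (hYX : ∀ i j, iY i * X j + X j * iY i = 0)
    (hYY : ∀ i j, iY i * Y j + Y j * iY i = if i = j then 1 else 0)
    (s : Finset J) {z : 𝓐} (hzX : ∀ i, Commute (iX i) z) (hzY : ∀ i, Commute (iY i) z)
    (h : (∑ j ∈ s, X j * Y j) ^ s.card * z = 0) : z = 0 := by
  have hc : ∀ i j, Commute (X i * Y i) (X j * Y j) := fun i j =>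
    (commute_mul hL (hX i) (hY i) (hX j)).mul_right (commute_mul hL (hX i) (hY i) (hY j))
  have hs : ∀ i, (X i * Y i) * (X i * Y i) = 0 := fun i => mul_mul_self hL (hX i) (hY i)
  have comm : ∀ {i a b : 𝓐}, i * a + a * i = 0 → i * b + b * i = 0 → Commute i (a * b) := by
    intro i a b h1 h2
    change i * (a * b) = a * b * i
    rw [← mul_assoc, eq_neg_of_add_eq_zero_left h1, neg_mul, mul_assoc,
      eq_neg_of_add_eq_zero_left h2]
    noncomm_ring
  induction s using Finset.induction_on with
  | empty => simpa using h
  | insert a s ha ih =>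
    apply ih
    rw [Finset.sum_insert ha, Finset.card_insert_of_notMem ha,
      add_sq_zero_pow (Commute.sum_right _ _ _ fun i _ => hc a i) (hs a),
      sum_sq_zero_pow hc hs, zero_add, smul_mul_assoc] at h
    have h' : X a * Y a * ((∑ j ∈ s, X j * Y j) ^ s.card * z) = 0 := by
      rw [← Nat.cast_smul_eq_nsmul ℝ] at h
      have h2 := (smul_eq_zero.1 h).resolve_left (by positivity)
      rwa [← ((Commute.sum_right _ _ _ fun i _ => hc a i : Commute (X a * Y a)
        (∑ j ∈ s, X j * Y j)).pow_right _).eq, mul_assoc] at h2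
    have key : ∀ i, i ∈ s → a ≠ i := fun i hi h => ha (h ▸ hi)
    refine eq_zero_of_mul_mul_eq_zero (ia := iX a) (ib := iY a) (by simpa using hXX a a) (hXY a a)
      (by simpa using hYY a a) ?_ ?_ h'
    · refine Commute.mul_right (Commute.pow_right (Commute.sum_right _ _ _ fun j hj => ?_) _) (hzX a)
      exact comm (by simpa [key j hj] using hXX a j) (hXY a j)
    · refine Commute.mul_right (Commute.pow_right (Commute.sum_right _ _ _ fun j hj => ?_) _) (hzY a)
      exact comm (hYX a j) (by simpa [key j hj] using hYY a j)

end Peel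

namespace FormAlgebra

variable {V 𝓐 : Type*} [NormedAddCommGroup V] [NormedSpace ℝ V] [NormedRing 𝓐]
    [NormedAlgebra ℝ 𝓐] (𝓕 : FormAlgebra V 𝓐)

/-- The space of constant one-forms. -/
noncomputable abbrev L : Submodule ℝ 𝓐 := LinearMap.range 𝓕.c.toLinearMap

theorem c_mem (a : V →L[ℝ] ℝ) : 𝓕.c a ∈ 𝓕.L := ⟨a, rfl⟩

theorem sq_of_mem : ∀ a ∈ 𝓕.L, a * a = 0 := by
  rintro _ ⟨a, rfl⟩; exact 𝓕.c_sq a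

theorem eq_zero_of_mem_pow {ξ : V} (hξ : ξ ≠ 0) {x : 𝓐} (hx : x ∈ 𝓕.L ^ finrank ℝ V)
    (hc : Commute (𝓕.ι ξ) x) : x = 0 := by
  obtain ⟨η, hη⟩ := SeparatingDual.exists_eq_one (R := ℝ) hξ
  have h0 : 𝓕.c η * x = 0 := by
    have : 𝓕.c η * x ∈ 𝓕.L ^ (finrank ℝ V + 1) := by
      rw [pow_succ']; exact Submodule.mul_mem_mul (𝓕.c_mem η) hx
    rw [L, 𝓕.range_pow] at this
    exact this
  have h1 := congrArg (· * x) (𝓕.ι_c ξ η)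
  simp only [hη, map_one, one_mul, add_mul, mul_assoc, h0, hc.eq, mul_zero, zero_add] at h1
  rw [← h1, ← mul_assoc, h0, zero_mul]

/-- The pointwise identity behind the vanishing of the exterior derivative of the transgression
form. -/
theorem transgression_eq_zero {ξ : V} (hξ : ξ ≠ 0) {r α δ Tq TF Ω : 𝓐} {N q : ℕ}
    (hd : finrank ℝ V = 1 + (2 + (1 + (2 * N + 2 * q))))
    (hr : r ∈ 𝓕.L) (hδ : δ ∈ 𝓕.L) (hTq : Tq ∈ 𝓕.L ^ 2) (hTF : TF ∈ 𝓕.L ^ 2)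
    (hΩ : Ω ∈ 𝓕.L ^ (2 * q)) (ir : 𝓕.ι ξ * r = -(r * 𝓕.ι ξ)) (iδ : 𝓕.ι ξ * δ = -(δ * 𝓕.ι ξ))
    (iTq : Commute (𝓕.ι ξ) Tq) (iTF : Commute (𝓕.ι ξ) TF) (iΩ : Commute (𝓕.ι ξ) Ω)
    (hcomm : Commute TF Tq) (hq : Tq ^ (N + 1) = 0) (hF : TF ^ (N + 1) = 0) :
    r * (Tq * δ - α * (TF - Tq)) * (∑ i ∈ Finset.range (N + 1), TF ^ i * Tq ^ (N + 1 - 1 - i)) * Ω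
      = 0 := by
  set S := ∑ i ∈ Finset.range (N + 1), TF ^ i * Tq ^ (N + 1 - 1 - i) with hS
  have h1 : (TF - Tq) * S = 0 := by rw [hS, hcomm.mul_geom_sum₂, hq, hF, sub_zero]
  have hSm : S ∈ 𝓕.L ^ (2 * N) := by
    refine Submodule.sum_mem _ fun i hi => ?_
    have hi' : i ≤ N := Nat.lt_succ_iff.1 (Finset.mem_range.1 hi)
    have : 2 * N = 2 * i + 2 * (N + 1 - 1 - i) := by omega
    rw [this, pow_add, pow_mul, pow_mul]
    exact Submodule.mul_mem_mul (Submodule.pow_mem_pow _ hTF _) (Submodule.pow_mem_pow _ hTq _)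
  have iS : Commute (𝓕.ι ξ) S :=
    Commute.sum_right _ _ _ fun i _ => (iTF.pow_right _).mul_right (iTq.pow_right _)
  have h2 : r * (Tq * (δ * (S * Ω))) = 0 := by
    refine 𝓕.eq_zero_of_mem_pow hξ ?_ ?_
    · rw [hd, pow_add, pow_one, pow_add _ 2, pow_add _ 1, pow_one, pow_add]
      exact Submodule.mul_mem_mul hr (Submodule.mul_mem_mul hTq (Submodule.mul_mem_mul hδ
        (Submodule.mul_mem_mul hSm hΩ)))
    · change _ = _
      rw [← mul_assoc, ir, neg_mul, mul_assoc r, ← mul_assoc _ Tq, iTq.eq, mul_assoc Tq,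
        ← mul_assoc _ δ, iδ, neg_mul, mul_assoc δ, (iS.mul_right iΩ).eq]
      noncomm_ring
  calc _ = r * (Tq * (δ * (S * Ω))) - r * α * ((TF - Tq) * S) * Ω := by noncomm_ring
    _ = 0 := by rw [h1, h2]; simp

end FormAlgebra

end

section

namespace FormAlgebra

variable {V 𝓐 : Type*} [NormedAddCommGroup V] [NormedSpace ℝ V] [FiniteDimensional ℝ V]
  [NormedRing 𝓐] [NormedAlgebra ℝ 𝓐] (𝓕 : FormAlgebra V 𝓐)

/-- Antisymmetrization `V* ⊗ 𝓐 → 𝓐`. -/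
noncomputable def ext : (V →L[ℝ] 𝓐) →ₗ[ℝ] 𝓐 where
  toFun T := ∑ i, 𝓕.c (LinearMap.toContinuousLinearMap ((finBasis ℝ V).coord i)) * T (finBasis ℝ V i)
  map_add' S T := by simp [mul_add, Finset.sum_add_distrib]
  map_smul' r T := by simp [Finset.smul_sum]

theorem ext_apply (T : V →L[ℝ] 𝓐) : 𝓕.ext T =
    ∑ i, 𝓕.c (LinearMap.toContinuousLinearMap ((finBasis ℝ V).coord i)) * T (finBasis ℝ V i) := rfl

theorem sum_basis (a : V →L[ℝ] ℝ) :
    ∑ i, a (finBasis ℝ V i) • LinearMap.toContinuousLinearMap ((finBasis ℝ V).coord i) = a := by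
  ext v
  conv_rhs => rw [← (finBasis ℝ V).sum_repr v, map_sum]
  simp [mul_comm]

theorem sum_c_basis (a : V →L[ℝ] ℝ) :
    ∑ i, a (finBasis ℝ V i) • 𝓕.c (LinearMap.toContinuousLinearMap ((finBasis ℝ V).coord i))
      = 𝓕.c a := by
  conv_rhs => rw [← sum_basis a, map_sum]
  simp

theorem ext_smulRight (a : V →L[ℝ] ℝ) (y : 𝓐) : 𝓕.ext (a.smulRight y) = 𝓕.c a * y := by
  rw [ext_apply, ← 𝓕.sum_c_basis a, Finset.sum_mul]
  simp

omit [FiniteDimensional ℝ V] in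
theorem anticomm_c {a b : V →L[ℝ] ℝ} : 𝓕.c a * 𝓕.c b = -(𝓕.c b * 𝓕.c a) :=
  anticomm 𝓕.sq_of_mem (𝓕.c_mem a) (𝓕.c_mem b)

theorem ext_symm (T : V →L[ℝ] V →L[ℝ] ℝ) (h : ∀ v w, T v w = T w v) :
    𝓕.ext (𝓕.c ∘L T) = 0 := by
  set S := 𝓕.ext (𝓕.c ∘L T) with hS
  have h1 : S = ∑ i, ∑ j, T (finBasis ℝ V i) (finBasis ℝ V j) •
      (𝓕.c (LinearMap.toContinuousLinearMap ((finBasis ℝ V).coord i)) *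
        𝓕.c (LinearMap.toContinuousLinearMap ((finBasis ℝ V).coord j))) := by
    rw [hS, ext_apply]
    refine Finset.sum_congr rfl fun i _ => ?_
    rw [ContinuousLinearMap.comp_apply, ← 𝓕.sum_c_basis (T _), Finset.mul_sum]
    simp
  have h2 : S = -S := by
    conv_lhs => rw [h1, Finset.sum_comm]
    rw [h1, ← Finset.sum_neg_distrib]
    refine Finset.sum_congr rfl fun i _ => ?_
    rw [← Finset.sum_neg_distrib]
    refine Finset.sum_congr rfl fun j _ => ?_
    rw [h, 𝓕.anticomm_c, smul_neg]
  have h3 : (2 : ℝ) • S = 0 := by rw [two_smul]; nth_rw 2 [h2]; exact add_neg_cancel S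
  exact (smul_eq_zero.1 h3).resolve_left two_ne_zero

/-- `f` is differentiable at `v` with exterior derivative `f'`. -/
def HasExtDeriv (f : V → 𝓐) (f' : 𝓐) (v : V) : Prop :=
  ∃ T : V →L[ℝ] 𝓐, HasFDerivAt f T v ∧ 𝓕.ext T = f'

variable {𝓕} {f g : V → 𝓐} {f' g' : 𝓐} {v : V}

theorem HasExtDeriv.congr_deriv (h : 𝓕.HasExtDeriv f f' v) (e : f' = g') : 𝓕.HasExtDeriv f g' v :=
  e ▸ h

theorem hasExtDeriv_const (y : 𝓐) : 𝓕.HasExtDeriv (fun _ => y) 0 v :=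
  ⟨0, hasFDerivAt_const y v, map_zero _⟩

theorem HasExtDeriv.add (hf : 𝓕.HasExtDeriv f f' v) (hg : 𝓕.HasExtDeriv g g' v) :
    𝓕.HasExtDeriv (fun v => f v + g v) (f' + g') v := by
  obtain ⟨S, hS, rfl⟩ := hf
  obtain ⟨T, hT, rfl⟩ := hg
  exact ⟨S + T, hS.add hT, map_add _ _ _⟩

theorem HasExtDeriv.sub (hf : 𝓕.HasExtDeriv f f' v) (hg : 𝓕.HasExtDeriv g g' v) :
    𝓕.HasExtDeriv (fun v => f v - g v) (f' - g') v := by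
  obtain ⟨S, hS, rfl⟩ := hf
  obtain ⟨T, hT, rfl⟩ := hg
  exact ⟨S - T, hS.sub hT, map_sub _ _ _⟩

theorem HasExtDeriv.sum {I : Type*} {s : Finset I} {f : I → V → 𝓐} {f' : I → 𝓐}
    (h : ∀ i ∈ s, 𝓕.HasExtDeriv (f i) (f' i) v) :
    𝓕.HasExtDeriv (fun v => ∑ i ∈ s, f i v) (∑ i ∈ s, f' i) v := by
  classical
  induction s using Finset.induction_on with
  | empty => simpa using hasExtDeriv_const (0 : 𝓐)
  | insert a s ha ih =>
    simp only [Finset.sum_insert ha]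
    exact (h a (by simp)).add (ih fun i hi => h i (by simp [hi]))

theorem HasExtDeriv.smul {r : V → ℝ} {r' : V →L[ℝ] ℝ} (hr : HasFDerivAt r r' v)
    (hf : 𝓕.HasExtDeriv f f' v) :
    𝓕.HasExtDeriv (fun v => r v • f v) (𝓕.c r' * f v + r v • f') v := by
  obtain ⟨S, hS, rfl⟩ := hf
  refine ⟨_, hr.smul hS, ?_⟩
  rw [map_add, map_smul, ext_smulRight, add_comm]

theorem HasExtDeriv.const_smul (r : ℝ) (hf : 𝓕.HasExtDeriv f f' v) :
    𝓕.HasExtDeriv (fun v => r • f v) (r • f') v :=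
  (HasExtDeriv.smul (hasFDerivAt_const r v) hf).congr_deriv (by simp)

theorem HasExtDeriv.mul_of_commute (hc : ∀ a, Commute (f v) (𝓕.c a))
    (hf : 𝓕.HasExtDeriv f f' v) (hg : 𝓕.HasExtDeriv g g' v) :
    𝓕.HasExtDeriv (fun v => f v * g v) (f' * g v + f v * g') v := by
  obtain ⟨S, hS, rfl⟩ := hf
  obtain ⟨T, hT, rfl⟩ := hg
  refine ⟨_, hS.mul' hT, ?_⟩
  rw [map_add, add_comm]
  congr 1
  · rw [ext_apply, ext_apply, Finset.sum_mul]
    simp [mul_assoc]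
  · rw [ext_apply, ext_apply, Finset.mul_sum]
    refine Finset.sum_congr rfl fun i _ => ?_
    simp only [_root_.smul_apply, smul_eq_mul]
    rw [← mul_assoc, ← (hc _).eq, mul_assoc]

theorem HasExtDeriv.mul_of_mem (hL : f v ∈ 𝓕.L)
    (hf : 𝓕.HasExtDeriv f f' v) (hg : 𝓕.HasExtDeriv g g' v) :
    𝓕.HasExtDeriv (fun v => f v * g v) (f' * g v - f v * g') v := by
  obtain ⟨S, hS, rfl⟩ := hf
  obtain ⟨T, hT, rfl⟩ := hg
  refine ⟨_, hS.mul' hT, ?_⟩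
  rw [map_add, add_comm, sub_eq_add_neg]
  congr 1
  · rw [ext_apply, ext_apply, Finset.sum_mul]
    simp [mul_assoc]
  · rw [ext_apply, ext_apply, Finset.mul_sum, ← Finset.sum_neg_distrib]
    refine Finset.sum_congr rfl fun i _ => ?_
    simp only [_root_.smul_apply, smul_eq_mul]
    rw [← mul_assoc, anticomm 𝓕.sq_of_mem (𝓕.c_mem _) hL, neg_mul, mul_assoc]

/-- Powers of closed even forms are closed. -/
theorem HasExtDeriv.pow_of_closed (hc : ∀ a, Commute (f v) (𝓕.c a))
    (hf : 𝓕.HasExtDeriv f 0 v) (n : ℕ) : 𝓕.HasExtDeriv (fun v => f v ^ n) 0 v := by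
  induction n with
  | zero => simpa using hasExtDeriv_const (1 : 𝓐)
  | succ n ih =>
    simp only [pow_succ']
    exact (hf.mul_of_commute hc ih).congr_deriv (by simp)

theorem hasExtDeriv_c_fderiv {r : V → ℝ} (hr : ContDiff ℝ 2 r) :
    𝓕.HasExtDeriv (fun v => 𝓕.c (fderiv ℝ r v)) 0 v := by
  have h1 : ContDiff ℝ 1 (fderiv ℝ r) := hr.fderiv_right (by norm_num)
  refine ⟨𝓕.c ∘L fderiv ℝ (fderiv ℝ r) v,
    𝓕.c.hasFDerivAt.comp v ((h1.differentiable one_ne_zero) v).hasFDerivAt, 𝓕.ext_symm _ ?_⟩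
  have := hr.contDiffAt (x := v) |>.isSymmSndFDerivAt (by simp)
  exact fun v w => this v w

open MeasureTheory in
theorem integral_ext_eq_zero [MeasurableSpace V] [BorelSpace V] {μ : Measure V}
    [μ.IsAddHaarMeasure] {W W' : V → 𝓐} (hW : ContDiff ℝ 1 W) (hs : HasCompactSupport W)
    (h : ∀ v, 𝓕.HasExtDeriv W (W' v) v) (ℓ : 𝓐 →L[ℝ] ℝ) : ∫ v, ℓ (W' v) ∂μ = 0 := by
  have hW' : ∀ v, W' v = 𝓕.ext (fderiv ℝ W v) := fun v => by
    obtain ⟨T, hT, e⟩ := h v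
    rw [hT.fderiv, e]
  have hcont := hW.continuous_fderiv one_ne_zero
  have hsupp : HasCompactSupport (fderiv ℝ W) := hs.fderiv ℝ
  have key : ∀ i, ∀ m : 𝓐 →L[ℝ] ℝ, Integrable (fun v => m (fderiv ℝ W v i)) μ ∧
      ∫ v, m (fderiv ℝ W v i) ∂μ = 0 := by
    intro i m
    have hstokes : Integrable (fun v => m (fderiv ℝ W v i)) μ := by
      refine Continuous.integrable_of_hasCompactSupport (by fun_prop) ?_
      exact hsupp.comp_left (g := fun T : V →L[ℝ] 𝓐 => m (T i)) (by simp)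
    refine ⟨hstokes, ?_⟩
    have hd : Differentiable ℝ (fun v => m (W v)) :=
      m.differentiable.comp (hW.differentiable one_ne_zero)
    have hfd : ∀ v, fderiv ℝ (fun v => m (W v)) v i = m (fderiv ℝ W v i) := fun v => by
      have := m.hasFDerivAt.comp v ((hW.differentiable one_ne_zero) v).hasFDerivAt
      exact congrArg (· i) this.fderiv
    have := integral_mul_fderiv_eq_neg_fderiv_mul_of_integrable (μ := μ) (𝕜 := ℝ)
      (f := fun _ : V => (1 : ℝ)) (g := fun v => m (W v)) (v := i) (by simp)
      (by simpa [hfd] using hstokes) (by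
        simp only [one_mul]
        exact (m.continuous.comp hW.continuous).integrable_of_hasCompactSupport
          (hs.comp_left (g := m) (map_zero m)))
      (fun x _ => by fun_prop) (fun x _ => hd x)
    simpa [hfd] using this
  have hm : ∀ v, ℓ (W' v) = ∑ i, (ℓ ∘L ContinuousLinearMap.mul ℝ 𝓐
      (𝓕.c (LinearMap.toContinuousLinearMap ((finBasis ℝ V).coord i))))
        (fderiv ℝ W v (finBasis ℝ V i)) := fun v => by
    rw [hW', ext_apply, map_sum]; rfl
  simp_rw [hm]
  rw [integral_finsetSum _ fun i _ => (key _ _).1]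
  exact Finset.sum_eq_zero fun i _ => (key _ _).2

end FormAlgebra

end

section

theorem normDiff_mul_area_pow {𝓐 : Type*} [Ring 𝓐] [Algebra ℝ 𝓐] {J : Type*} [Fintype J]
    {L : Submodule ℝ 𝓐} {k x y : J → ℝ} {X Y : J → 𝓐} (hL : ∀ a ∈ L, a * a = 0)
    (hX : ∀ i, X i ∈ L) (hY : ∀ i, Y i ∈ L) :
    normDiff k x y X Y * area X Y ^ (Fintype.card J) = 0 := by
  classical
  have hc : ∀ i j, Commute (X i * Y i) (X j * Y j) := fun i j =>
    (commute_mul hL (hX i) (hY i) (hX j)).mul_right (commute_mul hL (hX i) (hY i) (hY j))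
  have hs : ∀ i, (X i * Y i) * (X i * Y i) = 0 := fun i => mul_mul_self hL (hX i) (hY i)
  rw [normDiff, Finset.sum_mul]
  refine Finset.sum_eq_zero fun i _ => ?_
  refine mul_sum_sq_zero_pow hc hs Finset.univ (Finset.mem_univ i) ?_
  have h1 : X i * (X i * Y i) = 0 := by rw [← mul_assoc, hL _ (hX i), zero_mul]
  have h2 : Y i * (X i * Y i) = 0 := by
    rw [anticomm hL (hX i) (hY i), mul_neg, ← mul_assoc, hL _ (hY i), zero_mul, neg_zero]
  simp [add_mul, h1, h2]

namespace FormAlgebra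

variable {V 𝓐 : Type*} [NormedAddCommGroup V] [NormedSpace ℝ V]
  [NormedRing 𝓐] [NormedAlgebra ℝ 𝓐] (𝓕 : FormAlgebra V 𝓐)

/-- The differentials of a family of functions, as one-forms. -/
noncomputable def d {J : Type*} (x : J → V → ℝ) (v : V) (j : J) : 𝓐 := 𝓕.c (fderiv ℝ (x j) v)

theorem d_mem {J : Type*} (x : J → V → ℝ) (v : V) (j : J) : 𝓕.d x v j ∈ 𝓕.L := 𝓕.c_mem _

variable {J : Type*} [Fintype J] (k : J → ℝ) (x y : J → V → ℝ)

/-- The Liouville form of a family of pairs of functions. -/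
noncomputable def liou (v : V) : 𝓐 := liouville (x · v) (y · v) (𝓕.d x v) (𝓕.d y v)

/-- The area form of a family of pairs of functions. -/
noncomputable def areaForm (v : V) : 𝓐 := area (𝓕.d x v) (𝓕.d y v)

/-- The weighted norm of a family of pairs of functions. -/
noncomputable def wn (_ : FormAlgebra V 𝓐) (v : V) : ℝ := wnorm k (x · v) (y · v)

/-- The differential of the weighted norm. -/
noncomputable def nd (v : V) : 𝓐 := normDiff k (x · v) (y · v) (𝓕.d x v) (𝓕.d y v)

/-- The exterior derivative of `ν(D) A`. -/
noncomputable def curv (ν : ℝ → ℝ) (v : V) : 𝓐 :=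
  curvature (ν (𝓕.wn k x y v)) (deriv ν (𝓕.wn k x y v)) k (x · v) (y · v) (𝓕.d x v) (𝓕.d y v)

theorem curv_eq (ν : ℝ → ℝ) (v : V) : 𝓕.curv k x y ν v =
    deriv ν (𝓕.wn k x y v) • (𝓕.nd k x y v * 𝓕.liou x y v) +
      (2 * ν (𝓕.wn k x y v)) • 𝓕.areaForm x y v := rfl

variable {k x y} {v : V}

theorem liou_mem : 𝓕.liou x y v ∈ 𝓕.L := liouville_mem (𝓕.d_mem _ _) (𝓕.d_mem _ _)
theorem nd_mem : 𝓕.nd k x y v ∈ 𝓕.L := normDiff_mem (𝓕.d_mem _ _) (𝓕.d_mem _ _)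

theorem areaForm_commute {a : 𝓐} (ha : a ∈ 𝓕.L) : Commute (𝓕.areaForm x y v) a :=
  area_commute 𝓕.sq_of_mem (𝓕.d_mem _ _) (𝓕.d_mem _ _) ha

theorem curv_commute {ν : ℝ → ℝ} {a : 𝓐} (ha : a ∈ 𝓕.L) : Commute (𝓕.curv k x y ν v) a :=
  curvature_commute 𝓕.sq_of_mem (𝓕.d_mem _ _) (𝓕.d_mem _ _) ha

theorem curv_commute_curv {ν ν₁ : ℝ → ℝ} {I : Type*} [Fintype I] {k₁ : I → ℝ} {x₁ y₁ : I → V → ℝ} :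
    Commute (𝓕.curv k x y ν v) (𝓕.curv k₁ x₁ y₁ ν₁ v) := by
  rw [curv_eq 𝓕 k₁ x₁]
  refine Commute.add_right (Commute.smul_right ?_ _) (Commute.smul_right ?_ _)
  · exact (𝓕.curv_commute 𝓕.nd_mem).mul_right (𝓕.curv_commute 𝓕.liou_mem)
  · exact Commute.sum_right _ _ _ fun j _ =>
      (𝓕.curv_commute (𝓕.d_mem _ _ _)).mul_right (𝓕.curv_commute (𝓕.d_mem _ _ _))

section Smooth

variable (hx : ∀ j, ContDiff ℝ 2 (x j)) (hy : ∀ j, ContDiff ℝ 2 (y j))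
include hx hy

theorem contDiff_wn : ContDiff ℝ 2 (𝓕.wn k x y) := by
  unfold wn wnorm
  fun_prop

omit [Fintype J] hy in
theorem contDiff_d (j : J) : ContDiff ℝ 1 (fun v => 𝓕.d x v j) :=
  𝓕.c.contDiff.comp ((hx j).fderiv_right (by norm_num))

theorem contDiff_liou : ContDiff ℝ 1 (𝓕.liou x y) := by
  refine ContDiff.sum fun j _ => ?_
  exact (((hx j).of_le one_le_two).smul (𝓕.contDiff_d hy j)).sub
    (((hy j).of_le one_le_two).smul (𝓕.contDiff_d hx j))

theorem contDiff_areaForm : ContDiff ℝ 1 (𝓕.areaForm x y) :=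
  ContDiff.sum fun j _ => (𝓕.contDiff_d hx j).mul (𝓕.contDiff_d hy j)

theorem contDiff_nd : ContDiff ℝ 1 (𝓕.nd k x y) := by
  refine ContDiff.sum fun j _ => ContDiff.const_smul _ ?_
  exact (((hx j).of_le one_le_two).smul (𝓕.contDiff_d hx j)).add
    (((hy j).of_le one_le_two).smul (𝓕.contDiff_d hy j))

theorem contDiff_curv {ν : ℝ → ℝ} (hν : ContDiff ℝ 2 ν) : ContDiff ℝ 1 (𝓕.curv k x y ν) := by
  have h1 : ContDiff ℝ 1 (deriv ν) := ((contDiff_succ_iff_deriv (n := 1)).1 hν).2.2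
  have hw : ContDiff ℝ 1 (𝓕.wn k x y) := (𝓕.contDiff_wn hx hy).of_le one_le_two
  refine ContDiff.add ?_ ?_
  · exact (h1.comp hw).smul ((𝓕.contDiff_nd hx hy).mul (𝓕.contDiff_liou hx hy))
  · exact (contDiff_const.mul ((hν.of_le one_le_two).comp hw)).smul (𝓕.contDiff_areaForm hx hy)

theorem hasFDerivAt_wn (v : V) : ∃ D : V →L[ℝ] ℝ, HasFDerivAt (𝓕.wn k x y) D v ∧
    𝓕.c D = 𝓕.nd k x y v := by
  have hd : ∀ j, HasFDerivAt (x j) (fderiv ℝ (x j) v) v := fun j =>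
    (((hx j).differentiable two_ne_zero) v).hasFDerivAt
  have hd' : ∀ j, HasFDerivAt (y j) (fderiv ℝ (y j) v) v := fun j =>
    (((hy j).differentiable two_ne_zero) v).hasFDerivAt
  refine ⟨_, HasFDerivAt.fun_sum fun j _ =>
    (((hd j).pow 2).add ((hd' j).pow 2)).const_mul (k j), ?_⟩
  rw [map_sum, nd, normDiff]
  refine Finset.sum_congr rfl fun j _ => ?_
  simp only [d, map_smul, map_add]
  norm_num
  module

variable [FiniteDimensional ℝ V]

theorem hasExtDeriv_areaForm : 𝓕.HasExtDeriv (𝓕.areaForm x y) 0 v := by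
  refine (HasExtDeriv.sum fun j _ => (hasExtDeriv_c_fderiv (hx j)).mul_of_mem (𝓕.c_mem _)
    (hasExtDeriv_c_fderiv (hy j))).congr_deriv ?_
  simp

theorem hasExtDeriv_nd : 𝓕.HasExtDeriv (𝓕.nd k x y) 0 v := by
  have h : 𝓕.nd k x y = fun v => 𝓕.c (fderiv ℝ (𝓕.wn k x y) v) := by
    funext v
    obtain ⟨D, hD, e⟩ := 𝓕.hasFDerivAt_wn (k := k) hx hy v
    rw [hD.fderiv, e]
  rw [h]
  exact hasExtDeriv_c_fderiv (𝓕.contDiff_wn hx hy)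

theorem hasExtDeriv_liou : 𝓕.HasExtDeriv (𝓕.liou x y) ((2 : ℝ) • 𝓕.areaForm x y v) v := by
  have hd : ∀ j, HasFDerivAt (x j) (fderiv ℝ (x j) v) v := fun j =>
    (((hx j).differentiable two_ne_zero) v).hasFDerivAt
  have hd' : ∀ j, HasFDerivAt (y j) (fderiv ℝ (y j) v) v := fun j =>
    (((hy j).differentiable two_ne_zero) v).hasFDerivAt
  refine (HasExtDeriv.sum fun j _ => ((hasExtDeriv_c_fderiv (hy j)).smul (hd j)).sub
    ((hasExtDeriv_c_fderiv (hx j)).smul (hd' j))).congr_deriv ?_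
  rw [areaForm, area, Finset.smul_sum]
  refine Finset.sum_congr rfl fun j _ => ?_
  rw [𝓕.anticomm_c (a := fderiv ℝ (y j) v)]
  simp only [d]
  module

theorem hasExtDeriv_smul_liou {ν : ℝ → ℝ} (hν : ContDiff ℝ 2 ν) :
    𝓕.HasExtDeriv (fun v => ν (𝓕.wn k x y v) • 𝓕.liou x y v) (𝓕.curv k x y ν v) v := by
  obtain ⟨D, hD, e⟩ := 𝓕.hasFDerivAt_wn (k := k) hx hy v
  have h1 := ((hν.differentiable two_ne_zero) (𝓕.wn k x y v)).hasDerivAt.comp_hasFDerivAt v hD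
  refine (HasExtDeriv.smul h1 (𝓕.hasExtDeriv_liou hx hy)).congr_deriv ?_
  rw [map_smul, e, curv_eq, smul_mul_assoc, smul_smul, mul_comm (2 : ℝ)]
  rfl

theorem hasExtDeriv_curv {ν : ℝ → ℝ} (hν : ContDiff ℝ 2 ν) :
    𝓕.HasExtDeriv (𝓕.curv k x y ν) 0 v := by
  obtain ⟨D, hD, e⟩ := 𝓕.hasFDerivAt_wn (k := k) hx hy v
  have h1 := ((hν.differentiable two_ne_zero) (𝓕.wn k x y v)).hasDerivAt.comp_hasFDerivAt v hD
  have hν' : ContDiff ℝ 1 (deriv ν) := ((contDiff_succ_iff_deriv (n := 1)).1 hν).2.2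
  have h2 := ((hν'.differentiable one_ne_zero) (𝓕.wn k x y v)).hasDerivAt.comp_hasFDerivAt v hD
  have h3 := (𝓕.hasExtDeriv_nd (k := k) (v := v) hx hy).mul_of_mem 𝓕.nd_mem
    (𝓕.hasExtDeriv_liou (v := v) hx hy)
  refine ((HasExtDeriv.smul h2 h3).add (HasExtDeriv.smul (h1.const_mul 2)
    (𝓕.hasExtDeriv_areaForm hx hy))).congr_deriv ?_
  have hsq : 𝓕.nd k x y v * (𝓕.nd k x y v * 𝓕.liou x y v) = 0 := by
    rw [← mul_assoc, 𝓕.sq_of_mem _ 𝓕.nd_mem, zero_mul]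
  simp only [map_smul, e, smul_mul_assoc, hsq, zero_mul, mul_smul_comm, Function.comp]
  module

end Smooth

end FormAlgebra

end

section

namespace FormAlgebra

variable {V 𝓐 : Type*} [NormedAddCommGroup V] [NormedSpace ℝ V]
  [NormedRing 𝓐] [NormedAlgebra ℝ 𝓐] (𝓕 : FormAlgebra V 𝓐)
  {J K : Type*} [Fintype J] [Fintype K]

/-- The transgression form between the connection forms of two equivariant families, cut off by
`ψ` and localized by `φ` near the zero set of a third family. -/
noncomputable def transgression (k : J → ℝ) (qx qy x y : J → V → ℝ) (gx gy : K → V → ℝ)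
    (ν ψ φ : ℝ → ℝ) (v : V) : 𝓐 :=
  (ψ (𝓕.wn k qx qy v) • 𝓕.nd k qx qy v) *
    ((ν (𝓕.wn k qx qy v) • 𝓕.liou qx qy v) *
      ((ν (𝓕.wn k x y v) • 𝓕.liou x y v - ν (𝓕.wn k qx qy v) • 𝓕.liou qx qy v) *
        ((∑ i ∈ Finset.range (Fintype.card J),
            𝓕.curv k x y ν v ^ i * 𝓕.curv k qx qy ν v ^ (Fintype.card J - 1 - i)) *
          (φ (𝓕.wn (fun _ => 1) gx gy v) • 𝓕.areaForm gx gy v ^ Fintype.card K))))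

variable {k : J → ℝ} {qx qy x y : J → V → ℝ} {gx gy : K → V → ℝ} {ν ψ φ : ℝ → ℝ}
  (hqx : ∀ j, ContDiff ℝ 2 (qx j)) (hqy : ∀ j, ContDiff ℝ 2 (qy j))
  (hx : ∀ j, ContDiff ℝ 2 (x j)) (hy : ∀ j, ContDiff ℝ 2 (y j))
  (hgx : ∀ j, ContDiff ℝ 2 (gx j)) (hgy : ∀ j, ContDiff ℝ 2 (gy j))
  (hν : ContDiff ℝ 2 ν) (hψ : ContDiff ℝ 2 ψ) (hφ : ContDiff ℝ 2 φ)
include hqx hqy hx hy hgx hgy hν hψ hφ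

theorem contDiff_transgression :
    ContDiff ℝ 1 (𝓕.transgression k qx qy x y gx gy ν ψ φ) := by
  have hwq : ContDiff ℝ 1 (𝓕.wn k qx qy) := (𝓕.contDiff_wn hqx hqy).of_le one_le_two
  have hw : ContDiff ℝ 1 (𝓕.wn k x y) := (𝓕.contDiff_wn hx hy).of_le one_le_two
  have hwg : ContDiff ℝ 1 (𝓕.wn (fun _ => 1) gx gy) := (𝓕.contDiff_wn hgx hgy).of_le one_le_two
  have hν1 := hν.of_le one_le_two
  have hψ1 := hψ.of_le one_le_two
  have hφ1 := hφ.of_le one_le_two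
  refine ContDiff.mul ((hψ1.comp hwq).smul (𝓕.contDiff_nd hqx hqy)) (ContDiff.mul
    ((hν1.comp hwq).smul (𝓕.contDiff_liou hqx hqy)) (ContDiff.mul
      (((hν1.comp hw).smul (𝓕.contDiff_liou hx hy)).sub
        ((hν1.comp hwq).smul (𝓕.contDiff_liou hqx hqy))) (ContDiff.mul (ContDiff.sum fun i _ =>
          ((𝓕.contDiff_curv hx hy hν).pow _).mul ((𝓕.contDiff_curv hqx hqy hν).pow _))
            ((hφ1.comp hwg).smul ((𝓕.contDiff_areaForm hgx hgy).pow _)))))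

variable [FiniteDimensional ℝ V]

theorem hasExtDeriv_transgression [Nonempty J] (v ξ : V)
    (hd : finrank ℝ V = 2 * Fintype.card J + 2 * Fintype.card K + 2)
    (hqxξ : ∀ j, fderiv ℝ (qx j) v ξ = -(k j * qy j v))
    (hqyξ : ∀ j, fderiv ℝ (qy j) v ξ = k j * qx j v)
    (hxξ : ∀ j, fderiv ℝ (x j) v ξ = -(k j * y j v))
    (hyξ : ∀ j, fderiv ℝ (y j) v ξ = k j * x j v)
    (hgxξ : ∀ j, fderiv ℝ (gx j) v ξ = 0)
    (hgyξ : ∀ j, fderiv ℝ (gy j) v ξ = 0)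
    (h : ψ (𝓕.wn k qx qy v) ≠ 0 → φ (𝓕.wn (fun _ => 1) gx gy v) ≠ 0 → ξ ≠ 0 ∧
      ν (𝓕.wn k qx qy v) + deriv ν (𝓕.wn k qx qy v) * 𝓕.wn k qx qy v = 0 ∧
      ν (𝓕.wn k x y v) + deriv ν (𝓕.wn k x y v) * 𝓕.wn k x y v = 0 ∧
      ν (𝓕.wn k qx qy v) * 𝓕.wn k qx qy v = 1 ∧ ν (𝓕.wn k x y v) * 𝓕.wn k x y v = 1) :
    𝓕.HasExtDeriv (𝓕.transgression k qx qy x y gx gy ν ψ φ) 0 v := by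
  classical
  obtain ⟨Dq, hDq, eq⟩ := 𝓕.hasFDerivAt_wn (k := k) hqx hqy v
  obtain ⟨Dg, hDg, eg⟩ := 𝓕.hasFDerivAt_wn (k := fun _ => 1) hgx hgy v
  have hφd := ((hφ.differentiable two_ne_zero) (𝓕.wn (fun _ => 1) gx gy v)).hasDerivAt.comp_hasFDerivAt v hDg
  have hψd := ((hψ.differentiable two_ne_zero) (𝓕.wn k qx qy v)).hasDerivAt.comp_hasFDerivAt v hDq
  have hGpow : 𝓕.nd (fun _ => 1) gx gy v * 𝓕.areaForm gx gy v ^ Fintype.card K = 0 :=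
    normDiff_mul_area_pow 𝓕.sq_of_mem (𝓕.d_mem _ _) (𝓕.d_mem _ _)
  have hΘ : 𝓕.HasExtDeriv (fun v => φ (𝓕.wn (fun _ => 1) gx gy v) •
      𝓕.areaForm gx gy v ^ Fintype.card K) 0 v := by
    refine (HasExtDeriv.smul hφd (HasExtDeriv.pow_of_closed
      (fun a => 𝓕.areaForm_commute (𝓕.c_mem a)) (𝓕.hasExtDeriv_areaForm hgx hgy)
      (Fintype.card K))).congr_deriv ?_
    rw [map_smul, eg, smul_mul_assoc, hGpow]
    simp
  have hcF := fun n => HasExtDeriv.pow_of_closed (fun a => 𝓕.curv_commute (𝓕.c_mem a))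
    (𝓕.hasExtDeriv_curv (k := k) (v := v) hx hy hν) n
  have hcq := fun n => HasExtDeriv.pow_of_closed (fun a => 𝓕.curv_commute (𝓕.c_mem a))
    (𝓕.hasExtDeriv_curv (k := k) (v := v) hqx hqy hν) n
  have hSΘ : 𝓕.HasExtDeriv (fun v => (∑ i ∈ Finset.range (Fintype.card J),
            𝓕.curv k x y ν v ^ i * 𝓕.curv k qx qy ν v ^ (Fintype.card J - 1 - i)) *
          (φ (𝓕.wn (fun _ => 1) gx gy v) • 𝓕.areaForm gx gy v ^ Fintype.card K)) 0 v := by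
    refine (HasExtDeriv.mul_of_commute (fun a => ?_) (HasExtDeriv.sum fun i _ =>
      (hcF i).mul_of_commute (fun a => (𝓕.curv_commute (𝓕.c_mem a)).pow_left _)
        (hcq (Fintype.card J - 1 - i))) hΘ).congr_deriv ?_
    · exact Commute.sum_left _ _ _ fun i _ => Commute.mul_left
        ((𝓕.curv_commute (𝓕.c_mem a)).pow_left _) ((𝓕.curv_commute (𝓕.c_mem a)).pow_left _)
    · simp
  have hα := 𝓕.hasExtDeriv_smul_liou (k := k) (v := v) hqx hqy hν
  have hδ := (𝓕.hasExtDeriv_smul_liou (k := k) (v := v) hx hy hν).sub hα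
  have hαm : ν (𝓕.wn k qx qy v) • 𝓕.liou qx qy v ∈ 𝓕.L := 𝓕.L.smul_mem _ 𝓕.liou_mem
  have hτm : ν (𝓕.wn k x y v) • 𝓕.liou x y v ∈ 𝓕.L := 𝓕.L.smul_mem _ 𝓕.liou_mem
  have hrm : ψ (𝓕.wn k qx qy v) • 𝓕.nd k qx qy v ∈ 𝓕.L := 𝓕.L.smul_mem _ 𝓕.nd_mem
  have hr := HasExtDeriv.smul hψd (𝓕.hasExtDeriv_nd (k := k) (v := v) hqx hqy)
  have hsq : 𝓕.nd k qx qy v * 𝓕.nd k qx qy v = 0 := 𝓕.sq_of_mem _ 𝓕.nd_mem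
  refine (hr.mul_of_mem hrm (hα.mul_of_mem hαm (hδ.mul_of_mem
    (𝓕.L.sub_mem hτm hαm) hSΘ))).congr_deriv ?_
  rw [map_smul, eq, smul_mul_assoc, hsq]
  simp only [mul_zero, sub_zero, smul_zero, add_zero, zero_mul, zero_sub, neg_eq_zero]
  by_cases hψ0 : ψ (𝓕.wn k qx qy v) = 0
  · simp [hψ0]
  by_cases hφ0 : φ (𝓕.wn (fun _ => 1) gx gy v) = 0
  · simp [hφ0]
  obtain ⟨hξ, hν1, hν2, hν3, hν4⟩ := h hψ0 hφ0
  obtain ⟨N, hN⟩ : ∃ N, Fintype.card J = N + 1 :=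
    ⟨_, (Nat.succ_pred_eq_of_pos Fintype.card_pos).symm⟩
  have iqx : ∀ j, 𝓕.ι ξ * 𝓕.d qx v j + 𝓕.d qx v j * 𝓕.ι ξ = algebraMap ℝ 𝓐 (-(k j * qy j v)) :=
    fun j => by rw [d, 𝓕.ι_c, hqxξ]
  have iqy : ∀ j, 𝓕.ι ξ * 𝓕.d qy v j + 𝓕.d qy v j * 𝓕.ι ξ = algebraMap ℝ 𝓐 (k j * qx j v) :=
    fun j => by rw [d, 𝓕.ι_c, hqyξ]
  have ix : ∀ j, 𝓕.ι ξ * 𝓕.d x v j + 𝓕.d x v j * 𝓕.ι ξ = algebraMap ℝ 𝓐 (-(k j * y j v)) :=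
    fun j => by rw [d, 𝓕.ι_c, hxξ]
  have iy : ∀ j, 𝓕.ι ξ * 𝓕.d y v j + 𝓕.d y v j * 𝓕.ι ξ = algebraMap ℝ 𝓐 (k j * x j v) :=
    fun j => by rw [d, 𝓕.ι_c, hyξ]
  have igx : ∀ j, 𝓕.ι ξ * 𝓕.d gx v j + 𝓕.d gx v j * 𝓕.ι ξ = algebraMap ℝ 𝓐 (-(0 * gy j v)) :=
    fun j => by rw [d, 𝓕.ι_c, hgxξ]; simp
  have igy : ∀ j, 𝓕.ι ξ * 𝓕.d gy v j + 𝓕.d gy v j * 𝓕.ι ξ = algebraMap ℝ 𝓐 (0 * gx j v) :=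
    fun j => by rw [d, 𝓕.ι_c, hgyξ]; simp
  have iarea : Commute (𝓕.ι ξ) (𝓕.areaForm gx gy v) := by
    have := contract_area (k := fun _ => 0) igx igy
    simp only [normDiff, mul_zero, zero_smul, Finset.sum_const_zero, smul_zero, sub_zero] at this
    exact this
  have iα : 𝓕.ι ξ * (ν (𝓕.wn k qx qy v) • 𝓕.liou qx qy v) +
      (ν (𝓕.wn k qx qy v) • 𝓕.liou qx qy v) * 𝓕.ι ξ = 1 := by
    have := contract_liouville iqx iqy
    rw [mul_smul_comm, smul_mul_assoc, ← smul_add]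
    erw [this]
    rw [← map_one (algebraMap ℝ 𝓐), ← hν3, map_mul, Algebra.smul_def]
    rfl
  have iτ : 𝓕.ι ξ * (ν (𝓕.wn k x y v) • 𝓕.liou x y v) +
      (ν (𝓕.wn k x y v) • 𝓕.liou x y v) * 𝓕.ι ξ = 1 := by
    have := contract_liouville ix iy
    rw [mul_smul_comm, smul_mul_assoc, ← smul_add]
    erw [this]
    rw [← map_one (algebraMap ℝ 𝓐), ← hν4, map_mul, Algebra.smul_def]
    rfl
  have main := 𝓕.transgression_eq_zero (N := N) (q := Fintype.card K) hξ (by rw [hd, hN]; ring)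
    (α := ν (𝓕.wn k qx qy v) • 𝓕.liou qx qy v) (Tq := 𝓕.curv k qx qy ν v)
    (TF := 𝓕.curv k x y ν v) hrm (𝓕.L.sub_mem hτm hαm)
    (curvature_mem (𝓕.d_mem _ _) (𝓕.d_mem _ _) : 𝓕.curv k qx qy ν v ∈ 𝓕.L ^ 2)
    (curvature_mem (𝓕.d_mem _ _) (𝓕.d_mem _ _) : 𝓕.curv k x y ν v ∈ 𝓕.L ^ 2)
    (Ω := φ (𝓕.wn (fun _ => 1) gx gy v) • 𝓕.areaForm gx gy v ^ Fintype.card K)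
    (by
      rw [pow_mul]
      exact Submodule.smul_mem _ _ (Submodule.pow_mem_pow _ (area_mem (𝓕.d_mem _ _) (𝓕.d_mem _ _)) _))
    (by
      rw [mul_smul_comm, smul_mul_assoc, ← smul_neg]
      congr 1
      exact contract_normDiff iqx iqy)
    (by
      rw [eq_neg_iff_add_eq_zero, mul_sub, sub_mul]
      rw [sub_add_sub_comm, iτ, iα, sub_self])
    (contract_curvature iqx iqy hν1) (contract_curvature ix iy hν2)
    ((iarea.pow_right _).smul_right _) 𝓕.curv_commute_curv
    (curvature_pow_eq_zero 𝓕.sq_of_mem (𝓕.d_mem _ _) (𝓕.d_mem _ _) hN hν1)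
    (curvature_pow_eq_zero 𝓕.sq_of_mem (𝓕.d_mem _ _) (𝓕.d_mem _ _) hN hν2)
  rw [← hN] at main
  rw [← main]
  simp only [Function.comp, mul_assoc, sub_mul]

end FormAlgebra

end

section

section Twist

variable {𝓐 : Type*} [Ring 𝓐] [Algebra ℝ 𝓐] {J : Type*} [Fintype J] {L : Submodule ℝ 𝓐}
  {k a b u w : J → ℝ} {A B U W X Y : J → 𝓐}

theorem liouville_twist (huw : ∀ j, u j ^ 2 + w j ^ 2 = 1)
    (hX : ∀ j, X j = u j • A j + a j • U j - (w j • B j + b j • W j))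
    (hY : ∀ j, Y j = u j • B j + b j • U j + (w j • A j + a j • W j)) :
    liouville (fun j => u j * a j - w j * b j) (fun j => u j * b j + w j * a j) X Y =
      liouville a b A B + ∑ j, (a j ^ 2 + b j ^ 2) • (u j • W j - w j • U j) := by
  rw [liouville, liouville, ← Finset.sum_add_distrib]
  refine Finset.sum_congr rfl fun j _ => ?_
  rw [hX, hY]
  have h := huw j
  match_scalars
  · linear_combination a j * h
  · ring
  · linear_combination (-b j) * h
  · ring

theorem wnorm_twist (huw : ∀ j, u j ^ 2 + w j ^ 2 = 1) :
    wnorm k (fun j => u j * a j - w j * b j) (fun j => u j * b j + w j * a j) = wnorm k a b := by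
  refine Finset.sum_congr rfl fun j _ => ?_
  dsimp only
  linear_combination (k j * (a j ^ 2 + b j ^ 2)) * huw j

variable (hL : ∀ a ∈ L, a * a = 0) (hA : ∀ i, A i ∈ L) (hB : ∀ i, B i ∈ L)
  {P : 𝓐} (hP : ∀ a ∈ L, Commute P a) (hPU : ∀ j, P * U j = 0) (hPW : ∀ j, P * W j = 0)
include hL hA hB hP hPU hPW

theorem mul_curvature_twist (huw : ∀ j, u j ^ 2 + w j ^ 2 = 1)
    (hX : ∀ j, X j = u j • A j + a j • U j - (w j • B j + b j • W j))
    (hY : ∀ j, Y j = u j • B j + b j • U j + (w j • A j + a j • W j)) (ν ν' : ℝ) :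
    P * curvature ν ν' k (fun j => u j * a j - w j * b j) (fun j => u j * b j + w j * a j) X Y =
      P * curvature ν ν' k a b A B := by
  have PX : ∀ j, P * X j = P * (u j • A j - w j • B j) := fun j => by
    rw [hX]; simp only [mul_add, mul_sub, mul_smul_comm, hPU, hPW, smul_zero, add_zero]
  have PY : ∀ j, P * Y j = P * (u j • B j + w j • A j) := fun j => by
    rw [hY]; simp only [mul_add, mul_smul_comm, hPU, hPW, smul_zero, add_zero]
  have h1 : P * normDiff k (fun j => u j * a j - w j * b j) (fun j => u j * b j + w j * a j) X Y =
      P * normDiff k a b A B := by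
    rw [normDiff, normDiff, Finset.mul_sum, Finset.mul_sum]
    refine Finset.sum_congr rfl fun j _ => ?_
    simp only [mul_smul_comm, mul_add, PX, PY, mul_sub]
    have h := huw j
    match_scalars
    · linear_combination 2 * k j * a j * h
    · linear_combination 2 * k j * b j * h
  have h2 : P * liouville (fun j => u j * a j - w j * b j) (fun j => u j * b j + w j * a j) X Y =
      P * liouville a b A B := by
    rw [liouville_twist huw hX hY, mul_add, Finset.mul_sum, Finset.sum_eq_zero, add_zero]
    intro j _
    simp only [mul_smul_comm, mul_sub, hPU, hPW, smul_zero, sub_zero]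
  have h3 : P * area X Y = P * area A B := by
    rw [area, area, Finset.mul_sum, Finset.mul_sum]
    refine Finset.sum_congr rfl fun j _ => ?_
    have hm : u j • A j - w j • B j ∈ L := L.sub_mem (L.smul_mem _ (hA j)) (L.smul_mem _ (hB j))
    rw [← mul_assoc, PX, (hP _ hm).eq, mul_assoc, PY, ← mul_assoc, ← (hP _ hm).eq, mul_assoc]
    congr 1
    simp only [sub_mul, mul_add, smul_mul_assoc, mul_smul_comm, hL _ (hA j), hL _ (hB j),
      anticomm hL (hB j) (hA j), smul_zero]
    have h := huw j
    match_scalars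
    linear_combination h
  have hn : Commute P (normDiff k a b A B) := hP _ (normDiff_mem hA hB)
  rw [curvature, curvature, mul_add, mul_add, mul_smul_comm, mul_smul_comm, mul_smul_comm,
    mul_smul_comm, h3, ← mul_assoc, h1, hn.eq, mul_assoc, h2, ← mul_assoc, ← hn.eq, mul_assoc]

theorem mul_curvature_pow_twist (huw : ∀ j, u j ^ 2 + w j ^ 2 = 1)
    (hX : ∀ j, X j = u j • A j + a j • U j - (w j • B j + b j • W j))
    (hY : ∀ j, Y j = u j • B j + b j • U j + (w j • A j + a j • W j)) (ν ν' : ℝ) (n : ℕ) :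
    P * curvature ν ν' k (fun j => u j * a j - w j * b j) (fun j => u j * b j + w j * a j) X Y ^ n
      = P * curvature ν ν' k a b A B ^ n := by
  have hc : Commute P (curvature ν ν' k a b A B) := by
    refine Commute.add_right (Commute.smul_right ?_ _) (Commute.smul_right ?_ _)
    · exact (hP _ (normDiff_mem hA hB)).mul_right (hP _ (liouville_mem hA hB))
    · exact Commute.sum_right _ _ _ fun j _ => (hP _ (hA j)).mul_right (hP _ (hB j))
  induction n with
  | zero => simp
  | succ n ih =>
    rw [pow_succ', ← mul_assoc, mul_curvature_twist hL hA hB hP hPU hPW huw hX hY, hc.eq, mul_assoc,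
      ih, ← mul_assoc, ← hc.eq, mul_assoc, ← pow_succ']

omit hP hPU hPW in
/-- The leading coefficient of the differential of the cutoff times the transgression form. -/
theorem mul_transgression_twist [DecidableEq J] (huw : ∀ j, u j ^ 2 + w j ^ 2 = 1)
    (hX : ∀ j, X j = u j • A j + a j • U j - (w j • B j + b j • W j))
    (hY : ∀ j, Y j = u j • B j + b j • U j + (w j • A j + a j • W j))
    {ν ν' ψ φ : ℝ} {N : ℕ} (hN : Fintype.card J = N + 1) {ρ ϑ Z₁ Z₂ Ω : 𝓐} {e : J → ℝ}
    (hZ₁ : Z₁ ∈ L) (hZ₂ : Z₂ ∈ L) (hϑ : ϑ ∈ L) (hρϑ : ρ * ϑ = Z₁ * Z₂)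
    (hPU : ∀ j, Z₁ * Z₂ * U j = 0) (hPW : ∀ j, Z₁ * Z₂ * W j = 0)
    (he : ∀ j, u j • W j - w j • U j = e j • ϑ) :
    ρ * ((ψ • normDiff k a b A B) * ((ν • liouville a b A B) *
      ((ν • liouville (fun j => u j * a j - w j * b j) (fun j => u j * b j + w j * a j) X Y -
        ν • liouville a b A B) * ((∑ i ∈ Finset.range (Fintype.card J),
          curvature ν ν' k (fun j => u j * a j - w j * b j) (fun j => u j * b j + w j * a j) X Y ^ i *
          curvature ν ν' k a b A B ^ (Fintype.card J - 1 - i)) * (φ • Ω))))) =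
    (ψ * ν * ν * φ * (∑ j, (a j ^ 2 + b j ^ 2) * e j) * ((2 * ν) ^ N * (2 * wnorm k a b))) •
      (Z₁ * Z₂ * (area A B ^ (N + 1) * Ω)) := by
  have hP : ∀ a ∈ L, Commute (Z₁ * Z₂) a := fun a ha => commute_mul hL hZ₁ hZ₂ ha
  have hF := mul_curvature_pow_twist (k := k) hL hA hB hP hPU hPW huw hX hY ν ν'
  have hδ : ν • liouville (fun j => u j * a j - w j * b j) (fun j => u j * b j + w j * a j) X Y -
        ν • liouville a b A B = (ν * ∑ j, (a j ^ 2 + b j ^ 2) * e j) • ϑ := by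
    rw [liouville_twist huw hX hY, smul_add, add_sub_cancel_left, mul_smul]
    simp only [he, smul_smul, Finset.sum_smul]
  rw [hδ]
  set n := normDiff k a b A B with hn
  set l := liouville a b A B with hl
  set c := curvature ν ν' k a b A B with hc
  set s := ∑ j, (a j ^ 2 + b j ^ 2) * e j
  set S := ∑ i ∈ Finset.range (Fintype.card J),
          curvature ν ν' k (fun j => u j * a j - w j * b j) (fun j => u j * b j + w j * a j) X Y ^ i *
          c ^ (Fintype.card J - 1 - i) with hS
  have hnl : Commute (n * l) ϑ := commute_mul hL (normDiff_mem hA hB) (liouville_mem hA hB) hϑ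
  have hPnl : Commute (Z₁ * Z₂) (n * l) :=
    (hP _ (normDiff_mem hA hB)).mul_right (hP _ (liouville_mem hA hB))
  have hPS : Z₁ * Z₂ * S = (N + 1) • (Z₁ * Z₂ * c ^ N) := by
    rw [hS, Finset.mul_sum, hN]
    have : ∀ i ∈ Finset.range (N + 1), Z₁ * Z₂ * (curvature ν ν' k (fun j => u j * a j - w j * b j)
        (fun j => u j * b j + w j * a j) X Y ^ i * c ^ (N + 1 - 1 - i)) = Z₁ * Z₂ * c ^ N := by
      intro i hi
      rw [← mul_assoc, hF, mul_assoc, ← pow_add]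
      congr 2
      have := Finset.mem_range.1 hi
      omega
    rw [Finset.sum_congr rfl this]
    simp
  have h1 : ρ * (n * (l * (ϑ * (S * Ω)))) = Z₁ * Z₂ * ((N + 1) • (n * l * c ^ N)) * Ω := by
    calc ρ * (n * (l * (ϑ * (S * Ω)))) = ρ * ((n * l) * ϑ) * S * Ω := by noncomm_ring
      _ = (ρ * ϑ) * (n * l) * S * Ω := by rw [hnl.eq]; noncomm_ring
      _ = n * l * (Z₁ * Z₂ * S) * Ω := by rw [hρϑ, hPnl.eq]; noncomm_ring
      _ = (N + 1) • ((n * l * (Z₁ * Z₂)) * c ^ N * Ω) := by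
        rw [hPS, mul_smul_comm, smul_mul_assoc]; simp only [mul_assoc]
      _ = _ := by rw [← hPnl.eq, mul_smul_comm, smul_mul_assoc]; simp only [mul_assoc]
  have h2 : (N + 1) • (n * l * c ^ N) = ((2 * ν) ^ N * (2 * wnorm k a b)) • area A B ^ (N + 1) :=
    normDiff_mul_liouville_mul_curvature_pow hL hA hB hN
  rw [h2] at h1
  simp only [smul_mul_assoc, mul_smul_comm, h1, smul_smul, mul_assoc]
  congr 1
  ring

end Twist

end

section

theorem nontrivial_formOp (V : Type*) [NormedAddCommGroup V] [NormedSpace ℝ V]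
    [FiniteDimensional ℝ V] : Nontrivial (FormOp V) := by
  have : 0 < extDim V := by
    have : Nontrivial (ExteriorAlgebra ℝ (V →L[ℝ] ℝ)) :=
      (ExteriorAlgebra.algebraMap_leftInverse (R := ℝ) (V →L[ℝ] ℝ)).injective.nontrivial
    exact Module.finrank_pos
  have : Nonempty (Fin (extDim V)) := ⟨⟨0, this⟩⟩
  infer_instance

theorem exists_contDiff_inv {d : ℝ} (hd : 0 < d) : ∃ ν : ℝ → ℝ, ContDiff ℝ 2 ν ∧
    ∀ t, d < t → ν t * t = 1 ∧ ν t + deriv ν t * t = 0 := by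
  set s : ℝ → ℝ := fun t => Real.smoothTransition (2 * t / d - 1) with hs
  have hsd : ContDiff ℝ 2 s := Real.smoothTransition.contDiff.comp (by fun_prop)
  have hpos : ∀ t, 0 < t * s t + 1 - s t := by
    intro t
    have h0 : 0 ≤ s t := Real.smoothTransition.nonneg _
    have h1 : s t ≤ 1 := Real.smoothTransition.le_one _
    rcases le_or_gt t (d / 2) with h | h
    · have : s t = 0 := Real.smoothTransition.zero_of_nonpos (by
        rw [sub_nonpos, div_le_one hd]; linarith)
      rw [this]; norm_num
    · have ht : 0 < t := by linarith
      rcases h1.lt_or_eq with h1 | h1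
      · have : 0 ≤ t * s t := by positivity
        linarith
      · rw [h1]; linarith
  refine ⟨fun t => (t * s t + 1 - s t)⁻¹, ContDiff.inv (by fun_prop) fun t => (hpos t).ne', ?_⟩
  have hev : ∀ t, d < t → (t * s t + 1 - s t)⁻¹ = t⁻¹ := by
    intro t ht
    have : s t = 1 := Real.smoothTransition.one_of_one_le (by
      rw [le_sub_iff_add_le, le_div_iff₀ hd]; linarith)
    rw [this]; norm_num
  intro t ht
  have ht0 : t ≠ 0 := by linarith
  have hloc : (fun t => (t * s t + 1 - s t)⁻¹) =ᶠ[nhds t] fun t => t⁻¹ :=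
    Filter.eventually_of_mem (Ioi_mem_nhds ht) hev
  dsimp only
  rw [hloc.deriv_eq, hev t ht, deriv_inv]
  constructor <;> field_simp
  ring

namespace FormAlgebra

section Twist

variable {V 𝓐 : Type*} [NormedAddCommGroup V] [NormedSpace ℝ V]
  [NormedRing 𝓐] [NormedAlgebra ℝ 𝓐] (𝓕 : FormAlgebra V 𝓐)
  {J K : Type*} [Fintype J] [Fintype K]

theorem mul_transgression {k u w : J → ℝ} {qx qy x y : J → V → ℝ} {gx gy : K → V → ℝ}
    {ν ψ φ : ℝ → ℝ} {v : V} {U W : J → 𝓐} {N : ℕ} (hN : Fintype.card J = N + 1)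
    {ρ ϑ Z₁ Z₂ : 𝓐} {e : J → ℝ}
    (huw : ∀ j, u j ^ 2 + w j ^ 2 = 1)
    (hx : ∀ j, x j v = u j * qx j v - w j * qy j v)
    (hy : ∀ j, y j v = u j * qy j v + w j * qx j v)
    (hX : ∀ j, 𝓕.d x v j = u j • 𝓕.d qx v j + qx j v • U j - (w j • 𝓕.d qy v j + qy j v • W j))
    (hY : ∀ j, 𝓕.d y v j = u j • 𝓕.d qy v j + qy j v • U j + (w j • 𝓕.d qx v j + qx j v • W j))
    (hZ₁ : Z₁ ∈ 𝓕.L) (hZ₂ : Z₂ ∈ 𝓕.L) (hϑ : ϑ ∈ 𝓕.L) (hρϑ : ρ * ϑ = Z₁ * Z₂)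
    (hPU : ∀ j, Z₁ * Z₂ * U j = 0) (hPW : ∀ j, Z₁ * Z₂ * W j = 0)
    (he : ∀ j, u j • W j - w j • U j = e j • ϑ) :
    ρ * 𝓕.transgression k qx qy x y gx gy ν ψ φ v =
    (ψ (𝓕.wn k qx qy v) * ν (𝓕.wn k qx qy v) * ν (𝓕.wn k qx qy v) *
      φ (𝓕.wn (fun _ => 1) gx gy v) * (∑ j, (qx j v ^ 2 + qy j v ^ 2) * e j) *
      ((2 * ν (𝓕.wn k qx qy v)) ^ N * (2 * 𝓕.wn k qx qy v))) •
      (Z₁ * Z₂ * (𝓕.areaForm qx qy v ^ (N + 1) * 𝓕.areaForm gx gy v ^ Fintype.card K)) := by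
  classical
  have ex : (fun j => x j v) = fun j => u j * qx j v - w j * qy j v := funext hx
  have ey : (fun j => y j v) = fun j => u j * qy j v + w j * qx j v := funext hy
  have hw : 𝓕.wn k x y v = 𝓕.wn k qx qy v := by
    rw [wn, ex, ey]; exact wnorm_twist huw
  have := mul_transgression_twist (k := k) (ν := ν (𝓕.wn k qx qy v))
    (ν' := deriv ν (𝓕.wn k qx qy v)) (ψ := ψ (𝓕.wn k qx qy v))
    (φ := φ (𝓕.wn (fun _ => 1) gx gy v)) (Ω := 𝓕.areaForm gx gy v ^ Fintype.card K)
    𝓕.sq_of_mem (𝓕.d_mem qx v) (𝓕.d_mem qy v) huw hX hY hN hZ₁ hZ₂ hϑ hρϑ hPU hPW he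
  have hl : 𝓕.liou x y v = liouville (fun j => u j * qx j v - w j * qy j v)
      (fun j => u j * qy j v + w j * qx j v) (𝓕.d x v) (𝓕.d y v) := by rw [liou, ex, ey]
  have hc : 𝓕.curv k x y ν v = curvature (ν (𝓕.wn k qx qy v)) (deriv ν (𝓕.wn k qx qy v)) k
      (fun j => u j * qx j v - w j * qy j v) (fun j => u j * qy j v + w j * qx j v)
      (𝓕.d x v) (𝓕.d y v) := by rw [curv, hw, ex, ey]
  rw [transgression, hl, hc, hw]
  exact this

end Twist

section Coordinates

variable {V 𝓐 : Type*} [NormedAddCommGroup V] [NormedSpace ℝ V]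
  [NormedRing 𝓐] [NormedAlgebra ℝ 𝓐] [Nontrivial 𝓐] (𝓕 : FormAlgebra V 𝓐)
  {J K : Type*} [Fintype J] [Fintype K] [DecidableEq J] [DecidableEq K]

omit [Nontrivial 𝓐] [DecidableEq K] [Fintype K] in
theorem ι_c_dual {p : K → V →L[ℝ] ℝ} {p' : K → V} [DecidableEq K]
    (hp : ∀ i j, p j (p' i) = if i = j then 1 else 0) (i j : K) :
    𝓕.ι (p' i) * 𝓕.c (p j) + 𝓕.c (p j) * 𝓕.ι (p' i) = if i = j then 1 else 0 := by
  rw [𝓕.ι_c, hp]; split_ifs <;> simp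

omit [Nontrivial 𝓐] [DecidableEq K] in
theorem commute_ι_area {p r : K → V →L[ℝ] ℝ} {v : V} (hp : ∀ j, p j v = 0)
    (hr : ∀ j, r j v = 0) :
    Commute (𝓕.ι v) (area (fun j => 𝓕.c (p j)) (fun j => 𝓕.c (r j))) := by
  refine Commute.sum_right _ _ _ fun j _ => ?_
  have h1 := 𝓕.ι_c v (p j)
  have h2 := 𝓕.ι_c v (r j)
  rw [hp, map_zero] at h1
  rw [hr, map_zero] at h2
  change 𝓕.ι v * (𝓕.c (p j) * 𝓕.c (r j)) = 𝓕.c (p j) * 𝓕.c (r j) * 𝓕.ι v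
  rw [← mul_assoc, eq_neg_of_add_eq_zero_left h1, neg_mul, mul_assoc,
    eq_neg_of_add_eq_zero_left h2]
  noncomm_ring

theorem volume_ne_zero {a b : J → V →L[ℝ] ℝ} {g h : K → V →L[ℝ] ℝ} {z₁ z₂ : V →L[ℝ] ℝ}
    {a' b' : J → V} {g' h' : K → V} {z₁' z₂' : V}
    (haa : ∀ i j, a j (a' i) = if i = j then 1 else 0) (hab : ∀ i j, b j (a' i) = 0)
    (hba : ∀ i j, a j (b' i) = 0) (hbb : ∀ i j, b j (b' i) = if i = j then 1 else 0)
    (hga : ∀ i j, g j (a' i) = 0) (hha : ∀ i j, h j (a' i) = 0)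
    (hgb : ∀ i j, g j (b' i) = 0) (hhb : ∀ i j, h j (b' i) = 0)
    (hgg : ∀ i j, g j (g' i) = if i = j then 1 else 0) (hgh : ∀ i j, h j (g' i) = 0)
    (hhg : ∀ i j, g j (h' i) = 0) (hhh : ∀ i j, h j (h' i) = if i = j then 1 else 0)
    (h11 : z₁ z₁' = 1) (h12 : z₂ z₁' = 0) (h22 : z₂ z₂' = 1)
    (h1a : ∀ j, a j z₁' = 0) (h1b : ∀ j, b j z₁' = 0) (h2a : ∀ j, a j z₂' = 0)
    (h2b : ∀ j, b j z₂' = 0) (h1g : ∀ j, g j z₁' = 0) (h1h : ∀ j, h j z₁' = 0)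
    (h2g : ∀ j, g j z₂' = 0) (h2h : ∀ j, h j z₂' = 0) :
    𝓕.c z₁ * 𝓕.c z₂ * (area (fun j => 𝓕.c (a j)) (fun j => 𝓕.c (b j)) ^ Fintype.card J *
      area (fun j => 𝓕.c (g j)) (fun j => 𝓕.c (h j)) ^ Fintype.card K) ≠ 0 := by
  intro hz
  have e1 := eq_zero_of_mul_mul_eq_zero (ia := 𝓕.ι z₁') (ib := 𝓕.ι z₂')
    (by rw [𝓕.ι_c, h11, map_one]) (by rw [𝓕.ι_c, h12, map_zero]) (by rw [𝓕.ι_c, h22, map_one])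
    (((𝓕.commute_ι_area h1a h1b).pow_right _).mul_right ((𝓕.commute_ι_area h1g h1h).pow_right _))
    (((𝓕.commute_ι_area h2a h2b).pow_right _).mul_right ((𝓕.commute_ι_area h2g h2h).pow_right _)) hz
  have e2 := eq_zero_of_area_pow_mul_eq_zero (iX := fun i => 𝓕.ι (a' i))
    (iY := fun i => 𝓕.ι (b' i)) 𝓕.sq_of_mem (X := fun j => 𝓕.c (a j)) (Y := fun j => 𝓕.c (b j))
    (fun _ => 𝓕.c_mem _) (fun _ => 𝓕.c_mem _)
    (𝓕.ι_c_dual haa) (fun i j => by rw [𝓕.ι_c, hab, map_zero])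
    (fun i j => by rw [𝓕.ι_c, hba, map_zero]) (𝓕.ι_c_dual hbb) Finset.univ
    (fun i => (𝓕.commute_ι_area (hga i) (hha i)).pow_right _)
    (fun i => (𝓕.commute_ι_area (hgb i) (hhb i)).pow_right _) e1
  have e3 := eq_zero_of_area_pow_mul_eq_zero (iX := fun i => 𝓕.ι (g' i))
    (iY := fun i => 𝓕.ι (h' i)) 𝓕.sq_of_mem (X := fun j => 𝓕.c (g j)) (Y := fun j => 𝓕.c (h j))
    (z := 1) (fun _ => 𝓕.c_mem _) (fun _ => 𝓕.c_mem _)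
    (𝓕.ι_c_dual hgg) (fun i j => by rw [𝓕.ι_c, hgh, map_zero])
    (fun i j => by rw [𝓕.ι_c, hhg, map_zero]) (𝓕.ι_c_dual hhh) Finset.univ
    (fun i => Commute.one_right _) (fun i => Commute.one_right _) (by rw [mul_one]; exact e2)
  exact one_ne_zero e3

end Coordinates

end FormAlgebra

end

section

/-- The space of modes `q`, of a twist parameter `ζ`, and of means `β`. -/
abbrev Modes (J K : Type*) : Type _ := (J → ℂ) × ℂ × (K → ℂ)

namespace Modes

variable {J K : Type*}

/-- Real part of a mode. -/
noncomputable def qre (j : J) : Modes J K →L[ℝ] ℝ :=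
  Complex.reCLM ∘L (ContinuousLinearMap.proj j ∘L ContinuousLinearMap.fst ℝ (J → ℂ) (ℂ × (K → ℂ)))

/-- Imaginary part of a mode. -/
noncomputable def qim (j : J) : Modes J K →L[ℝ] ℝ :=
  Complex.imCLM ∘L (ContinuousLinearMap.proj j ∘L ContinuousLinearMap.fst ℝ (J → ℂ) (ℂ × (K → ℂ)))

/-- Real part of the twist parameter. -/
noncomputable def zre : Modes J K →L[ℝ] ℝ :=
  Complex.reCLM ∘L (ContinuousLinearMap.fst ℝ ℂ (K → ℂ) ∘L
    ContinuousLinearMap.snd ℝ (J → ℂ) (ℂ × (K → ℂ)))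

/-- Imaginary part of the twist parameter. -/
noncomputable def zim : Modes J K →L[ℝ] ℝ :=
  Complex.imCLM ∘L (ContinuousLinearMap.fst ℝ ℂ (K → ℂ) ∘L
    ContinuousLinearMap.snd ℝ (J → ℂ) (ℂ × (K → ℂ)))

/-- Real part of a mean. -/
noncomputable def bre (i : K) : Modes J K →L[ℝ] ℝ :=
  Complex.reCLM ∘L (ContinuousLinearMap.proj i ∘L (ContinuousLinearMap.snd ℝ ℂ (K → ℂ) ∘L
    ContinuousLinearMap.snd ℝ (J → ℂ) (ℂ × (K → ℂ))))

/-- Imaginary part of a mean. -/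
noncomputable def bim (i : K) : Modes J K →L[ℝ] ℝ :=
  Complex.imCLM ∘L (ContinuousLinearMap.proj i ∘L (ContinuousLinearMap.snd ℝ ℂ (K → ℂ) ∘L
    ContinuousLinearMap.snd ℝ (J → ℂ) (ℂ × (K → ℂ))))

@[simp] theorem qre_apply (j : J) (v : Modes J K) : qre j v = (v.1 j).re := rfl
@[simp] theorem qim_apply (j : J) (v : Modes J K) : qim j v = (v.1 j).im := rfl
@[simp] theorem zre_apply (v : Modes J K) : zre v = v.2.1.re := rfl
@[simp] theorem zim_apply (v : Modes J K) : zim v = v.2.1.im := rfl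
@[simp] theorem bre_apply (i : K) (v : Modes J K) : bre i v = (v.2.2 i).re := rfl
@[simp] theorem bim_apply (i : K) (v : Modes J K) : bim i v = (v.2.2 i).im := rfl

variable [Fintype J] [Fintype K]

/-- Weighted square norm of the modes. -/
noncomputable def wsq (k : J → ℝ) (q : J → ℂ) : ℝ := ∑ j, k j * ‖q j‖ ^ 2

theorem wsq_eq_wnorm (k : J → ℝ) (q : J → ℂ) :
    wsq k q = wnorm k (fun j => (q j).re) (fun j => (q j).im) := by
  refine Finset.sum_congr rfl fun j _ => ?_
  rw [← Complex.normSq_eq_norm_sq, Complex.normSq_apply]; ring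

theorem continuous_wsq (k : J → ℝ) : Continuous (wsq k) := by
  unfold wsq; fun_prop

theorem wsq_nonneg {k : J → ℝ} (hk : ∀ j, 0 ≤ k j) (q : J → ℂ) : 0 ≤ wsq k q :=
  Finset.sum_nonneg fun j _ => mul_nonneg (hk j) (by positivity)

theorem eq_zero_of_wsq_eq_zero {k : J → ℝ} (hk : ∀ j, 0 < k j) {q : J → ℂ} (h : wsq k q = 0) :
    q = 0 := by
  funext j
  have := (Finset.sum_eq_zero_iff_of_nonneg fun j _ =>
    mul_nonneg (hk j).le (by positivity)).1 h j (Finset.mem_univ j)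
  simpa [(hk j).ne'] using this

theorem isCompact_wsq_le {k : J → ℝ} (hk : ∀ j, 0 < k j) (C : ℝ) :
    IsCompact {q : J → ℂ | wsq k q ≤ C} := by
  refine Metric.isCompact_of_isClosed_isBounded
    (isClosed_le (continuous_wsq k) continuous_const) ?_
  rw [← Bornology.forall_isBounded_image_eval_iff]
  intro j
  refine isBounded_iff_forall_norm_le.2 ⟨√(C / k j), ?_⟩
  rintro _ ⟨q, hq, rfl⟩
  refine Real.le_sqrt_of_sq_le ?_
  rw [le_div_iff₀ (hk j), mul_comm]
  exact (Finset.single_le_sum (f := fun j => k j * ‖q j‖ ^ 2)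
    (fun j _ => mul_nonneg (hk j).le (by positivity)) (Finset.mem_univ j)).trans hq

theorem finrank_modes : finrank ℝ (Modes J K) = 2 * Fintype.card J + 2 * Fintype.card K + 2 := by
  have h : ∀ I : Type _, ∀ [Fintype I], finrank ℝ (I → ℂ) = 2 * Fintype.card I := by
    intro I _
    rw [Module.finrank_pi_fintype]
    simp [mul_comm]
  rw [Module.finrank_prod, Module.finrank_prod, h, Complex.finrank_real_complex,
    Module.finrank_pi_fintype]
  simp
  ring

variable {𝓐 : Type*} [NormedRing 𝓐] [NormedAlgebra ℝ 𝓐] [Nontrivial 𝓐]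
  (𝓕 : FormAlgebra (Modes J K) 𝓐)

/-- The constant volume form. -/
noncomputable def vol : 𝓐 :=
  𝓕.c zre * 𝓕.c zim * (area (fun j => 𝓕.c (qre j)) (fun j => 𝓕.c (qim j)) ^ Fintype.card J *
      area (fun j => 𝓕.c (bre j)) (fun j => 𝓕.c (bim j)) ^ Fintype.card K)

theorem vol_ne_zero : vol 𝓕 ≠ 0 := by
  classical
  refine 𝓕.volume_ne_zero (a' := fun j => (Pi.single j 1, 0, 0))
    (b' := fun j => (Pi.single j Complex.I, 0, 0)) (g' := fun j => (0, 0, Pi.single j 1))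
    (h' := fun j => (0, 0, Pi.single j Complex.I)) (z₁' := (0, 1, 0)) (z₂' := (0, Complex.I, 0))
    ?_ ?_ ?_ ?_ ?_ ?_ ?_ ?_ ?_ ?_ ?_ ?_ ?_ ?_ ?_ ?_ ?_ ?_ ?_ ?_ ?_ ?_ ?_
  all_goals first | (intro i j; simp [Pi.single_apply]; done) |
    (intro j; simp; done) | (simp; done) | skip
  all_goals (intro i j; by_cases h : j = i <;> simp [h])
  all_goals exact Ne.symm h

end Modes

end

section

namespace Modes

variable {J K : Type*} [Fintype J] [Fintype K]

theorem hasFDerivAt_norm_twist {v : Modes J K} (h : v.2.1 ≠ 0) :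
    HasFDerivAt (fun v : Modes J K => ‖v.2.1‖)
      (‖v.2.1‖⁻¹ • (v.2.1.re • (zre : Modes J K →L[ℝ] ℝ) + v.2.1.im • zim)) v := by
  have e : (fun v : Modes J K => ‖v.2.1‖) = fun v => √(zre v ^ 2 + zim v ^ 2) := by
    funext v; rw [Complex.norm_eq_sqrt_sq_add_sq]; rfl
  have hn : ‖v.2.1‖ = √(zre v ^ 2 + zim v ^ 2) := congrFun e v
  have hpos : 0 < ‖v.2.1‖ := norm_pos_iff.2 h
  rw [e, hn]
  have h0 : zre v ^ 2 + zim v ^ 2 ≠ 0 := by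
    intro h0; rw [hn, h0] at hpos; simp at hpos
  refine ((((zre (J := J) (K := K)).hasFDerivAt.pow 2).add
    ((zim (J := J) (K := K)).hasFDerivAt.pow 2)).sqrt h0).congr_fderiv ?_
  have hn' : √(v.2.1.re ^ 2 + v.2.1.im ^ 2) = ‖v.2.1‖ := hn.symm
  rw [← hn]
  ext w <;> simp [hn']
  field_simp

theorem hasFDerivAt_twist_re {v : Modes J K} (h : v.2.1 ≠ 0) :
    HasFDerivAt (fun v : Modes J K => v.2.1.re / ‖v.2.1‖)
      (-(v.2.1.im * ‖v.2.1‖⁻¹ ^ 3) • (v.2.1.re • (zim : Modes J K →L[ℝ] ℝ) - v.2.1.im • zre)) v := by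
  have hn : ‖v.2.1‖ ≠ 0 := norm_ne_zero_iff.2 h
  have hsq : ‖v.2.1‖ ^ 2 = v.2.1.re ^ 2 + v.2.1.im ^ 2 := by
    rw [← Complex.normSq_eq_norm_sq, Complex.normSq_apply]; ring
  refine ((zre (J := J) (K := K)).hasFDerivAt.mul
    ((hasDerivAt_inv hn).comp_hasFDerivAt v (hasFDerivAt_norm_twist h))).congr_fderiv ?_
  simp only [Function.comp, zre_apply]
  match_scalars
  · field_simp
    linear_combination hsq
  · field_simp

theorem hasFDerivAt_twist_im {v : Modes J K} (h : v.2.1 ≠ 0) :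
    HasFDerivAt (fun v : Modes J K => v.2.1.im / ‖v.2.1‖)
      ((v.2.1.re * ‖v.2.1‖⁻¹ ^ 3) • (v.2.1.re • (zim : Modes J K →L[ℝ] ℝ) - v.2.1.im • zre)) v := by
  have hn : ‖v.2.1‖ ≠ 0 := norm_ne_zero_iff.2 h
  have hsq : ‖v.2.1‖ ^ 2 = v.2.1.re ^ 2 + v.2.1.im ^ 2 := by
    rw [← Complex.normSq_eq_norm_sq, Complex.normSq_apply]; ring
  refine ((zim (J := J) (K := K)).hasFDerivAt.mul
    ((hasDerivAt_inv hn).comp_hasFDerivAt v (hasFDerivAt_norm_twist h))).congr_fderiv ?_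
  simp only [Function.comp, zim_apply]
  match_scalars
  · field_simp
  · field_simp
    linear_combination hsq

/-- The family `q` with the modes in `E` multiplied by `ζ / |ζ|`. -/
noncomputable def twisted (E : J → Prop) [DecidablePred E] (v : Modes J K) (j : J) : ℂ :=
  if E j then v.2.1 / (‖v.2.1‖ : ℂ) * v.1 j else v.1 j

variable {𝓐 : Type*} [NormedRing 𝓐] [NormedAlgebra ℝ 𝓐]
  (𝓕 : FormAlgebra (Modes J K) 𝓐)

theorem mul_transgression_eq (k : J → ℝ) (E : J → Prop) [DecidablePred E] {x y : J → Modes J K → ℝ}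
    {gx gy : K → Modes J K → ℝ} (ν ψ φ : ℝ → ℝ) {v : Modes J K} (h : v.2.1 ≠ 0) {N : ℕ}
    (hN : Fintype.card J = N + 1)
    (hx : ∀ j, x j =ᶠ[nhds v] fun v => (twisted E v j).re)
    (hy : ∀ j, y j =ᶠ[nhds v] fun v => (twisted E v j).im)
    (hgx : ∀ i, gx i =ᶠ[nhds v] bre i) (hgy : ∀ i, gy i =ᶠ[nhds v] bim i) :
    𝓕.c (v.2.1.re • zre + v.2.1.im • zim) *
      𝓕.transgression k (fun j => qre j) (fun j => qim j) x y gx gy ν ψ φ v =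
    (ψ (wsq k v.1) * ν (wsq k v.1) * ν (wsq k v.1) * φ (wsq (fun _ => 1) v.2.2) *
      (∑ j, ‖v.1 j‖ ^ 2 * if E j then 1 else 0) *
      ((2 * ν (wsq k v.1)) ^ N * (2 * wsq k v.1))) • vol 𝓕 := by
  have hn : ‖v.2.1‖ ≠ 0 := norm_ne_zero_iff.2 h
  have hsq : ‖v.2.1‖ ^ 2 = v.2.1.re ^ 2 + v.2.1.im ^ 2 := by
    rw [← Complex.normSq_eq_norm_sq, Complex.normSq_apply]; ring
  have hre : ∀ v : Modes J K, (v.2.1 / (‖v.2.1‖ : ℂ)).re = v.2.1.re / ‖v.2.1‖ := fun v => by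
    rw [← Complex.div_ofReal_re]
  have him : ∀ v : Modes J K, (v.2.1 / (‖v.2.1‖ : ℂ)).im = v.2.1.im / ‖v.2.1‖ := fun v => by
    rw [← Complex.div_ofReal_im]
  have hqre : ∀ j, HasFDerivAt (qre j : Modes J K → ℝ) (qre j) v := fun j => (qre j).hasFDerivAt
  have hqim : ∀ j, HasFDerivAt (qim j : Modes J K → ℝ) (qim j) v := fun j => (qim j).hasFDerivAt
  set ω : Modes J K →L[ℝ] ℝ := v.2.1.re • zim - v.2.1.im • zre with hω
  set u : J → ℝ := fun j => if E j then v.2.1.re / ‖v.2.1‖ else 1 with hu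
  set w : J → ℝ := fun j => if E j then v.2.1.im / ‖v.2.1‖ else 0 with hw
  set U : J → 𝓐 := fun j => if E j then -(v.2.1.im * ‖v.2.1‖⁻¹ ^ 3) • 𝓕.c ω else 0 with hU
  set W : J → 𝓐 := fun j => if E j then (v.2.1.re * ‖v.2.1‖⁻¹ ^ 3) • 𝓕.c ω else 0 with hW
  have dq : ∀ j, 𝓕.d (fun j => (qre j : Modes J K → ℝ)) v j = 𝓕.c (qre j) := fun j => by
    rw [FormAlgebra.d, ContinuousLinearMap.fderiv]
  have dp : ∀ j, 𝓕.d (fun j => (qim j : Modes J K → ℝ)) v j = 𝓕.c (qim j) := fun j => by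
    rw [FormAlgebra.d, ContinuousLinearMap.fderiv]
  have hωZ : 𝓕.c zre * 𝓕.c zim * 𝓕.c ω = 0 := by
    have h1 : 𝓕.c zim * 𝓕.c zre = -(𝓕.c zre * 𝓕.c zim) :=
      anticomm 𝓕.sq_of_mem (𝓕.c_mem _) (𝓕.c_mem _)
    rw [hω, map_sub, map_smul, map_smul, mul_sub, mul_smul_comm, mul_smul_comm, mul_assoc,
      𝓕.c_sq, mul_assoc, h1, mul_neg, ← mul_assoc, 𝓕.c_sq]
    simp
  have key := 𝓕.mul_transgression (k := k) (qx := fun j => (qre j : Modes J K → ℝ))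
    (qy := fun j => (qim j : Modes J K → ℝ)) (x := x) (y := y) (gx := gx) (gy := gy)
    (ν := ν) (ψ := ψ) (φ := φ) (v := v) (u := u) (w := w) (U := U) (W := W) hN
    (ρ := 𝓕.c (v.2.1.re • zre + v.2.1.im • zim)) (ϑ := (‖v.2.1‖⁻¹ ^ 2) • 𝓕.c ω)
    (Z₁ := 𝓕.c zre) (Z₂ := 𝓕.c zim) (e := fun j => if E j then 1 else 0)
    (by
      intro j; by_cases hE : E j <;> simp only [hu, hw, hE, if_true, if_false]
      · field_simp; exact hsq.symm
      · norm_num)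
    (by
      intro j; rw [(hx j).self_of_nhds]
      by_cases hE : E j <;> simp [twisted, hu, hw, hE, hre, him])
    (by
      intro j; rw [(hy j).self_of_nhds]
      by_cases hE : E j <;> simp [twisted, hu, hw, hE, hre, him])
    (by
      intro j
      rw [dq, dp, FormAlgebra.d, (hx j).fderiv_eq]
      by_cases hE : E j
      · have h1 := (hasFDerivAt_twist_re h).mul (hqre j)
        have h2 := (hasFDerivAt_twist_im h).mul (hqim j)
        have hd := (h1.sub h2).congr_of_eventuallyEq
          (f₁ := fun v : Modes J K => (twisted E v j).re) (Filter.Eventually.of_forall fun v => by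
            simp [twisted, hE, hre, him])
        rw [hd.fderiv]
        simp only [hu, hw, hU, hW, hω, hE, if_true, map_sub, map_add, map_smul]
      · have hd : (fun v : Modes J K => (twisted E v j).re) = qre j := by
          funext v; simp [twisted, hE]
        rw [hd, ContinuousLinearMap.fderiv]
        simp [hu, hw, hU, hW, hE])
    (by
      intro j
      rw [dq, dp, FormAlgebra.d, (hy j).fderiv_eq]
      by_cases hE : E j
      · have h1 := (hasFDerivAt_twist_re h).mul (hqim j)
        have h2 := (hasFDerivAt_twist_im h).mul (hqre j)
        have hd := (h1.add h2).congr_of_eventuallyEq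
          (f₁ := fun v : Modes J K => (twisted E v j).im) (Filter.Eventually.of_forall fun v => by
            simp [twisted, hE, hre, him])
        rw [hd.fderiv]
        simp only [hu, hw, hU, hW, hω, hE, if_true, map_sub, map_add, map_smul]
      · have hd : (fun v : Modes J K => (twisted E v j).im) = qim j := by
          funext v; simp [twisted, hE]
        rw [hd, ContinuousLinearMap.fderiv]
        simp [hu, hw, hU, hW, hE])
    (𝓕.c_mem _) (𝓕.c_mem _) (𝓕.L.smul_mem _ (𝓕.c_mem _))
    (by
      have h1 : 𝓕.c zim * 𝓕.c zre = -(𝓕.c zre * 𝓕.c zim) :=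
        anticomm 𝓕.sq_of_mem (𝓕.c_mem _) (𝓕.c_mem _)
      simp only [hω, map_add, map_sub, map_smul, mul_smul_comm, add_mul, mul_sub, smul_mul_assoc,
        𝓕.c_sq, h1]
      match_scalars
      field_simp
      linear_combination -hsq)
    (by intro j; by_cases hE : E j <;> simp [hU, hE, hωZ])
    (by intro j; by_cases hE : E j <;> simp [hW, hE, hωZ])
    (by
      intro j; by_cases hE : E j <;> simp only [hu, hw, hU, hW, hE, if_true, if_false]
      · match_scalars
        field_simp
        linear_combination -hsq
      · simp)
  have hwq : 𝓕.wn k (fun j => (qre j : Modes J K → ℝ)) (fun j => (qim j : Modes J K → ℝ)) v =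
    wsq k v.1 := (wsq_eq_wnorm k v.1).symm
  have hwg : 𝓕.wn (fun _ => 1) gx gy v = wsq (fun _ => 1) v.2.2 := by
    rw [wsq_eq_wnorm, FormAlgebra.wn]
    congr 1
    · funext i; exact (hgx i).self_of_nhds
    · funext i; exact (hgy i).self_of_nhds
  rw [key, hwq, hwg]
  have hg : 𝓕.areaForm gx gy v = area (fun j => 𝓕.c (bre j)) (fun j => 𝓕.c (bim j)) := by
    rw [FormAlgebra.areaForm]
    congr 1
    · funext i; rw [FormAlgebra.d, (hgx i).fderiv_eq, ContinuousLinearMap.fderiv]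
    · funext i; rw [FormAlgebra.d, (hgy i).fderiv_eq, ContinuousLinearMap.fderiv]
  have hq : 𝓕.areaForm (fun j => (qre j : Modes J K → ℝ)) (fun j => (qim j : Modes J K → ℝ)) v =
      area (fun j => 𝓕.c (qre j)) (fun j => 𝓕.c (qim j)) := by
    rw [FormAlgebra.areaForm]
    congr 1
    · funext i; exact dq i
    · funext i; exact dp i
  rw [hg, hq, vol, hN]
  congr 4
  refine funext fun j => ?_
  rw [← Complex.normSq_eq_norm_sq, Complex.normSq_apply]
  simp only [qre_apply, qim_apply]
  ring

end Modes

end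

section

/-- A decreasing cutoff, equal to one on `(-∞, 2]` and to zero on `[3, ∞)`. -/
noncomputable def outerCutoff (t : ℝ) : ℝ := Real.smoothTransition (3 - t)

theorem contDiff_outerCutoff : ContDiff ℝ 2 outerCutoff :=
  Real.smoothTransition.contDiff.comp (by fun_prop)

theorem deriv_outerCutoff_nonpos (t : ℝ) : deriv outerCutoff t ≤ 0 := by
  have h : Monotone fun t => -outerCutoff t := fun a b hab =>
    neg_le_neg (Real.smoothTransition.monotone (by linarith))
  have := h.deriv_nonneg (x := t)
  rw [deriv.fun_neg] at this
  linarith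

theorem deriv_outerCutoff_of_lt {t : ℝ} (h : t < 2) : deriv outerCutoff t = 0 := by
  have : outerCutoff =ᶠ[nhds t] fun _ => 1 := Filter.eventually_of_mem (Iio_mem_nhds h)
    fun s hs => Real.smoothTransition.one_of_one_le (by have := Set.mem_Iio.1 hs; linarith)
  rw [this.deriv_eq, deriv_const]

theorem deriv_outerCutoff_of_gt {t : ℝ} (h : 3 < t) : deriv outerCutoff t = 0 := by
  have : outerCutoff =ᶠ[nhds t] fun _ => 0 := Filter.eventually_of_mem (Ioi_mem_nhds h)
    fun s hs => Real.smoothTransition.zero_of_nonpos (by have := Set.mem_Ioi.1 hs; linarith)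
  rw [this.deriv_eq, deriv_const]

theorem exists_deriv_outerCutoff_ne_zero : ∃ t, deriv outerCutoff t ≠ 0 := by
  by_contra! h
  have := is_const_of_deriv_eq_zero (contDiff_outerCutoff.differentiable two_ne_zero) h 2 3
  norm_num [outerCutoff] at this

namespace Modes

variable {J K : Type*} [Fintype J] [Fintype K]

/-- The generator of the weighted circle action. -/
noncomputable def gen (k : J → ℝ) (v : Modes J K) : Modes J K :=
  (fun j => Complex.I * k j * v.1 j, 0, 0)

theorem isCompact_box {k : J → ℝ} (hk : ∀ j, 0 < k j) (C : ℝ) :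
    IsCompact {v : Modes J K | wsq k v.1 ≤ 2 ∧ ‖v.2.1‖ ≤ 2 ∧ wsq (fun _ => 1) v.2.2 ≤ C} := by
  have := (isCompact_wsq_le hk 2).prod ((isCompact_closedBall (0 : ℂ) 2).prod
    (isCompact_wsq_le (k := fun _ : K => (1 : ℝ)) (fun _ => one_pos) C))
  refine this.of_isClosed_subset ?_ ?_
  · exact (isClosed_le ((continuous_wsq k).comp continuous_fst) continuous_const).inter
      ((isClosed_le continuous_snd.fst.norm continuous_const).inter
        (isClosed_le ((continuous_wsq _).comp continuous_snd.snd) continuous_const))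
  · rintro v ⟨h1, h2, h3⟩
    exact ⟨h1, by simpa using h2, h3⟩

theorem exists_common_zero {k : J → ℝ} (hk : ∀ j, 0 < k j) (E : J → Prop) [DecidablePred E]
    (hE : ∃ j, E j) {F : Modes J K → J → ℂ} {G : Modes J K → K → ℂ} (hF : ContDiff ℝ 2 F)
    (hG : ContDiff ℝ 2 G) (hFξ : ∀ v j, fderiv ℝ F v (gen k v) j = Complex.I * k j * F v j)
    (hGξ : ∀ v, fderiv ℝ G v (gen k v) = 0)
    (hFout : ∀ v : Modes J K, 1 ≤ ‖v.2.1‖ → F v = twisted E v)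
    (hGout : ∀ v : Modes J K, 1 ≤ ‖v.2.1‖ → G v = v.2.2)
    (hprop : ∃ C, ∀ v : Modes J K, wsq k v.1 ≤ 2 → wsq (fun _ => 1) (G v) ≤ 1 →
      wsq (fun _ => 1) v.2.2 ≤ C) :
    ∃ v : Modes J K, 1 ≤ wsq k v.1 ∧ wsq k v.1 ≤ 2 ∧ F v = 0 ∧ G v = 0 := by
  classical
  by_contra! hno
  obtain ⟨C, hC⟩ := hprop
  obtain ⟨j₀, hj₀⟩ := hE
  have : Nonempty J := ⟨j₀⟩
  obtain ⟨N, hN⟩ : ∃ N, Fintype.card J = N + 1 :=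
    ⟨_, (Nat.succ_pred_eq_of_pos Fintype.card_pos).symm⟩
  obtain ⟨μ, hμ, hμF⟩ : ∃ μ, 0 < μ ∧ ∀ v ∈ {v : Modes J K | wsq k v.1 ≤ 2 ∧ ‖v.2.1‖ ≤ 2 ∧
      wsq (fun _ => 1) v.2.2 ≤ C} ∩ {v | 1 ≤ wsq k v.1},
      μ ≤ wsq k (F v) + wsq (fun _ => 1) (G v) := by
    refine IsCompact.exists_forall_le' ((isCompact_box hk C).inter_right
      (isClosed_le continuous_const ((continuous_wsq k).comp continuous_fst))) ?_ ?_
    · exact (((continuous_wsq k).comp hF.continuous).add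
        ((continuous_wsq _).comp hG.continuous)).continuousOn
    · rintro v ⟨⟨h2, -, -⟩, h1⟩
      have hFn : 0 ≤ wsq k (F v) := wsq_nonneg (fun j => (hk j).le) _
      have hGn : 0 ≤ wsq (fun _ => 1) (G v) := wsq_nonneg (fun _ => zero_le_one) _
      by_contra! hle
      exact hno v h1 h2 (eq_zero_of_wsq_eq_zero hk (by linarith))
        (eq_zero_of_wsq_eq_zero (fun _ => one_pos) (by linarith))
  set δ : ℝ := min (μ / 2) 1 with hδ
  have hδ0 : 0 < δ := by positivity
  have hδ1 : δ ≤ 1 := min_le_right _ _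
  have hδμ : δ ≤ μ / 2 := min_le_left _ _
  obtain ⟨ν, hν, hνd⟩ := exists_contDiff_inv (d := min (μ / 4) (1 / 2)) (by positivity)
  have hν1 : ∀ t, 1 < t → ν t * t = 1 ∧ ν t + deriv ν t * t = 0 := fun t ht =>
    hνd t (lt_of_le_of_lt (min_le_right _ _) (by linarith))
  set φ : ℝ → ℝ := fun t => Real.smoothTransition (1 - t / δ) with hφ
  set ψ : ℝ → ℝ := fun t => Real.smoothTransition (t - 1) * Real.smoothTransition (2 - t) with hψ
  have hφd : ContDiff ℝ 2 φ := Real.smoothTransition.contDiff.comp (by fun_prop)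
  have hψd : ContDiff ℝ 2 ψ := (Real.smoothTransition.contDiff.comp (by fun_prop)).mul
    (Real.smoothTransition.contDiff.comp (by fun_prop))
  have hφ0 : ∀ t, 0 ≤ φ t := fun t => Real.smoothTransition.nonneg _
  have hψ0 : ∀ t, 0 ≤ ψ t := fun t => mul_nonneg (Real.smoothTransition.nonneg _)
    (Real.smoothTransition.nonneg _)
  have hφs : ∀ t, φ t ≠ 0 → t < δ := by
    intro t ht
    by_contra! h
    exact ht (Real.smoothTransition.zero_of_nonpos (by
      rw [sub_nonpos, one_le_div hδ0]; exact h))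
  have hψs : ∀ t, ψ t ≠ 0 → 1 < t ∧ t < 2 := by
    intro t ht
    constructor
    · by_contra! h
      exact ht (by simp only [hψ]; rw [Real.smoothTransition.zero_of_nonpos (by linarith), zero_mul])
    · by_contra! h
      exact ht (by
        simp only [hψ]
        rw [Real.smoothTransition.zero_of_nonpos (x := 2 - t) (by linarith), mul_zero])
  set 𝓕 := formAlgebra (Modes J K)
  have : Nontrivial (FormOp (Modes J K)) := nontrivial_formOp _
  set x : J → Modes J K → ℝ := fun j v => (F v j).re with hx
  set y : J → Modes J K → ℝ := fun j v => (F v j).im with hy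
  set gx : K → Modes J K → ℝ := fun j v => (G v j).re with hgx
  set gy : K → Modes J K → ℝ := fun j v => (G v j).im with hgy
  have hFj : ∀ j, ContDiff ℝ 2 fun v => F v j := fun j => contDiff_pi.1 hF j
  have hGj : ∀ j, ContDiff ℝ 2 fun v => G v j := fun j => contDiff_pi.1 hG j
  have hxd : ∀ j, ContDiff ℝ 2 (x j) := fun j => Complex.reCLM.contDiff.comp (hFj j)
  have hyd : ∀ j, ContDiff ℝ 2 (y j) := fun j => Complex.imCLM.contDiff.comp (hFj j)
  have hgxd : ∀ j, ContDiff ℝ 2 (gx j) := fun j => Complex.reCLM.contDiff.comp (hGj j)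
  have hgyd : ∀ j, ContDiff ℝ 2 (gy j) := fun j => Complex.imCLM.contDiff.comp (hGj j)
  have hqxd : ∀ j, ContDiff ℝ 2 (qre j : Modes J K → ℝ) := fun j =>
    ContinuousLinearMap.contDiff (qre j : Modes J K →L[ℝ] ℝ)
  have hqyd : ∀ j, ContDiff ℝ 2 (qim j : Modes J K → ℝ) := fun j =>
    ContinuousLinearMap.contDiff (qim j : Modes J K →L[ℝ] ℝ)
  have hDF : ∀ v j, HasFDerivAt (fun v => F v j)
      (ContinuousLinearMap.proj j ∘L fderiv ℝ F v) v := fun v j =>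
    hasFDerivAt_pi'.1 ((hF.differentiable two_ne_zero) v).hasFDerivAt j
  have hDG : ∀ v j, HasFDerivAt (fun v => G v j)
      (ContinuousLinearMap.proj j ∘L fderiv ℝ G v) v := fun v j =>
    hasFDerivAt_pi'.1 ((hG.differentiable two_ne_zero) v).hasFDerivAt j
  set Tr : Modes J K → FormOp (Modes J K) :=
    𝓕.transgression k (fun j => qre j) (fun j => qim j) x y gx gy ν ψ φ with hTr
  have hTrd : ContDiff ℝ 1 Tr :=
    𝓕.contDiff_transgression hqxd hqyd hxd hyd hgxd hgyd hν hψd hφd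
  have hwF : ∀ v, 𝓕.wn k x y v = wsq k (F v) := fun v => (wsq_eq_wnorm k (F v)).symm
  have hwG : ∀ v, 𝓕.wn (fun _ => 1) gx gy v = wsq (fun _ => 1) (G v) :=
    fun v => (wsq_eq_wnorm _ (G v)).symm
  have hwq : ∀ v : Modes J K, 𝓕.wn k (fun j => (qre j : Modes J K → ℝ)) (fun j => qim j) v =
    wsq k v.1 := fun v => (wsq_eq_wnorm k v.1).symm
  set κ : Modes J K → ℝ := fun v => outerCutoff (‖v.2.1‖ ^ 2) with hκ
  have hκs : ∀ v, κ v ≠ 0 → ‖v.2.1‖ ≤ 2 := by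
    intro v hv
    by_contra! h
    exact hv (Real.smoothTransition.zero_of_nonpos (by nlinarith))
  have hκd : ∀ v, HasFDerivAt κ
      ((2 * deriv outerCutoff (‖v.2.1‖ ^ 2)) • (v.2.1.re • (zre : Modes J K →L[ℝ] ℝ) +
        v.2.1.im • zim)) v := by
    intro v
    have e : (fun v : Modes J K => ‖v.2.1‖ ^ 2) = fun v => zre v ^ 2 + zim v ^ 2 := by
      funext v
      rw [← Complex.normSq_eq_norm_sq, Complex.normSq_apply, zre_apply, zim_apply]; ring
    have h1 : HasFDerivAt (fun v : Modes J K => ‖v.2.1‖ ^ 2)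
        ((2 : ℝ) • (v.2.1.re • (zre : Modes J K →L[ℝ] ℝ) + v.2.1.im • zim)) v := by
      rw [e]
      refine (((zre (J := J) (K := K)).hasFDerivAt.pow 2).add
        ((zim (J := J) (K := K)).hasFDerivAt.pow 2)).congr_fderiv ?_
      simp only [zre_apply, zim_apply]
      norm_num
      module
    refine (((contDiff_outerCutoff.differentiable two_ne_zero) _).hasDerivAt.comp_hasFDerivAt v
      h1).congr_fderiv ?_
    module
  have hκ1 : ContDiff ℝ 1 κ := by
    refine (contDiff_outerCutoff.of_le one_le_two).comp ?_
    exact contDiff_snd.fst.norm_sq ℝ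
  have hTrs : ∀ v, Tr v ≠ 0 → (1 < wsq k v.1 ∧ wsq k v.1 < 2) ∧ wsq (fun _ => 1) (G v) < δ := by
    intro v hv
    constructor
    · refine hψs _ fun h0 => hv ?_
      rw [hTr, FormAlgebra.transgression, hwq, h0, zero_smul, zero_mul]
    · refine hφs _ fun h0 => hv ?_
      rw [hTr, FormAlgebra.transgression, hwG, h0, zero_smul]
      simp
  set m : Modes J K → ℝ := fun v => (2 * deriv outerCutoff (‖v.2.1‖ ^ 2)) *
    (ψ (wsq k v.1) * ν (wsq k v.1) * ν (wsq k v.1) * φ (wsq (fun _ => 1) v.2.2) *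
      (∑ j, ‖v.1 j‖ ^ 2 * if E j then 1 else 0) *
      ((2 * ν (wsq k v.1)) ^ N * (2 * wsq k v.1))) with hm
  have hW : ∀ v, 𝓕.HasExtDeriv (fun v => κ v • Tr v) (m v • vol 𝓕) v := by
    intro v
    have h1 : 𝓕.HasExtDeriv (fun v => κ v • Tr v) (𝓕.c
        ((2 * deriv outerCutoff (‖v.2.1‖ ^ 2)) • (v.2.1.re • (zre : Modes J K →L[ℝ] ℝ) +
        v.2.1.im • zim)) * Tr v) v := by
      by_cases h0 : κ v = 0
      · refine (FormAlgebra.HasExtDeriv.smul (hκd v) (f' := 𝓕.ext (fderiv ℝ Tr v))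
          ⟨_, ((hTrd.differentiable one_ne_zero) v).hasFDerivAt, rfl⟩).congr_deriv ?_
        rw [h0, zero_smul, add_zero]
      · refine (FormAlgebra.HasExtDeriv.smul (hκd v) (f' := 0)
          (𝓕.hasExtDeriv_transgression hqxd hqyd hxd hyd hgxd hgyd hν hψd hφd v (gen k v)
            finrank_modes ?_ ?_ ?_ ?_ ?_ ?_ ?_)).congr_deriv ?_
        · intro j; rw [ContinuousLinearMap.fderiv]; simp [gen]
        · intro j; rw [ContinuousLinearMap.fderiv]; simp [gen]
        · intro j
          have := Complex.reCLM.hasFDerivAt.comp v (hDF v j)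
          rw [show x j = Complex.reCLM ∘ fun v => F v j from rfl, this.fderiv]
          simp [hFξ, hy]
        · intro j
          have := Complex.imCLM.hasFDerivAt.comp v (hDF v j)
          rw [show y j = Complex.imCLM ∘ fun v => F v j from rfl, this.fderiv]
          simp [hFξ, hx]
        · intro j
          have := Complex.reCLM.hasFDerivAt.comp v (hDG v j)
          rw [show gx j = Complex.reCLM ∘ fun v => G v j from rfl, this.fderiv]
          simp [hGξ]
        · intro j
          have := Complex.imCLM.hasFDerivAt.comp v (hDG v j)
          rw [show gy j = Complex.imCLM ∘ fun v => G v j from rfl, this.fderiv]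
          simp [hGξ]
        · rw [hwq, hwF, hwG]
          intro hψv hφv
          obtain ⟨hR1, hR2⟩ := hψs _ hψv
          have hGv := hφs _ hφv
          have hb := hC v hR2.le (by linarith)
          have hμv := hμF v ⟨⟨hR2.le, hκs v h0, hb⟩, hR1.le⟩
          have hF1 : min (μ / 4) (1 / 2) < wsq k (F v) :=
            lt_of_le_of_lt (min_le_left _ _) (by linarith)
          refine ⟨fun hξ => ?_, (hν1 _ hR1).2, (hνd _ hF1).2, (hν1 _ hR1).1, (hνd _ hF1).1⟩
          have hq : v.1 = 0 := by
            funext j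
            have := congrFun (congrArg Prod.fst hξ) j
            simpa [gen, (hk j).ne'] using this
          rw [hq] at hR1
          simp [wsq] at hR1
          linarith
        · rw [smul_zero, add_zero]
    refine h1.congr_deriv ?_
    rcases le_or_gt ‖v.2.1‖ 1 with hle | hgt
    · have : deriv outerCutoff (‖v.2.1‖ ^ 2) = 0 := deriv_outerCutoff_of_lt (by
        nlinarith [norm_nonneg v.2.1])
      simp [hm, this]
    · have hnear : ∀ᶠ w : Modes J K in nhds v, 1 ≤ ‖w.2.1‖ := by
        have : ContinuousAt (fun w : Modes J K => ‖w.2.1‖) v := by fun_prop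
        exact (this.eventually (lt_mem_nhds hgt)).mono fun w hw => hw.le
      rw [map_smul, smul_mul_assoc, mul_transgression_eq 𝓕 k E ν ψ φ
        (norm_pos_iff.1 (one_pos.trans hgt)) hN, smul_smul]
      · exact fun j => hnear.mono fun w hw => by simp only [hx, hFout w hw]
      · exact fun j => hnear.mono fun w hw => by simp only [hy, hFout w hw]
      · exact fun j => hnear.mono fun w hw => by simp only [hgx, hGout w hw]; rfl
      · exact fun j => hnear.mono fun w hw => by simp only [hgy, hGout w hw]; rfl
  obtain ⟨ℓ, hℓ⟩ := SeparatingDual.exists_eq_one (R := ℝ) (vol_ne_zero 𝓕)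
  have hstokes := 𝓕.integral_ext_eq_zero (μ := MeasureTheory.Measure.addHaar) (hκ1.smul hTrd)
    (HasCompactSupport.intro (isCompact_box hk C) fun v hv => ?_) hW ℓ
  swap
  · by_contra hne
    rw [Pi.smul_apply', smul_eq_zero, not_or] at hne
    obtain ⟨⟨h1, h2⟩, h3⟩ := hTrs v hne.2
    exact hv ⟨h2.le, hκs v hne.1, hC v h2.le (by linarith)⟩
  simp only [map_smul, hℓ, smul_eq_mul, mul_one] at hstokes
  have hcont : Continuous m := by
    have hq : Continuous fun v : Modes J K => wsq k v.1 := (continuous_wsq k).comp continuous_fst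
    have hb : Continuous fun v : Modes J K => wsq (fun _ => 1) v.2.2 :=
      (continuous_wsq _).comp continuous_snd.snd
    have hd : Continuous (deriv outerCutoff) :=
      (contDiff_outerCutoff.of_le one_le_two).continuous_deriv le_rfl
    have c1 := hψd.continuous.comp hq
    have c2 := hν.continuous.comp hq
    have c3 := hφd.continuous.comp hb
    have c4 : Continuous fun v : Modes J K => deriv outerCutoff (‖v.2.1‖ ^ 2) :=
      hd.comp (by fun_prop)
    have c5 : Continuous fun v : Modes J K => ∑ j, ‖v.1 j‖ ^ 2 * if E j then (1 : ℝ) else 0 := by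
      fun_prop
    exact (continuous_const.mul c4).mul (((((c1.mul c2).mul c2).mul c3).mul c5).mul
      (((continuous_const.mul c2).pow N).mul (continuous_const.mul hq)))
  have hsum : ∀ v : Modes J K, 0 ≤ ∑ j, ‖v.1 j‖ ^ 2 * if E j then (1 : ℝ) else 0 := fun v =>
    Finset.sum_nonneg fun j _ => by split_ifs <;> positivity
  have hneg : 0 ≤ fun v => -m v := by
    intro v
    by_cases h0 : ψ (wsq k v.1) = 0
    · simp [hm, h0]
    have hR := hψs _ h0
    have hR0 : 0 < wsq k v.1 := by linarith
    have hνp : 0 < ν (wsq k v.1) :=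
      pos_of_mul_pos_left (by rw [(hν1 _ hR.1).1]; exact one_pos) hR0.le
    have h1 := deriv_outerCutoff_nonpos (‖v.2.1‖ ^ 2)
    have h2 : 0 ≤ ψ (wsq k v.1) * ν (wsq k v.1) * ν (wsq k v.1) * φ (wsq (fun _ => 1) v.2.2) *
      (∑ j, ‖v.1 j‖ ^ 2 * if E j then 1 else 0) *
      ((2 * ν (wsq k v.1)) ^ N * (2 * wsq k v.1)) := by
      have := hψ0 (wsq k v.1)
      have := hφ0 (wsq (fun _ => 1) v.2.2)
      have := hsum v
      positivity
    simp only [hm, Pi.zero_apply]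
    nlinarith
  obtain ⟨t₀, ht₀⟩ := exists_deriv_outerCutoff_ne_zero
  have ht₀2 : 2 ≤ t₀ := by
    by_contra! h; exact ht₀ (deriv_outerCutoff_of_lt h)
  set v₀ : Modes J K := (Pi.single j₀ ((√(3 / 2 / k j₀) : ℝ) : ℂ), ((√t₀ : ℝ) : ℂ), 0) with hv₀
  have hk₀ := hk j₀
  have hq₀ : ∀ j, ‖v₀.1 j‖ ^ 2 = if j = j₀ then 3 / 2 / k j₀ else 0 := by
    intro j
    by_cases h : j = j₀
    · subst h
      rw [if_pos rfl]
      simp only [hv₀, Pi.single_eq_same, Complex.norm_real, Real.norm_eq_abs, sq_abs]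
      exact Real.sq_sqrt (by positivity)
    · simp [hv₀, h]
  have hR₀ : wsq k v₀.1 = 3 / 2 := by
    simp only [wsq, hq₀, mul_ite, mul_zero, Finset.sum_ite_eq', Finset.mem_univ, if_true]
    field_simp
  have hm₀ : -m v₀ ≠ 0 := by
    have h1 : ‖v₀.2.1‖ ^ 2 = t₀ := by
      simp only [hv₀, Complex.norm_real, Real.norm_eq_abs, sq_abs]
      exact Real.sq_sqrt (by linarith)
    have h2 : ψ (3 / 2) ≠ 0 := mul_ne_zero (Real.smoothTransition.pos_of_pos (by norm_num)).ne'
      (Real.smoothTransition.pos_of_pos (by norm_num)).ne'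
    have h3 : ν (3 / 2) ≠ 0 := left_ne_zero_of_mul (b := 3 / 2) (by
      rw [(hν1 (3 / 2) (by norm_num)).1]; exact one_ne_zero)
    have h4 : φ 0 ≠ 0 := by simp [hφ]
    have h5 : ∑ j, ‖v₀.1 j‖ ^ 2 * (if E j then (1 : ℝ) else 0) ≠ 0 := by
      simp only [hq₀, ite_mul, zero_mul, Finset.sum_ite_eq', Finset.mem_univ, if_true, hj₀]
      positivity
    have h6 : wsq (fun _ => 1) v₀.2.2 = 0 := by simp [wsq, hv₀]
    simp only [hm, h1, hR₀, h6]
    simp only [neg_ne_zero]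
    refine mul_ne_zero (mul_ne_zero two_ne_zero ht₀) ?_
    refine mul_ne_zero (mul_ne_zero (mul_ne_zero (mul_ne_zero (mul_ne_zero h2 h3) h3) h4) h5) ?_
    exact mul_ne_zero (pow_ne_zero _ (mul_ne_zero two_ne_zero h3)) (by norm_num)
  have hpos := Continuous.integral_pos_of_hasCompactSupport_nonneg_nonzero
    (μ := MeasureTheory.Measure.addHaar) hcont.neg
    (HasCompactSupport.intro (isCompact_box hk 1) fun v hv => ?_) hneg hm₀
  swap
  · by_contra hne
    have hne' : m v ≠ 0 := fun h => hne (by simp [h])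
    have h1 : deriv outerCutoff (‖v.2.1‖ ^ 2) ≠ 0 := fun h => hne' (by simp [hm, h])
    have h2 : ψ (wsq k v.1) ≠ 0 := fun h => hne' (by simp [hm, h])
    have h3 : φ (wsq (fun _ => 1) v.2.2) ≠ 0 := fun h => hne' (by simp [hm, h])
    refine hv ⟨(hψs _ h2).2.le, ?_, (hφs _ h3).le.trans hδ1⟩
    by_contra! h
    exact h1 (deriv_outerCutoff_of_gt (by nlinarith))
  simp only [Pi.neg_apply] at hpos
  rw [MeasureTheory.integral_neg, hstokes] at hpos
  simp at hpos

end Modes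

end

section

/-- The function `t ↦ exp (i k t)`. -/
noncomputable def wave (k : ℤ) (t : ℝ) : ℂ := Complex.exp (Complex.I * k * t)

theorem wave_add_right (k : ℤ) (s t : ℝ) : wave k (s + t) = wave k s * wave k t := by
  simp only [wave, ← Complex.exp_add]; push_cast; ring_nf

theorem wave_add_left (k l : ℤ) (t : ℝ) : wave (k + l) t = wave k t * wave l t := by
  simp only [wave, ← Complex.exp_add]; push_cast; ring_nf

@[simp] theorem wave_zero_left (t : ℝ) : wave 0 t = 1 := by simp [wave]

@[simp] theorem wave_zero_right (k : ℤ) : wave k 0 = 1 := by simp [wave]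

theorem conj_wave (k : ℤ) (t : ℝ) : (starRingEnd ℂ) (wave k t) = wave (-k) t := by
  simp [wave, ← Complex.exp_conj]

theorem wave_neg_mul_wave (k : ℤ) (t : ℝ) : wave (-k) t * wave k t = 1 := by
  rw [← wave_add_left, neg_add_cancel, wave_zero_left]

@[simp] theorem norm_wave (k : ℤ) (t : ℝ) : ‖wave k t‖ = 1 := by
  rw [wave, show Complex.I * k * t = ((k * t : ℝ) : ℂ) * Complex.I by push_cast; ring,
    Complex.norm_exp_ofReal_mul_I]

theorem periodic_wave (k : ℤ) : Function.Periodic (wave k) (2 * Real.pi) := fun t => by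
  rw [add_comm, wave_add_right]
  have : wave k (2 * Real.pi) = 1 := by
    rw [wave, show Complex.I * k * ((2 * Real.pi : ℝ) : ℂ) = k * (2 * Real.pi * Complex.I) by
      push_cast; ring]
    exact Complex.exp_int_mul_two_pi_mul_I k
  rw [this, one_mul]

theorem contDiff_wave (k : ℤ) {n : WithTop ℕ∞} : ContDiff ℝ n (wave k) := by
  have : ContDiff ℝ n fun t : ℝ => (t : ℂ) := Complex.ofRealCLM.contDiff
  unfold wave
  exact (contDiff_const.mul this).cexp

@[fun_prop] theorem continuous_wave (k : ℤ) : Continuous (wave k) :=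
  (contDiff_wave k (n := 0)).continuous

theorem hasDerivAt_wave (k : ℤ) (t : ℝ) : HasDerivAt (wave k) (Complex.I * k * wave k t) t := by
  have h : HasDerivAt (fun t : ℝ => (t : ℂ)) 1 t := Complex.ofRealCLM.hasDerivAt
  refine (h.const_mul (Complex.I * k)).cexp.congr_deriv ?_
  rw [wave, mul_one, mul_comm]

section

variable {V : Type*} [NormedAddCommGroup V] [NormedSpace ℝ V]

/-- The mean of a function over a period. -/
noncomputable def mean (h : ℝ → V) : V := (2 * Real.pi)⁻¹ • ∫ t in (0)..(2 * Real.pi), h t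

theorem mean_add {f g : ℝ → V} (hf : Continuous f) (hg : Continuous g) :
    mean (fun t => f t + g t) = mean f + mean g := by
  rw [mean, intervalIntegral.integral_add (hf.intervalIntegrable _ _) (hg.intervalIntegrable _ _),
    smul_add]; rfl

theorem mean_sub {f g : ℝ → V} (hf : Continuous f) (hg : Continuous g) :
    mean (fun t => f t - g t) = mean f - mean g := by
  rw [mean, intervalIntegral.integral_sub (hf.intervalIntegrable _ _) (hg.intervalIntegrable _ _),
    smul_sub]; rfl

theorem mean_const [CompleteSpace V] (c : V) : mean (fun _ => c) = c := by
  rw [mean, intervalIntegral.integral_const, sub_zero, smul_smul, inv_mul_cancel₀ (by positivity),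
    one_smul]

theorem mean_clm {W : Type*} [NormedAddCommGroup W] [NormedSpace ℝ W] [CompleteSpace V]
    [CompleteSpace W] (L : V →L[ℝ] W) {h : ℝ → V} (hh : Continuous h) :
    mean (fun t => L (h t)) = L (mean h) := by
  rw [mean, L.intervalIntegral_comp_comm (hh.intervalIntegrable _ _), mean, map_smul]

theorem mean_sum {ι : Type*} {s : Finset ι} {f : ι → ℝ → V} (hf : ∀ i ∈ s, Continuous (f i)) :
    mean (fun t => ∑ i ∈ s, f i t) = ∑ i ∈ s, mean (f i) := by
  rw [mean, intervalIntegral.integral_finsetSum fun i hi => (hf i hi).intervalIntegrable _ _,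
    Finset.smul_sum]; rfl

theorem mean_mono {f g : ℝ → ℝ} (hf : Continuous f) (hg : Continuous g) (h : ∀ t, f t ≤ g t) :
    mean f ≤ mean g := by
  unfold mean
  rw [smul_eq_mul, smul_eq_mul]
  exact mul_le_mul_of_nonneg_left (intervalIntegral.integral_mono (by positivity)
    (hf.intervalIntegrable _ _) (hg.intervalIntegrable _ _) h) (by positivity)

theorem norm_mean_le (f : ℝ → V) : ‖mean f‖ ≤ mean fun t => ‖f t‖ := by
  unfold mean
  rw [norm_smul, Real.norm_of_nonneg (by positivity), smul_eq_mul]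
  exact mul_le_mul_of_nonneg_left (intervalIntegral.norm_integral_le_integral_norm
    (by positivity)) (by positivity)

theorem mean_comp_add {h : ℝ → V} (hh : Function.Periodic h (2 * Real.pi)) (s : ℝ) :
    mean (fun t => h (s + t)) = mean h := by
  have h1 := hh.intervalIntegral_add_eq s 0
  rw [zero_add] at h1
  rw [mean, mean, ← h1, intervalIntegral.integral_comp_add_left (fun t => h t), add_zero]

end

theorem mean_wave (k : ℤ) : mean (wave k) = if k = 0 then 1 else 0 := by
  split_ifs with h
  · subst h
    simp only [show wave 0 = fun _ => 1 from funext wave_zero_left]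
    exact mean_const (1 : ℂ)
  · have hc : Complex.I * k ≠ 0 := mul_ne_zero Complex.I_ne_zero (by exact_mod_cast h)
    have h2 : wave k (2 * Real.pi) = 1 := by
      have := periodic_wave k 0
      rwa [zero_add, wave_zero_right] at this
    unfold mean
    have : ∫ t in (0)..(2 * Real.pi), wave k t = 0 := by
      unfold wave at h2 ⊢
      rw [integral_exp_mul_complex hc, h2]
      simp
    rw [this, smul_zero]

section

variable {V : Type*} [NormedAddCommGroup V] [InnerProductSpace ℂ V]

/-- The Fourier coefficient of frequency `k`. -/
noncomputable def coeff (k : ℤ) (h : ℝ → V) : V := mean fun t => wave (-k) t • h t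

/-- The trigonometric polynomial with frequencies in `S` and coefficients `a`. -/
noncomputable def trig (S : Finset ℤ) (a : ℤ → V) (t : ℝ) : V := ∑ k ∈ S, wave k t • a k

@[fun_prop] theorem continuous_trig (S : Finset ℤ) (a : ℤ → V) : Continuous (trig S a) := by
  unfold trig; fun_prop

theorem periodic_trig (S : Finset ℤ) (a : ℤ → V) : Function.Periodic (trig S a) (2 * Real.pi) :=
  fun t => by simp only [trig, periodic_wave _ t]

variable [CompleteSpace V]

theorem mean_smul_const {f : ℝ → ℂ} (hf : Continuous f) (v : V) :
    mean (fun t => f t • v) = mean f • v :=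
  mean_clm (((ContinuousLinearMap.id ℂ ℂ).smulRight v).restrictScalars ℝ) hf

theorem mean_inner_left (v : V) {f : ℝ → V} (hf : Continuous f) :
    mean (fun t => inner ℂ v (f t)) = inner ℂ v (mean f) :=
  mean_clm ((innerSL ℂ v).restrictScalars ℝ) hf

theorem coeff_trig (S : Finset ℤ) (a : ℤ → V) (l : ℤ) :
    coeff l (trig S a) = if l ∈ S then a l else 0 := by
  have h : ∀ t, wave (-l) t • trig S a t = ∑ k ∈ S, wave (-l + k) t • a k := fun t => by
    simp only [trig, Finset.smul_sum, smul_smul, wave_add_left]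
  simp only [coeff, h]
  rw [mean_sum fun k _ => by fun_prop]
  have h2 : ∀ k, mean (fun t => wave (-l + k) t • a k) = if l = k then a k else 0 := fun k => by
    rw [mean_smul_const (continuous_wave _), mean_wave]
    by_cases hk : l = k
    · simp [hk]
    · rw [if_neg (by omega), if_neg hk, zero_smul]
  simp only [h2, Finset.sum_ite_eq]

theorem mean_inner_trig (S : Finset ℤ) (a : ℤ → V) {h : ℝ → V} (hh : Continuous h) :
    mean (fun t => inner ℂ (trig S a t) (h t)) = ∑ k ∈ S, inner ℂ (a k) (coeff k h) := by
  have h1 : ∀ t, inner ℂ (trig S a t) (h t) = ∑ k ∈ S, inner ℂ (a k) (wave (-k) t • h t) :=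
    fun t => by
      simp only [trig, sum_inner, inner_smul_left, inner_smul_right, conj_wave]
  simp only [h1]
  rw [mean_sum fun k _ => by fun_prop]
  exact Finset.sum_congr rfl fun k _ => mean_inner_left _ (by fun_prop)

theorem mean_re {f : ℝ → ℂ} (hf : Continuous f) : mean (fun t => (f t).re) = (mean f).re :=
  mean_clm Complex.reCLM hf

theorem mean_norm_sq_trig (S : Finset ℤ) (a : ℤ → V) :
    mean (fun t => ‖trig S a t‖ ^ 2) = ∑ k ∈ S, ‖a k‖ ^ 2 := by
  have h := mean_inner_trig S a (continuous_trig S a)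
  have h1 : ∀ t, ‖trig S a t‖ ^ 2 = (inner ℂ (trig S a t) (trig S a t)).re := fun t => by
    rw [inner_self_eq_norm_sq_to_K]; norm_cast
  simp only [h1]
  rw [mean_re (by fun_prop), h, Complex.re_sum]
  refine Finset.sum_congr rfl fun k hk => ?_
  rw [coeff_trig, if_pos hk, inner_self_eq_norm_sq_to_K]; norm_cast

theorem sum_norm_sq_coeff_le (S : Finset ℤ) {h : ℝ → V} (hh : Continuous h) :
    ∑ k ∈ S, ‖coeff k h‖ ^ 2 ≤ mean fun t => ‖h t‖ ^ 2 := by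
  set P := trig S fun k => coeff k h with hP
  have hPc : Continuous P := continuous_trig _ _
  have h1 : (mean fun t => (inner ℂ (P t) (h t)).re) = ∑ k ∈ S, ‖coeff k h‖ ^ 2 := by
    rw [mean_re (by fun_prop), mean_inner_trig _ _ hh, Complex.re_sum]
    refine Finset.sum_congr rfl fun k _ => ?_
    rw [inner_self_eq_norm_sq_to_K]; norm_cast
  have h2 := mean_norm_sq_trig S fun k => coeff k h
  have h3 : (mean fun t => (2 * (inner ℂ (P t) (h t)).re)) = 2 * ∑ k ∈ S, ‖coeff k h‖ ^ 2 := by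
    rw [← h1]
    exact mean_clm ((2 : ℝ) • ContinuousLinearMap.id ℝ ℝ)
      (h := fun t => (inner ℂ (P t) (h t)).re) (by fun_prop)
  have h4 : (mean fun t => (2 * (inner ℂ (P t) (h t)).re)) ≤
      mean fun t => ‖P t‖ ^ 2 + ‖h t‖ ^ 2 := by
    refine mean_mono (by fun_prop) (by fun_prop) fun t => ?_
    have h5 := (Complex.re_le_norm _).trans (norm_inner_le_norm (𝕜 := ℂ) (P t) (h t))
    nlinarith [sq_nonneg (‖P t‖ - ‖h t‖)]
  rw [mean_add (by fun_prop) (by fun_prop), h3, h2] at h4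
  linarith

end

end

section

theorem wave_eq_fourier (k : ℤ) {T : ℝ} (hT : T = 2 * Real.pi) (t : ℝ) :
    fourier k (t : AddCircle T) = wave k t := by
  subst hT
  rw [fourier_coe_apply, wave]
  congr 1
  push_cast
  field_simp

theorem coeff_eq_fourierCoeffOn (k : ℤ) (h : ℝ → ℂ) :
    coeff k h = fourierCoeffOn Real.two_pi_pos h k := by
  rw [fourierCoeffOn_eq_integral, coeff, mean]
  simp only [wave_eq_fourier _ (sub_zero (2 * Real.pi))]
  rw [sub_zero, one_div]

theorem eq_coeff_zero_of_coeff_eq_zero {f : ℝ → ℂ} (hf : Continuous f)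
    (hp : Function.Periodic f (2 * Real.pi)) (h : ∀ k : ℤ, k ≠ 0 → coeff k f = 0) (t : ℝ) :
    f t = coeff 0 f := by
  have : Fact (0 < 2 * Real.pi) := ⟨Real.two_pi_pos⟩
  have hc : Continuous (hp.lift : AddCircle (2 * Real.pi) → ℂ) :=
    continuous_coinduced_dom.2 hf
  let g : C(AddCircle (2 * Real.pi), ℂ) := ⟨hp.lift, hc⟩
  have hg : ∀ k, fourierCoeff g k = coeff k f := fun k => by
    rw [fourierCoeff_eq_intervalIntegral _ _ 0, coeff, mean, zero_add, one_div]
    simp only [wave_eq_fourier _ rfl]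
    rfl
  have hz : ∀ k, k ∉ ({0} : Finset ℤ) → fourierCoeff g k = 0 := fun k hk => by
    rw [hg]; exact h k (by simpa using hk)
  have h1 := has_pointwise_sum_fourier_series_of_summable
    (summable_of_ne_finset_zero hz) (t : AddCircle (2 * Real.pi))
  have h2 := h1.unique (hasSum_sum_of_ne_finset_zero fun k hk => by rw [hz k hk, zero_smul])
  rw [Finset.sum_singleton, hg, fourier_zero, smul_eq_mul, mul_one] at h2
  exact h2

theorem hasDerivAt_of_coeff_eq {h u : ℝ → ℂ} (hh : Continuous h) (hu : Continuous u)
    (hhp : Function.Periodic h (2 * Real.pi)) (hup : Function.Periodic u (2 * Real.pi)) {r : ℝ}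
    (hc : ∀ k : ℤ, coeff k h = Complex.I * r * k * coeff k u) (t : ℝ) :
    HasDerivAt (fun t => (r : ℂ) * u t) (h t) t := by
  set Γ : ℝ → ℂ := fun t => ∫ s in (0)..t, h s with hΓ
  have hΓd : ∀ t, HasDerivAt Γ (h t) t := fun t => hh.integral_hasStrictDerivAt 0 t |>.hasDerivAt
  have hΓc : Continuous Γ := continuous_iff_continuousAt.2 fun t => (hΓd t).continuousAt
  have h0 : ∫ s in (0)..(2 * Real.pi), h s = 0 := by
    have := hc 0
    simp only [coeff, mean, neg_zero, wave_zero_left, one_smul, Int.cast_zero, mul_zero,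
      zero_mul] at this
    exact (smul_eq_zero.1 this).resolve_left (by positivity)
  have hΓp : Function.Periodic Γ (2 * Real.pi) := fun t => by
    have h1 := hhp.intervalIntegral_add_eq t 0
    rw [zero_add, h0] at h1
    simp only [hΓ]
    rw [← intervalIntegral.integral_add_adjacent_intervals (hh.intervalIntegrable 0 t)
      (hh.intervalIntegrable t _), h1, add_zero]
  have hΓk : ∀ k : ℤ, k ≠ 0 → Complex.I * k * coeff k Γ = coeff k h := fun k hk => by
    rw [coeff_eq_fourierCoeffOn, coeff_eq_fourierCoeffOn, fourierCoeffOn_of_hasDerivAt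
      Real.two_pi_pos hk (fun t _ => hΓd t) (hh.intervalIntegrable _ _)]
    have e : Γ (2 * Real.pi) - Γ 0 = 0 := by simp [hΓ, h0]
    have hk' : (k : ℂ) ≠ 0 := by exact_mod_cast hk
    have hpi : (Real.pi : ℂ) ≠ 0 := by exact_mod_cast Real.pi_ne_zero
    rw [e]
    push_cast
    field_simp
    ring
  have hD := eq_coeff_zero_of_coeff_eq_zero (f := fun t => Γ t - r * u t) (by fun_prop)
    (fun t => by simp only [hΓp t, hup t]) fun k hk => by
      have e : coeff k (fun t => Γ t - r * u t) = coeff k Γ - r * coeff k u := by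
        simp only [coeff, smul_sub]
        rw [mean_sub (by fun_prop) (by fun_prop)]
        congr 1
        simp only [smul_eq_mul, mul_left_comm _ (r : ℂ)]
        exact mean_clm (((r : ℂ) • ContinuousLinearMap.id ℂ ℂ).restrictScalars ℝ)
          (h := fun t => wave (-k) t * u t) (by fun_prop)
      have hk' : Complex.I * (k : ℂ) ≠ 0 := mul_ne_zero Complex.I_ne_zero (by exact_mod_cast hk)
      apply mul_left_cancel₀ hk'
      rw [e, mul_sub, hΓk k hk, hc]
      ring
  have e : (fun t => (r : ℂ) * u t) = fun t => Γ t - coeff 0 fun t => Γ t - r * u t := by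
    funext t; rw [← hD t]; ring
  rw [e]
  exact (hΓd t).sub_const _

section

variable {V : Type*} [NormedAddCommGroup V] [InnerProductSpace ℂ V] [CompleteSpace V]

theorem hasDerivAt_of_coeff_eq_vec {h u : ℝ → V} (hh : Continuous h) (hu : Continuous u)
    (hhp : Function.Periodic h (2 * Real.pi)) (hup : Function.Periodic u (2 * Real.pi)) {r : ℝ}
    (hc : ∀ k : ℤ, coeff k h = (Complex.I * r * k) • coeff k u) (t : ℝ) :
    HasDerivAt (fun t => r • u t) (h t) t := by
  set Γ : ℝ → V := fun t => ∫ s in (0)..t, h s with hΓ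
  have hΓd : ∀ t, HasDerivAt Γ (h t) t := fun t => hh.integral_hasStrictDerivAt 0 t |>.hasDerivAt
  have hcoeff : ∀ (v : V) (k : ℤ) {f : ℝ → V}, Continuous f →
      coeff k (fun t => (inner ℂ v (f t) : ℂ)) = inner ℂ v (coeff k f) := fun v k f hf => by
    rw [coeff, coeff, ← mean_inner_left v (by fun_prop)]
    simp only [inner_smul_right, smul_eq_mul]
  have hconst : ∀ t, r • u t - Γ t = r • u 0 - Γ 0 := fun t => by
    refine ext_inner_left ℂ fun v => ?_
    have h1 : ∀ t, HasDerivAt (fun t => (inner ℂ v (r • u t - Γ t) : ℂ)) 0 t := fun t => by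
      have h2 := hasDerivAt_of_coeff_eq (h := fun t => (inner ℂ v (h t) : ℂ))
        (u := fun t => (inner ℂ v (u t) : ℂ)) (r := r) (by fun_prop) (by fun_prop)
        (fun t => by simp only [hhp t]) (fun t => by simp only [hup t])
        (fun k => by rw [hcoeff v k hh, hcoeff v k hu, hc, inner_smul_right]) t
      have h3 : HasDerivAt (fun t => (inner ℂ v (Γ t) : ℂ)) (inner ℂ v (h t)) t :=
        (((innerSL ℂ v).restrictScalars ℝ).hasFDerivAt.comp_hasDerivAt t (hΓd t))
      refine ((h2.sub h3).congr_deriv (sub_self _)).congr_of_eventuallyEq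
        (Filter.Eventually.of_forall fun t => ?_)
      simp only [inner_sub_right, Pi.sub_apply]
      rw [← Complex.coe_smul, inner_smul_right]
    exact is_const_of_deriv_eq_zero (fun t => (h1 t).differentiableAt) (fun t => (h1 t).deriv) t 0
  have e : (fun t => r • u t) = fun t => Γ t + (r • u 0 - Γ 0) := by
    funext t; rw [← hconst t]; abel
  rw [e]
  exact (hΓd t).add_const _

end

end

section

universe u

theorem contDiff_parametric_intervalIntegral {E : Type u} [NormedAddCommGroup E] [NormedSpace ℝ E]
    [FiniteDimensional ℝ E] (a b : ℝ) (n : ℕ) : ∀ {F : Type u} [NormedAddCommGroup F]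
    [NormedSpace ℝ F] {f : E → ℝ → F}, ContDiff ℝ n (fun p : E × ℝ => f p.1 p.2) →
      ContDiff ℝ n fun v => ∫ t in a..b, f v t := by
  induction n with
  | zero =>
    intro F _ _ f hf
    rw [Nat.cast_zero, contDiff_zero] at hf ⊢
    exact intervalIntegral.continuous_parametric_intervalIntegral_of_continuous' hf a b
  | succ n ih =>
    intro F _ _ f hf
    push_cast at hf ⊢
    rw [contDiff_succ_iff_hasFDerivAt] at hf ⊢
    obtain ⟨D, hD, hfD⟩ := hf
    have hf : Continuous fun p : E × ℝ => f p.1 p.2 :=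
      continuous_iff_continuousAt.2 fun p => (hfD p).continuousAt
    set f' : E → ℝ → E →L[ℝ] F := fun v t => D (v, t) ∘L ContinuousLinearMap.inl ℝ E ℝ with hf'
    have hf'n : ContDiff ℝ n fun p : E × ℝ => f' p.1 p.2 :=
      hD.clm_comp contDiff_const
    have hf'c : Continuous fun p : E × ℝ => f' p.1 p.2 := hf'n.continuous
    refine ⟨fun v => ∫ t in a..b, f' v t, ih hf'n, fun v => ?_⟩
    obtain ⟨C, hC⟩ := ((isCompact_closedBall v 1).prod (isCompact_uIcc (a := a) (b := b))).exists_bound_of_continuousOn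
      hf'c.continuousOn
    refine intervalIntegral.hasFDerivAt_integral_of_dominated_of_fderiv_le
      (bound := fun _ => C) (Metric.closedBall_mem_nhds v one_pos) ?_ ?_ ?_ ?_ ?_ ?_
    · exact Filter.Eventually.of_forall fun w =>
        (show Continuous fun t => f w t by fun_prop).aestronglyMeasurable
    · exact (show Continuous fun t => f v t by fun_prop).intervalIntegrable _ _
    · exact (show Continuous fun t => f' v t by fun_prop).aestronglyMeasurable
    · exact Filter.Eventually.of_forall fun t ht w hw =>
        hC (w, t) ⟨hw, Set.uIoc_subset_uIcc ht⟩
    · exact intervalIntegrable_const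
    · refine Filter.Eventually.of_forall fun t _ w _ => ?_
      have h := hasFDerivAt_prodMk_left (𝕜 := ℝ) w t
      exact HasFDerivAt.comp (f := fun w : E => (w, t)) (g := fun p : E × ℝ => f p.1 p.2) w
        (hfD (w, t)) h

end

section

/-- Complex conjugation for nonpositive frequencies, the identity for positive ones. -/
noncomputable def flip (k : ℤ) : ℂ →L[ℝ] ℂ :=
  if 0 < k then ContinuousLinearMap.id ℝ ℂ else Complex.conjCLE.toContinuousLinearMap

theorem flip_of_pos {k : ℤ} (h : 0 < k) (z : ℂ) : flip k z = z := by simp [flip, h]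

theorem flip_of_nonpos {k : ℤ} (h : k ≤ 0) (z : ℂ) : flip k z = (starRingEnd ℂ) z := by
  simp [flip, h.not_gt]

@[simp] theorem flip_flip (k : ℤ) (z : ℂ) : flip k (flip k z) = z := by
  rcases lt_or_ge 0 k with h | h <;> simp [flip_of_pos, flip_of_nonpos, h]

@[simp] theorem norm_flip (k : ℤ) (z : ℂ) : ‖flip k z‖ = ‖z‖ := by
  rcases lt_or_ge 0 k with h | h <;> simp [flip_of_pos, flip_of_nonpos, h]

theorem flip_mul (k : ℤ) (z w : ℂ) : flip k (z * w) = flip k z * flip k w := by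
  rcases lt_or_ge 0 k with h | h <;> simp [flip_of_pos, flip_of_nonpos, h]

theorem flip_one (k : ℤ) : flip k 1 = 1 := by
  rcases lt_or_ge 0 k with h | h <;> simp [flip_of_pos, flip_of_nonpos, h]

theorem flip_wave (k : ℤ) (s : ℝ) : flip k (wave k s) = wave |k| s := by
  rcases lt_or_ge 0 k with h | h
  · rw [flip_of_pos h, abs_of_pos h]
  · rw [flip_of_nonpos h, abs_of_nonpos h, conj_wave]

theorem int_mul_im_flip (k : ℤ) (z : ℂ) : k * (flip k z).im = |(k : ℝ)| * z.im := by
  rcases lt_or_ge 0 k with h | h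
  · rw [flip_of_pos h, abs_of_pos (by exact_mod_cast h)]
  · rw [flip_of_nonpos h, abs_of_nonpos (by exact_mod_cast h)]; simp

/-- A smooth map of the plane into the unit disc which is radial retraction outside the disc. -/
noncomputable def squeeze (ζ : ℂ) : ℂ :=
  (√(1 - Real.smoothTransition (‖ζ‖ ^ 2) + Real.smoothTransition (‖ζ‖ ^ 2) * ‖ζ‖ ^ 2))⁻¹ • ζ

/-- The quantity under the root in `squeeze` is positive. -/
theorem squeeze_aux_pos (ζ : ℂ) : 0 < 1 - Real.smoothTransition (‖ζ‖ ^ 2) +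
    Real.smoothTransition (‖ζ‖ ^ 2) * ‖ζ‖ ^ 2 := by
  have h0 := Real.smoothTransition.nonneg (‖ζ‖ ^ 2)
  have h1 := Real.smoothTransition.le_one (‖ζ‖ ^ 2)
  rcases h1.lt_or_eq with h | h
  · have := mul_nonneg h0 (sq_nonneg ‖ζ‖); linarith
  · rw [h, sub_self, zero_add, one_mul]
    by_contra! hle
    rw [Real.smoothTransition.zero_of_nonpos hle] at h
    exact zero_ne_one h

theorem contDiff_squeeze : ContDiff ℝ 2 squeeze := by
  have h1 : ContDiff ℝ 2 fun ζ : ℂ => ‖ζ‖ ^ 2 := contDiff_id.norm_sq ℝ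
  have h2 : ContDiff ℝ 2 fun ζ : ℂ => Real.smoothTransition (‖ζ‖ ^ 2) :=
    Real.smoothTransition.contDiff.comp h1
  refine ContDiff.smul (ContDiff.inv (ContDiff.sqrt ((contDiff_const.sub h2).add (h2.mul h1))
    fun ζ => (squeeze_aux_pos ζ).ne') fun ζ => ?_) contDiff_id
  exact (Real.sqrt_pos.2 (squeeze_aux_pos ζ)).ne'

theorem norm_sq_squeeze (ζ : ℂ) : ‖squeeze ζ‖ ^ 2 * (1 - Real.smoothTransition (‖ζ‖ ^ 2) +
    Real.smoothTransition (‖ζ‖ ^ 2) * ‖ζ‖ ^ 2) = ‖ζ‖ ^ 2 := by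
  have h := squeeze_aux_pos ζ
  rw [squeeze, norm_smul, norm_inv, Real.norm_of_nonneg (Real.sqrt_nonneg _), mul_pow, inv_pow,
    Real.sq_sqrt h.le]
  rw [mul_right_comm, inv_mul_cancel₀ h.ne', one_mul]

theorem squeeze_of_one_le {ζ : ℂ} (h : 1 ≤ ‖ζ‖) : squeeze ζ = ζ / (‖ζ‖ : ℂ) := by
  rw [squeeze, Real.smoothTransition.one_of_one_le (by nlinarith), sub_self, zero_add, one_mul,
    Real.sqrt_sq (norm_nonneg _), Complex.real_smul]
  push_cast
  rw [div_eq_inv_mul]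

theorem norm_squeeze_le_one (ζ : ℂ) : ‖squeeze ζ‖ ≤ 1 := by
  rcases le_or_gt 1 ‖ζ‖ with h | h
  · rw [squeeze_of_one_le h, norm_div, Complex.norm_real, norm_norm, div_self (by linarith)]
  · have h1 := norm_sq_squeeze ζ
    have h2 := squeeze_aux_pos ζ
    have h3 := Real.smoothTransition.le_one (‖ζ‖ ^ 2)
    have h4 : ‖ζ‖ ^ 2 < 1 := by nlinarith [norm_nonneg ζ]
    have h5 : ‖squeeze ζ‖ ^ 2 ≤ 1 := by
      by_contra! h6
      nlinarith
    nlinarith [norm_nonneg (squeeze ζ)]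

theorem norm_lt_of_norm_squeeze {ζ : ℂ} (h : ‖squeeze ζ‖ ^ 2 ≤ 1 / 2) : ‖ζ‖ ^ 2 ≤ 1 / 2 := by
  rcases le_or_gt 1 ‖ζ‖ with h1 | h1
  · rw [squeeze_of_one_le h1, norm_div, Complex.norm_real, norm_norm, div_self (by linarith)] at h
    norm_num at h
  · have h1 := norm_sq_squeeze ζ
    have h2 := squeeze_aux_pos ζ
    have h3 := Real.smoothTransition.nonneg (‖ζ‖ ^ 2)
    have h4 : ‖ζ‖ ^ 2 < 1 := by nlinarith [norm_nonneg ζ]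
    nlinarith

/-- A cutoff supported in the unit disc. -/
noncomputable def innerCutoff (ζ : ℂ) : ℝ := Real.smoothTransition (2 - 2 * ‖ζ‖ ^ 2)

theorem contDiff_innerCutoff : ContDiff ℝ 2 innerCutoff :=
  Real.smoothTransition.contDiff.comp (contDiff_const.sub
    (contDiff_const.mul (contDiff_id.norm_sq ℝ)))

theorem innerCutoff_of_one_le {ζ : ℂ} (h : 1 ≤ ‖ζ‖) : innerCutoff ζ = 0 :=
  Real.smoothTransition.zero_of_nonpos (by nlinarith)

theorem innerCutoff_of_le {ζ : ℂ} (h : ‖ζ‖ ^ 2 ≤ 1 / 2) : innerCutoff ζ = 1 :=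
  Real.smoothTransition.one_of_one_le (by linarith)

theorem abs_innerCutoff_le_one (ζ : ℂ) : |innerCutoff ζ| ≤ 1 :=
  abs_le.2 ⟨by have := Real.smoothTransition.nonneg (2 - 2 * ‖ζ‖ ^ 2); rw [innerCutoff]; linarith,
    Real.smoothTransition.le_one _⟩

/-- The complexified frequency attached to a twist parameter. -/
noncomputable def freq (ζ : ℂ) : ℂ := 1 + 1 / 4 * squeeze ζ

theorem norm_freq_sub_one_le (ζ : ℂ) : ‖freq ζ - 1‖ ≤ 1 / 4 := by
  rw [freq, add_sub_cancel_left, norm_mul]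
  norm_num
  linarith [norm_squeeze_le_one ζ]

/-- The symbol of the linear operator at frequency `k`. -/
noncomputable def symbol (k : ℤ) (ζ : ℂ) : ℂ := Complex.I * (1 - flip k (freq ζ) * k)

/-- The symbol with its zero at frequency one divided out. -/
noncomputable def divisor (k : ℤ) (ζ : ℂ) : ℂ := if k = 1 then -Complex.I / 4 else symbol k ζ

theorem symbol_one (ζ : ℂ) : symbol 1 ζ = divisor 1 ζ * squeeze ζ := by
  rw [symbol, divisor, if_pos rfl, flip_of_pos one_pos, freq]; push_cast; ring

theorem norm_symbol_ge {k : ℤ} (hk : k ≠ 1) (ζ : ℂ) : |(k : ℝ)| / 4 ≤ ‖symbol k ζ‖ := by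
  have h1 : ‖flip k (freq ζ) - 1‖ ≤ 1 / 4 := by
    rw [← flip_one k, ← map_sub, norm_flip]; exact norm_freq_sub_one_le ζ
  have h2 : ‖symbol k ζ‖ = ‖(1 - k : ℂ) - (flip k (freq ζ) - 1) * k‖ := by
    rw [symbol, norm_mul, Complex.norm_I, one_mul]; congr 1; ring
  have h3 := norm_sub_norm_le (1 - k : ℂ) ((flip k (freq ζ) - 1) * k)
  have h4 : ‖(1 - k : ℂ)‖ = |1 - (k : ℝ)| := by
    rw [← Real.norm_eq_abs, ← Complex.norm_real]; push_cast; rfl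
  have h5 : ‖(flip k (freq ζ) - 1) * (k : ℂ)‖ ≤ 1 / 4 * |(k : ℝ)| := by
    rw [norm_mul, Complex.norm_intCast]
    exact mul_le_mul_of_nonneg_right h1 (abs_nonneg _)
  rw [h2]
  rw [h4] at h3
  refine le_trans ?_ h3
  rcases lt_or_ge k 1 with h | h
  · have h' : (k : ℝ) ≤ 0 := by exact_mod_cast Int.lt_add_one_iff.1 h
    rw [abs_of_nonneg (show (0 : ℝ) ≤ 1 - k by linarith)]
    rw [abs_of_nonpos h'] at h5 ⊢
    linarith
  · have h' : (2 : ℝ) ≤ k := by exact_mod_cast (show 2 ≤ k by omega)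
    rw [abs_of_nonpos (show 1 - (k : ℝ) ≤ 0 by linarith)]
    rw [abs_of_nonneg (show (0 : ℝ) ≤ k by linarith)] at h5 ⊢
    linarith

theorem divisor_zero (ζ : ℂ) : divisor 0 ζ = Complex.I := by simp [divisor, symbol]

theorem norm_divisor_ge (k : ℤ) (ζ : ℂ) : |(k : ℝ)| / 4 ≤ ‖divisor k ζ‖ := by
  rw [divisor]
  split_ifs with h
  · subst h; norm_num
  · exact norm_symbol_ge h ζ

theorem divisor_ne_zero (k : ℤ) (ζ : ℂ) : divisor k ζ ≠ 0 := by
  by_cases hk : k = 0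
  · rw [hk, divisor_zero]; exact Complex.I_ne_zero
  · refine norm_pos_iff.1 (lt_of_lt_of_le ?_ (norm_divisor_ge k ζ))
    have : (k : ℝ) ≠ 0 := by exact_mod_cast hk
    positivity

theorem contDiff_divisor (k : ℤ) : ContDiff ℝ 2 (divisor k) := by
  by_cases h : k = 1
  · have : divisor k = fun _ => -Complex.I / 4 := by funext ζ; rw [divisor, if_pos h]
    rw [this]; exact contDiff_const
  · have : divisor k = symbol k := by funext ζ; rw [divisor, if_neg h]
    rw [this]
    exact contDiff_const.mul (contDiff_const.sub (((flip k).contDiff.comp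
      (contDiff_const.add (contDiff_const.mul contDiff_squeeze))).mul contDiff_const))

end

section

namespace Modes

variable {m : ℕ} (S : Finset ℤ)

/-- The Fourier coefficients of the loop encoded by a point of the space of modes. -/
noncomputable def amp (v : Modes (Fin m × S) (Fin m)) (k : ℤ) : EuclideanSpace ℂ (Fin m) :=
  WithLp.toLp 2 fun i =>
    if h : k ∈ S then flip k (v.1 (i, ⟨k, h⟩)) else if k = 0 then v.2.2 i else 0

/-- The loop encoded by a point of the space of modes. -/
noncomputable def loop (v : Modes (Fin m × S) (Fin m)) : ℝ → EuclideanSpace ℂ (Fin m) :=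
  trig (insert 0 S) (amp S v)

/-- The residual of the projected equation at frequency `k`. -/
noncomputable def residual (p : EuclideanSpace ℂ (Fin m) → EuclideanSpace ℂ (Fin m))
    (v : Modes (Fin m × S) (Fin m)) (k : ℤ) : EuclideanSpace ℂ (Fin m) :=
  (if k = 1 then squeeze v.2.1 else 1) • amp S v k +
    ((innerCutoff v.2.1 : ℂ) * (divisor k v.2.1)⁻¹) • coeff k fun t => p (loop S v t)

/-- The rotation of the space of modes which corresponds to a time shift of loops. -/
noncomputable def rot (s : ℝ) (v : Modes (Fin m × S) (Fin m)) : Modes (Fin m × S) (Fin m) :=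
  (fun j => wave |(j.2 : ℤ)| s * v.1 j, v.2)

variable {S}

theorem contDiff_amp (k : ℤ) : ContDiff ℝ 2 fun v : Modes (Fin m × S) (Fin m) => amp S v k := by
  refine PiLp.contDiff_toLp.comp (contDiff_pi.2 fun i => ?_)
  split_ifs with h h0
  · exact (flip k).contDiff.comp ((contDiff_apply ℝ ℂ _).comp contDiff_fst)
  · exact (contDiff_apply ℝ ℂ i).comp contDiff_snd.snd
  · exact contDiff_const

theorem contDiff_loop : ContDiff ℝ 2 fun p : Modes (Fin m × S) (Fin m) × ℝ => loop S p.1 p.2 := by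
  refine ContDiff.sum fun k _ => ?_
  exact ((contDiff_wave k).comp contDiff_snd).smul ((contDiff_amp k).comp contDiff_fst)

theorem contDiff_residual {p : EuclideanSpace ℂ (Fin m) → EuclideanSpace ℂ (Fin m)}
    (hp : ContDiff ℝ 2 p) (k : ℤ) :
    ContDiff ℝ 2 fun v : Modes (Fin m × S) (Fin m) => residual S p v k := by
  have hζ : ContDiff ℝ 2 fun v : Modes (Fin m × S) (Fin m) => v.2.1 := contDiff_snd.fst
  have h1 : ContDiff ℝ 2 fun v : Modes (Fin m × S) (Fin m) =>
      if k = 1 then squeeze v.2.1 else 1 := by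
    split_ifs
    · exact contDiff_squeeze.comp hζ
    · exact contDiff_const
  have h2 : ContDiff ℝ 2 fun v : Modes (Fin m × S) (Fin m) =>
      (innerCutoff v.2.1 : ℂ) * (divisor k v.2.1)⁻¹ :=
    (Complex.ofRealCLM.contDiff.comp (contDiff_innerCutoff.comp hζ)).mul
      (((contDiff_divisor k).comp hζ).inv fun v => divisor_ne_zero _ _)
  have h3 : ContDiff ℝ 2 fun v : Modes (Fin m × S) (Fin m) =>
      coeff k fun t => p (loop S v t) := by
    refine contDiff_const.smul (contDiff_parametric_intervalIntegral _ _ 2 ?_)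
    exact ((contDiff_wave _).comp contDiff_snd).smul (hp.comp contDiff_loop)
  exact (h1.smul (contDiff_amp k)).add (h2.smul h3)

theorem amp_rot (s : ℝ) (v : Modes (Fin m × S) (Fin m)) (k : ℤ) :
    amp S (rot S s v) k = wave k s • amp S v k := by
  ext i
  simp only [amp, rot, PiLp.smul_apply, smul_eq_mul]
  split_ifs with h h'
  · rw [flip_mul, ← flip_wave, flip_flip]
  · rw [h', wave_zero_left, one_mul]
  · rw [mul_zero]

theorem loop_rot (s : ℝ) (v : Modes (Fin m × S) (Fin m)) (t : ℝ) :
    loop S (rot S s v) t = loop S v (s + t) := by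
  simp only [loop, trig, amp_rot, smul_smul, wave_add_right, mul_comm]

theorem residual_rot (p : EuclideanSpace ℂ (Fin m) → EuclideanSpace ℂ (Fin m))
    (hp : Continuous p) (s : ℝ) (v : Modes (Fin m × S) (Fin m)) (k : ℤ) :
    residual S p (rot S s v) k = wave k s • residual S p v k := by
  have hc : coeff k (fun t => p (loop S (rot S s v) t)) =
      wave k s • coeff k fun t => p (loop S v t) := by
    have hcont : Continuous (loop S v) := continuous_trig _ _
    have hper : Function.Periodic (fun t => wave (-k) t • p (loop S v t)) (2 * Real.pi) :=
      fun t => by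
        have : loop S v (t + 2 * Real.pi) = loop S v t := periodic_trig _ _ t
        simp only [periodic_wave _ t, this]
    have h1 : mean (fun t => wave k s • (wave (-k) (s + t) • p (loop S v (s + t)))) =
        wave k s • mean (fun t => wave (-k) (s + t) • p (loop S v (s + t))) :=
      mean_clm ((wave k s • ContinuousLinearMap.id ℂ (EuclideanSpace ℂ (Fin m))).restrictScalars ℝ)
        (h := fun t => wave (-k) (s + t) • p (loop S v (s + t))) (by fun_prop)
    rw [mean_comp_add hper] at h1
    rw [coeff, coeff, ← h1]
    congr 1
    funext t
    rw [loop_rot, smul_smul, wave_add_right, ← mul_assoc, mul_comm (wave k s),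
      wave_neg_mul_wave, one_mul]
  rw [residual, hc, amp_rot, residual]
  simp only [rot]
  rw [smul_add, smul_comm (wave k s), smul_comm (wave k s)]

theorem sum_weight_amp (v : Modes (Fin m × S) (Fin m)) :
    wsq (fun j : Fin m × S => |((j.2 : ℤ) : ℝ)|) v.1 = ∑ k ∈ S, |(k : ℝ)| * ‖amp S v k‖ ^ 2 := by
  rw [wsq, Fintype.sum_prod_type_right, ← Finset.sum_coe_sort S]
  refine Finset.sum_congr rfl fun k _ => ?_
  rw [EuclideanSpace.norm_sq_eq, Finset.mul_sum]
  refine Finset.sum_congr rfl fun i _ => ?_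
  simp [amp]

theorem wsq_mean (h0 : 0 ∉ S) (v : Modes (Fin m × S) (Fin m)) :
    wsq (fun _ => 1) v.2.2 = ‖amp S v 0‖ ^ 2 := by
  rw [wsq, EuclideanSpace.norm_sq_eq]
  simp [amp, h0]

theorem divisor_smul_residual (p : EuclideanSpace ℂ (Fin m) → EuclideanSpace ℂ (Fin m))
    (v : Modes (Fin m × S) (Fin m)) (k : ℤ) :
    divisor k v.2.1 • residual S p v k = symbol k v.2.1 • amp S v k +
      (innerCutoff v.2.1 : ℂ) • coeff k fun t => p (loop S v t) := by
  rw [residual, smul_add, smul_smul, smul_smul, mul_left_comm,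
    mul_inv_cancel₀ (divisor_ne_zero _ _), mul_one]
  congr 2
  split_ifs with h
  · rw [h, symbol_one]
  · rw [divisor, if_neg h, mul_one]

theorem norm_symbol_smul_amp_le {p : EuclideanSpace ℂ (Fin m) → EuclideanSpace ℂ (Fin m)}
    {v : Modes (Fin m × S) (Fin m)} {k : ℤ} (h : residual S p v k = 0) :
    ‖symbol k v.2.1‖ * ‖amp S v k‖ ≤ ‖coeff k fun t => p (loop S v t)‖ := by
  have h1 := divisor_smul_residual p v k
  rw [h, smul_zero] at h1
  rw [← norm_smul, eq_neg_of_add_eq_zero_left h1.symm, norm_neg, norm_smul, Complex.norm_real]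
  exact mul_le_of_le_one_left (norm_nonneg _) (abs_innerCutoff_le_one _)

theorem sum_norm_sq_coeff_loop_le {p : EuclideanSpace ℂ (Fin m) → EuclideanSpace ℂ (Fin m)}
    (hp : Continuous p) (hp' : ∀ z, ‖p z‖ ^ 2 ≤ 1 / 512 * ‖z‖ ^ 2 + 1 / 512)
    (v : Modes (Fin m × S) (Fin m)) :
    ∑ k ∈ insert 0 S, ‖coeff k fun t => p (loop S v t)‖ ^ 2 ≤
      1 / 512 * (∑ k ∈ insert 0 S, ‖amp S v k‖ ^ 2) + 1 / 512 := by
  have hcont : Continuous (loop S v) := continuous_trig _ _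
  refine (sum_norm_sq_coeff_le _ (by fun_prop)).trans ?_
  refine (mean_mono (by fun_prop) (by fun_prop) fun t => hp' _).trans ?_
  rw [mean_add (by fun_prop) (by fun_prop), mean_const, ← mean_norm_sq_trig]
  exact (add_le_add_left (mean_clm ((1 / 512 : ℝ) • ContinuousLinearMap.id ℝ ℝ)
    (h := fun t => ‖loop S v t‖ ^ 2) (by fun_prop)).le _)

end Modes

end

section

namespace Modes

variable {m : ℕ} {S : Finset ℤ}

/-- The weight of a mode is the absolute value of its frequency. -/
noncomputable def weight (S : Finset ℤ) (j : Fin m × S) : ℝ := |((j.2 : ℤ) : ℝ)|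

theorem intCast_abs_eq (k : ℤ) : ((|k| : ℤ) : ℂ) = ((|(k : ℝ)| : ℝ) : ℂ) := by
  rw [← Int.cast_abs, Complex.ofReal_intCast]

theorem rot_zero (v : Modes (Fin m × S) (Fin m)) : rot S 0 v = v := by
  simp [rot]

theorem hasDerivAt_rot (v : Modes (Fin m × S) (Fin m)) :
    HasDerivAt (fun s => rot S s v) (gen (weight S) v) 0 := by
  have h1 : HasDerivAt (fun s : ℝ => fun j : Fin m × S => wave |(j.2 : ℤ)| s * v.1 j)
      (fun j => Complex.I * weight S j * v.1 j) 0 := by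
    refine hasDerivAt_pi.2 fun j => ?_
    have := (hasDerivAt_wave |(j.2 : ℤ)| 0).mul_const (v.1 j)
    simpa [weight, intCast_abs_eq] using this
  exact h1.prodMk (hasDerivAt_const (0 : ℝ) v.2)

theorem fderiv_gen_of_rot {W : Type*} [NormedAddCommGroup W] [NormedSpace ℝ W]
    {f : Modes (Fin m × S) (Fin m) → W} {v : Modes (Fin m × S) (Fin m)}
    (hf : DifferentiableAt ℝ f v) {w : W}
    (h : HasDerivAt (fun s => f (rot S s v)) w 0) : fderiv ℝ f v (gen (weight S) v) = w := by
  have h1 : HasFDerivAt f (fderiv ℝ f v) (rot S 0 v) := by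
    rw [rot_zero]; exact hf.hasFDerivAt
  exact (h1.comp_hasDerivAt (0 : ℝ) (hasDerivAt_rot v)).unique h

theorem residual_of_one_le (p : EuclideanSpace ℂ (Fin m) → EuclideanSpace ℂ (Fin m))
    {v : Modes (Fin m × S) (Fin m)} (h : 1 ≤ ‖v.2.1‖) (k : ℤ) :
    residual S p v k = (if k = 1 then v.2.1 / (‖v.2.1‖ : ℂ) else 1) • amp S v k := by
  rw [residual, innerCutoff_of_one_le h, squeeze_of_one_le h]
  simp

theorem norm_amp_zero_le (p : EuclideanSpace ℂ (Fin m) → EuclideanSpace ℂ (Fin m))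
    (v : Modes (Fin m × S) (Fin m)) :
    ‖amp S v 0‖ ≤ ‖residual S p v 0‖ + ‖coeff 0 fun t => p (loop S v t)‖ := by
  have h : Complex.I • amp S v 0 = Complex.I • residual S p v 0 -
      (innerCutoff v.2.1 : ℂ) • coeff 0 fun t => p (loop S v t) := by
    have := divisor_smul_residual p v 0
    rw [divisor_zero] at this
    rw [this]
    simp [symbol]
  have h2 := norm_sub_le (Complex.I • residual S p v 0)
    ((innerCutoff v.2.1 : ℂ) • coeff 0 fun t => p (loop S v t))
  rw [← h, norm_smul, norm_smul, norm_smul, Complex.norm_I, one_mul, one_mul,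
    Complex.norm_real] at h2
  refine h2.trans ?_
  gcongr
  exact mul_le_of_le_one_left (norm_nonneg _) (abs_innerCutoff_le_one _)

theorem sum_norm_sq_amp_le (h0 : 0 ∉ S) (v : Modes (Fin m × S) (Fin m)) :
    ∑ k ∈ S, ‖amp S v k‖ ^ 2 ≤ wsq (weight S) v.1 := by
  refine (Finset.sum_le_sum fun k hk => ?_).trans_eq (sum_weight_amp v).symm
  have : (1 : ℝ) ≤ |(k : ℝ)| := by
    exact_mod_cast Int.one_le_abs fun h => h0 (h ▸ hk)
  exact le_mul_of_one_le_left (sq_nonneg _) this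

theorem exists_residual_eq_zero (hm : 0 < m) (h1 : 1 ∈ S) (h0 : 0 ∉ S)
    {p : EuclideanSpace ℂ (Fin m) → EuclideanSpace ℂ (Fin m)} (hp : ContDiff ℝ 2 p)
    (hp' : ∀ z, ‖p z‖ ^ 2 ≤ 1 / 512 * ‖z‖ ^ 2 + 1 / 512) :
    ∃ v : Modes (Fin m × S) (Fin m), 1 ≤ wsq (weight S) v.1 ∧ wsq (weight S) v.1 ≤ 2 ∧
      ∀ k ∈ insert 0 S, residual S p v k = 0 := by
  have hS : ∀ j : Fin m × S, ((j.2 : ℤ)) ≠ 0 := fun j h => h0 (h ▸ j.2.2)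
  have hF : ContDiff ℝ 2 fun (v : Modes (Fin m × S) (Fin m)) (j : Fin m × S) =>
      flip (j.2 : ℤ) (residual S p v (j.2 : ℤ) j.1) :=
    contDiff_pi.2 fun j => (flip _).contDiff.comp
      ((contDiff_piLp_apply 2).comp (contDiff_residual hp _))
  have hG : ContDiff ℝ 2 fun (v : Modes (Fin m × S) (Fin m)) (i : Fin m) =>
      residual S p v 0 i :=
    contDiff_pi.2 fun i => (contDiff_piLp_apply 2).comp (contDiff_residual hp _)
  refine Exists.elim (exists_common_zero (k := weight (m := m) S)
    (fun j => by simpa [weight] using hS j) (fun j => (j.2 : ℤ) = 1)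
    ⟨(⟨0, hm⟩, ⟨1, h1⟩), rfl⟩ hF hG ?_ ?_ ?_ ?_ ?_) ?_
  · intro v j
    refine congrFun (fderiv_gen_of_rot (v := v) (hF.differentiable (by norm_num) v)
      (w := fun j => Complex.I * weight S j * flip (j.2 : ℤ) (residual S p v (j.2 : ℤ) j.1))
      (hasDerivAt_pi.2 fun j => ?_)) j
    have := (hasDerivAt_wave |(j.2 : ℤ)| 0).mul_const
      (flip (j.2 : ℤ) (residual S p v (j.2 : ℤ) j.1))
    simpa [weight, intCast_abs_eq, residual_rot p hp.continuous, flip_mul, flip_wave] using this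
  · intro v
    refine fderiv_gen_of_rot (hG.differentiable (by norm_num) v) ?_
    simpa [residual_rot p hp.continuous] using
      hasDerivAt_const (0 : ℝ) (fun i : Fin m => residual S p v 0 i)
  · intro v hv
    funext j
    have hj := j.2.2
    simp only [residual_of_one_le p hv, twisted, PiLp.smul_apply, smul_eq_mul, flip_mul]
    have : flip (j.2 : ℤ) (amp S v (j.2 : ℤ) j.1) = v.1 j := by simp [amp]
    rw [this]
    split_ifs with h
    · rw [h, flip_of_pos one_pos]
    · rw [flip_one, one_mul]
  · intro v hv
    funext i
    simp [residual_of_one_le p hv, amp, h0]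
  · refine ⟨10, fun v hv hGv => ?_⟩
    have hG' : ‖residual S p v 0‖ ^ 2 ≤ 1 := by
      simpa [wsq, EuclideanSpace.norm_sq_eq] using hGv
    have hb := (Finset.single_le_sum (f := fun k => ‖coeff k fun t => p (loop S v t)‖ ^ 2)
      (fun k _ => sq_nonneg _) (Finset.mem_insert_self 0 S)).trans
      (sum_norm_sq_coeff_loop_le hp.continuous hp' v)
    rw [Finset.sum_insert h0] at hb
    have hs := sum_norm_sq_amp_le h0 v
    have hx := norm_amp_zero_le p v
    rw [wsq_mean h0]
    set x := ‖amp S v 0‖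
    set b := ‖coeff 0 fun t => p (loop S v t)‖
    have hx0 : 0 ≤ x := norm_nonneg _
    have : x ^ 2 ≤ (‖residual S p v 0‖ + b) ^ 2 := by gcongr
    nlinarith [sq_nonneg (‖residual S p v 0‖ - b)]
  · rintro v ⟨hv1, hv2, hF0, hG0⟩
    refine ⟨v, hv1, hv2, fun k hk => ?_⟩
    ext i
    rcases Finset.mem_insert.1 hk with rfl | hk
    · exact congrFun hG0 i
    · have := congrFun hF0 (i, ⟨k, hk⟩)
      simp only [Pi.zero_apply] at this
      rw [← flip_flip k (residual S p v k i), this, map_zero]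
      rfl


theorem exists_galerkin (hm : 0 < m) (h1 : 1 ∈ S) (h0 : 0 ∉ S)
    {p : EuclideanSpace ℂ (Fin m) → EuclideanSpace ℂ (Fin m)} (hp : ContDiff ℝ 2 p)
    (hp' : ∀ z, ‖p z‖ ^ 2 ≤ 1 / 512 * ‖z‖ ^ 2 + 1 / 512) {η : ℝ} (hη0 : 0 ≤ η)
    (hη : ∀ z, |(inner ℂ z (p z)).re| ≤ η * ‖z‖) :
    ∃ (ζ : ℂ) (a : ℤ → EuclideanSpace ℂ (Fin m)), (∀ k ∉ insert 0 S, a k = 0) ∧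
      |(freq ζ).im| ≤ 2 * η ∧ 1 / 2 ≤ ‖a 1‖ ^ 2 ∧
      ∑ k ∈ insert 0 S, (1 + (k : ℝ) ^ 2) * ‖a k‖ ^ 2 ≤ 20 ∧
      ∀ k ∈ insert 0 S, symbol k ζ • a k + coeff k (fun t => p (trig (insert 0 S) a t)) = 0 := by
  obtain ⟨v, hR1, hR2, hv⟩ := exists_residual_eq_zero hm h1 h0 hp hp'
  have hcont : Continuous (loop S v) := continuous_trig _ _
  have hpc : Continuous p := hp.continuous
  set c : ℤ → EuclideanSpace ℂ (Fin m) := fun k => coeff k fun t => p (loop S v t) with hc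
  have hP := sum_norm_sq_coeff_loop_le hp.continuous hp' v
  have hS := sum_norm_sq_amp_le h0 v
  have hx := norm_amp_zero_le p v
  rw [hv 0 (Finset.mem_insert_self 0 S), norm_zero, zero_add] at hx
  have hc0 : ‖c 0‖ ^ 2 ≤ ∑ k ∈ insert 0 S, ‖c k‖ ^ 2 :=
    Finset.single_le_sum (f := fun k => ‖c k‖ ^ 2) (fun k _ => sq_nonneg _)
      (Finset.mem_insert_self 0 S)
  have hx2 : ‖amp S v 0‖ ^ 2 ≤ ‖c 0‖ ^ 2 := by gcongr
  have hN : ∑ k ∈ insert 0 S, ‖amp S v k‖ ^ 2 =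
      ‖amp S v 0‖ ^ 2 + ∑ k ∈ S, ‖amp S v k‖ ^ 2 := Finset.sum_insert h0
  set P := ∑ k ∈ insert 0 S, ‖c k‖ ^ 2
  set N := ∑ k ∈ insert 0 S, ‖amp S v k‖ ^ 2
  have hP3 : P ≤ 3 / 511 := by linarith
  have hN3 : N ≤ 3 := by linarith
  have hmode : ∀ k ∈ (insert 0 S).erase 1, (k : ℝ) ^ 2 * ‖amp S v k‖ ^ 2 ≤ 16 * ‖c k‖ ^ 2 := by
    intro k hk
    have hk1 := Finset.mem_erase.1 hk
    have h2 := norm_symbol_smul_amp_le (hv k hk1.2)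
    have h3 : |(k : ℝ)| / 4 * ‖amp S v k‖ ≤ ‖c k‖ :=
      (mul_le_mul_of_nonneg_right (norm_symbol_ge hk1.1 _) (norm_nonneg _)).trans h2
    have h4 : (|(k : ℝ)| / 4 * ‖amp S v k‖) ^ 2 ≤ ‖c k‖ ^ 2 := by gcongr
    rw [mul_pow, div_pow, sq_abs] at h4
    linarith
  have h1mem : (1 : ℤ) ∈ insert 0 S := Finset.mem_insert_of_mem h1
  have hrest : ∑ k ∈ (insert 0 S).erase 1, (k : ℝ) ^ 2 * ‖amp S v k‖ ^ 2 ≤ 16 * P := by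
    refine (Finset.sum_le_sum hmode).trans ?_
    rw [← Finset.mul_sum]
    exact mul_le_mul_of_nonneg_left (Finset.sum_le_sum_of_subset_of_nonneg
      (Finset.erase_subset _ _) fun k _ _ => sq_nonneg ‖c k‖) (by norm_num)
  have hsq := Finset.add_sum_erase (insert 0 S)
    (fun k : ℤ => (k : ℝ) ^ 2 * ‖amp S v k‖ ^ 2) h1mem
  simp only [Int.cast_one, one_pow, one_mul] at hsq
  have habs : wsq (weight S) v.1 ≤ ∑ k ∈ insert 0 S, (k : ℝ) ^ 2 * ‖amp S v k‖ ^ 2 := by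
    refine (sum_weight_amp v).trans_le ?_
    rw [Finset.sum_insert h0]
    simp only [Int.cast_zero, ne_eq, OfNat.ofNat_ne_zero, not_false_eq_true, zero_pow, zero_mul,
      zero_add]
    refine Finset.sum_le_sum fun k hk => ?_
    have : (1 : ℝ) ≤ |(k : ℝ)| := by
      exact_mod_cast Int.one_le_abs fun h => h0 (h ▸ hk)
    gcongr
    nlinarith [sq_abs (k : ℝ)]
  have ha1 : 1 / 2 ≤ ‖amp S v 1‖ ^ 2 := by linarith
  have ha1' : ‖amp S v 1‖ ^ 2 ≤ N :=
    Finset.single_le_sum (f := fun k => ‖amp S v k‖ ^ 2) (fun k _ => sq_nonneg _) h1mem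
  have hc1 : ‖c 1‖ ^ 2 ≤ P :=
    Finset.single_le_sum (f := fun k => ‖c k‖ ^ 2) (fun k _ => sq_nonneg _) h1mem
  have hsqz : ‖squeeze v.2.1‖ ^ 2 ≤ 1 / 2 := by
    have h2 := norm_symbol_smul_amp_le (hv 1 h1mem)
    rw [symbol_one, divisor, if_pos rfl, norm_mul, norm_div, norm_neg, Complex.norm_I,
      Complex.norm_ofNat] at h2
    have h3 : (‖squeeze v.2.1‖ / 4 * ‖amp S v 1‖) ^ 2 ≤ ‖c 1‖ ^ 2 := by
      refine pow_le_pow_left₀ (by positivity) (le_trans (le_of_eq ?_) h2) 2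
      ring
    rw [mul_pow, div_pow] at h3
    nlinarith [sq_nonneg ‖squeeze v.2.1‖]
  have hcut := innerCutoff_of_le (norm_lt_of_norm_squeeze hsqz)
  have heq : ∀ k ∈ insert 0 S, symbol k v.2.1 • amp S v k + c k = 0 := by
    intro k hk
    have := divisor_smul_residual p v k
    rwa [hv k hk, smul_zero, hcut, Complex.ofReal_one, one_smul, eq_comm] at this
  refine ⟨v.2.1, amp S v, fun k hk => ?_, ?_, ha1, ?_, heq⟩
  · ext i
    rw [Finset.mem_insert, not_or] at hk
    simp [amp, hk.1, hk.2]
  · have hre : ∀ k ∈ insert 0 S, (inner ℂ (amp S v k) (c k)).re =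
        -((freq v.2.1).im * (|(k : ℝ)| * ‖amp S v k‖ ^ 2)) := by
      intro k hk
      rw [eq_neg_of_add_eq_zero_right (heq k hk), inner_neg_right, inner_smul_right,
        inner_self_eq_norm_sq_to_K]
      have := int_mul_im_flip k (freq v.2.1)
      simp only [symbol, ← Complex.ofReal_intCast, ← Complex.ofReal_pow, Complex.coe_algebraMap,
        Complex.neg_re, Complex.re_mul_ofReal, Complex.I_mul_re, Complex.sub_im, Complex.one_im,
        Complex.im_mul_ofReal]
      linear_combination (-‖amp S v k‖ ^ 2) * this
    have hsum : mean (fun t => (inner ℂ (loop S v t) (p (loop S v t))).re) =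
        -((freq v.2.1).im * wsq (weight S) v.1) := by
      rw [mean_re (by fun_prop), show mean (fun t => inner ℂ (loop S v t) (p (loop S v t))) = _
        from mean_inner_trig _ _ (by fun_prop), Complex.re_sum, Finset.sum_congr rfl hre,
        Finset.sum_neg_distrib, ← Finset.mul_sum, Finset.sum_insert h0, ← sum_weight_amp]
      simp only [Int.cast_zero, abs_zero, zero_mul, zero_add]
      rfl
    have hbound : |mean (fun t => (inner ℂ (loop S v t) (p (loop S v t))).re)| ≤ η * 2 := by
      rw [← Real.norm_eq_abs]
      refine (norm_mean_le _).trans ?_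
      refine (mean_mono (by fun_prop) (by fun_prop) (g := fun t =>
        (η / 2) * ‖loop S v t‖ ^ 2 + η / 2) fun t => (hη _).trans ?_).trans ?_
      · nlinarith [sq_nonneg (‖loop S v t‖ - 1)]
      · rw [mean_add (by fun_prop) (by fun_prop), mean_const]
        have h5 : mean (fun t => (η / 2) * ‖loop S v t‖ ^ 2) = (η / 2) * N := by
          rw [show N = mean fun t => ‖loop S v t‖ ^ 2 from (mean_norm_sq_trig _ _).symm]
          exact mean_clm ((η / 2) • ContinuousLinearMap.id ℝ ℝ)
            (h := fun t => ‖loop S v t‖ ^ 2) (by fun_prop)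
        rw [h5]
        nlinarith
    rw [hsum, abs_neg, abs_mul] at hbound
    rw [abs_of_nonneg (zero_le_one.trans hR1)] at hbound
    nlinarith [abs_nonneg (freq v.2.1).im]
  · simp only [add_mul, one_mul, Finset.sum_add_distrib]
    linarith

end Modes

end

section

open Filter Topology

theorem summable_inv_one_add_sq : Summable fun k : ℤ => (1 + (k : ℝ) ^ 2)⁻¹ := by
  refine .of_norm_bounded_eventually (Real.summable_one_div_int_pow.2 one_lt_two) ?_
  refine (Set.finite_singleton (0 : ℤ)).subset fun k hk => ?_
  by_contra h0
  have h0 : (k : ℝ) ≠ 0 := by exact_mod_cast h0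
  refine hk ?_
  have : 0 < (k : ℝ) ^ 2 := by positivity
  change ‖(1 + (k : ℝ) ^ 2)⁻¹‖ ≤ 1 / (k : ℝ) ^ 2
  rw [Real.norm_of_nonneg (by positivity), ← one_div]
  exact one_div_le_one_div_of_le this (by linarith)

theorem le_weight_mul_sq_add_min {d w δ : ℝ} (hd : 0 ≤ d) (hw : 0 < w) (hδ : 0 < δ) :
    d ≤ δ * (w * d ^ 2) + min d (δ⁻¹ * w⁻¹) := by
  rcases le_total d (δ⁻¹ * w⁻¹) with h | h
  · rw [min_eq_left h]
    have : 0 ≤ δ * (w * d ^ 2) := by positivity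
    linarith
  · have h1 : 1 ≤ d * (δ * w) := by
      rw [← mul_inv, inv_le_iff_one_le_mul₀ (by positivity)] at h
      exact h
    have : 0 ≤ min d (δ⁻¹ * w⁻¹) := le_min hd (by positivity)
    nlinarith

section Weighted

variable {d : ℤ → ℝ} {C : ℝ}

theorem summable_of_weighted (hd : ∀ k, 0 ≤ d k)
    (hC : ∀ T : Finset ℤ, ∑ k ∈ T, (1 + (k : ℝ) ^ 2) * d k ^ 2 ≤ C) : Summable d := by
  have h1 : Summable fun k : ℤ => (1 + (k : ℝ) ^ 2) * d k ^ 2 :=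
    summable_of_sum_le (fun k => by positivity) hC
  refine .of_nonneg_of_le hd (fun k => ?_) (h1.add summable_inv_one_add_sq)
  have := le_weight_mul_sq_add_min (hd k) (w := 1 + (k : ℝ) ^ 2) (by positivity) one_pos
  rw [one_mul, inv_one, one_mul] at this
  exact this.trans (by gcongr; exact min_le_right _ _)

theorem tsum_le_of_weighted (hd : ∀ k, 0 ≤ d k)
    (hC : ∀ T : Finset ℤ, ∑ k ∈ T, (1 + (k : ℝ) ^ 2) * d k ^ 2 ≤ C) {δ : ℝ} (hδ : 0 < δ) :
    ∑' k, d k ≤ δ * C + ∑' k : ℤ, min (d k) (δ⁻¹ * (1 + (k : ℝ) ^ 2)⁻¹) := by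
  have h1 : Summable fun k : ℤ => (1 + (k : ℝ) ^ 2) * d k ^ 2 :=
    summable_of_sum_le (fun k => by positivity) hC
  have hs := summable_of_weighted hd hC
  have h2 : Summable fun k : ℤ => min (d k) (δ⁻¹ * (1 + (k : ℝ) ^ 2)⁻¹) :=
    .of_nonneg_of_le (fun k => le_min (hd k) (by positivity)) (fun k => min_le_left _ _) hs
  calc ∑' k, d k ≤ ∑' k : ℤ, (δ * ((1 + (k : ℝ) ^ 2) * d k ^ 2) +
        min (d k) (δ⁻¹ * (1 + (k : ℝ) ^ 2)⁻¹)) :=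
        hs.tsum_le_tsum (fun k => le_weight_mul_sq_add_min (hd k) (by positivity) hδ)
          ((h1.mul_left δ).add h2)
    _ = δ * (∑' k : ℤ, (1 + (k : ℝ) ^ 2) * d k ^ 2) +
        ∑' k : ℤ, min (d k) (δ⁻¹ * (1 + (k : ℝ) ^ 2)⁻¹) := by
        rw [(h1.mul_left δ).tsum_add h2, tsum_mul_left]
    _ ≤ _ := by
        gcongr
        exact h1.tsum_le_of_sum_le hC

theorem tendsto_tsum_of_weighted {d : ℕ → ℤ → ℝ} (hd : ∀ n k, 0 ≤ d n k)
    (hC : ∀ n, ∀ T : Finset ℤ, ∑ k ∈ T, (1 + (k : ℝ) ^ 2) * d n k ^ 2 ≤ C)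
    (hl : ∀ k, Tendsto (fun n => d n k) atTop (𝓝 0)) :
    Tendsto (fun n => ∑' k, d n k) atTop (𝓝 0) := by
  have hC0 : 0 ≤ C := by simpa using hC 0 ∅
  refine (Metric.tendsto_nhds).2 fun e he => ?_
  set δ := e / (2 * (C + 1)) with hδ
  have hδ0 : 0 < δ := by positivity
  have hδC : δ * C < e / 2 := by
    rw [hδ, div_mul_eq_mul_div, div_lt_iff₀ (by positivity)]
    nlinarith
  have h1 : Tendsto (fun n => ∑' k : ℤ, min (d n k) (δ⁻¹ * (1 + (k : ℝ) ^ 2)⁻¹)) atTop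
      (𝓝 (∑' _ : ℤ, (0 : ℝ))) := by
    refine tendsto_tsum_of_dominated_convergence (summable_inv_one_add_sq.mul_left δ⁻¹)
      (fun k => ?_) (.of_forall fun n k => ?_)
    · exact squeeze_zero (fun n => le_min (hd n k) (by positivity)) (fun n => min_le_left _ _)
        (hl k)
    · rw [Real.norm_of_nonneg (le_min (hd n k) (by positivity))]
      exact min_le_right _ _
  rw [tsum_zero] at h1
  filter_upwards [(tendsto_order.1 h1).2 (e / 2) (by positivity)] with n hn
  rw [Real.dist_0_eq_abs, abs_of_nonneg (tsum_nonneg (hd n))]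
  linarith [tsum_le_of_weighted (hd n) (hC n) hδ0]

end Weighted

section Series

variable {V : Type*} [NormedAddCommGroup V] [InnerProductSpace ℂ V]

theorem tendsto_coeff {f : ℕ → ℝ → V} {g : ℝ → V} {C : ℝ} (hf : ∀ n, Continuous (f n))
    (hC : ∀ n t, ‖f n t‖ ≤ C) (hl : ∀ t, Tendsto (fun n => f n t) atTop (𝓝 (g t))) (k : ℤ) :
    Tendsto (fun n => coeff k (f n)) atTop (𝓝 (coeff k g)) := by
  refine Tendsto.const_smul (intervalIntegral.tendsto_integral_filter_of_dominated_convergence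
    (fun _ => C) (.of_forall fun n => ?_) (.of_forall fun n => .of_forall fun t _ => ?_)
    intervalIntegrable_const (.of_forall fun t _ => (hl t).const_smul _)) _
  · have := hf n
    exact Continuous.aestronglyMeasurable (by fun_prop)
  · rw [norm_smul, norm_wave, one_mul]
    exact hC n t

/-- The Fourier series with given coefficients. -/
noncomputable def series (a : ℤ → V) (t : ℝ) : V := ∑' k, wave k t • a k

theorem series_eq_trig {a : ℤ → V} {T : Finset ℤ} (h : ∀ k ∉ T, a k = 0) :
    series a = trig T a := by
  funext t
  exact tsum_eq_sum fun k hk => by rw [h k hk, smul_zero]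

theorem periodic_series (a : ℤ → V) : Function.Periodic (series a) (2 * Real.pi) := fun t => by
  simp only [series, periodic_wave _ t]

theorem norm_wave_smul (k : ℤ) (t : ℝ) (v : V) : ‖wave k t • v‖ = ‖v‖ := by
  rw [norm_smul, norm_wave, one_mul]

theorem norm_series_le {a : ℤ → V} (ha : Summable fun k => ‖a k‖) (t : ℝ) :
    ‖series a t‖ ≤ ∑' k, ‖a k‖ := by
  refine (norm_tsum_le_tsum_norm ?_).trans_eq ?_ <;> simp only [norm_wave_smul]
  exact ha

variable [CompleteSpace V]

theorem continuous_series {a : ℤ → V} (ha : Summable fun k => ‖a k‖) : Continuous (series a) :=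
  continuous_tsum (fun k => by fun_prop) ha fun k t => (norm_wave_smul k t _).le

theorem series_sub {a b : ℤ → V} (ha : Summable fun k => ‖a k‖) (hb : Summable fun k => ‖b k‖)
    (t : ℝ) : series (fun k => a k - b k) t = series a t - series b t := by
  have h : ∀ {a : ℤ → V}, (Summable fun k => ‖a k‖) → Summable fun k => wave k t • a k :=
    fun ha => .of_norm (by simpa only [norm_wave_smul] using ha)
  simp only [series, smul_sub]
  exact (h ha).tsum_sub (h hb)

end Series

end

section

open Filter Topology

section Limit

variable {m : ℕ} {p : EuclideanSpace ℂ (Fin m) → EuclideanSpace ℂ (Fin m)}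

theorem exists_approx (hp : Continuous p) (hb : ∀ z, ‖p z‖ ≤ 1 / 64 * ‖z‖)
    (ho : ∀ z, (inner ℂ z (p z)).re = 0) {η : ℝ} (hη : 0 < η) (hη' : η ≤ 1 / 64) :
    ∃ g : EuclideanSpace ℂ (Fin m) → EuclideanSpace ℂ (Fin m), ContDiff ℝ 2 g ∧
      (∀ z, ‖g z - p z‖ ≤ η) ∧ (∀ z, ‖g z‖ ≤ 1 / 64 * ‖z‖ + 1 / 64) ∧
      ∀ z, |(inner ℂ z (g z)).re| ≤ η * ‖z‖ := by
  obtain ⟨g, hg, hgp, -⟩ := hp.exists_contDiff_approx 2 (ε := fun _ => η) continuous_const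
    fun _ => hη
  have hgp' : ∀ z, ‖g z - p z‖ ≤ η := fun z => by rw [← dist_eq_norm]; exact (hgp z).le
  refine ⟨g, by exact_mod_cast hg, hgp', fun z => ?_, fun z => ?_⟩
  · have := norm_le_insert' (g z) (p z)
    linarith [hgp' z, hb z]
  · have h1 : (inner ℂ z (g z)).re = (inner ℂ z (g z - p z)).re := by
      rw [inner_sub_right, Complex.sub_re, ho, sub_zero]
    rw [h1, mul_comm]
    exact (Complex.abs_re_le_norm _).trans ((norm_inner_le_norm _ _).trans
      (mul_le_mul_of_nonneg_left (hgp' z) (norm_nonneg _)))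

theorem exists_galerkin_sequence (hm : 0 < m) (hp : Continuous p)
    (hb : ∀ z, ‖p z‖ ≤ 1 / 64 * ‖z‖) (ho : ∀ z, (inner ℂ z (p z)).re = 0) (n : ℕ) :
    ∃ (g : EuclideanSpace ℂ (Fin m) → EuclideanSpace ℂ (Fin m)) (w : ℂ)
      (a : ℤ → EuclideanSpace ℂ (Fin m)), Continuous g ∧
      (∀ z, ‖g z - p z‖ ≤ 1 / 64 * (1 / ((n : ℝ) + 1))) ∧
      (∀ z, ‖g z‖ ≤ 1 / 64 * ‖z‖ + 1 / 64) ∧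
      (∃ T : Finset ℤ, ∀ k ∉ T, a k = 0) ∧
      ‖w - 1‖ ≤ 1 / 4 ∧ |w.im| ≤ 1 / ((n : ℝ) + 1) ∧ 1 / 2 ≤ ‖a 1‖ ^ 2 ∧
      (∀ T : Finset ℤ, ∑ k ∈ T, (1 + (k : ℝ) ^ 2) * ‖a k‖ ^ 2 ≤ 20) ∧
      ∀ k : ℤ, |k| ≤ n → (Complex.I * (1 - flip k w * k)) • a k +
        coeff k (fun t => g (series a t)) = 0 := by
  have hη : (0 : ℝ) < 1 / 64 * (1 / ((n : ℝ) + 1)) := by positivity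
  have hn1 : 1 / ((n : ℝ) + 1) ≤ 1 := by
    rw [div_le_one (by positivity)]
    linarith [n.cast_nonneg (α := ℝ)]
  obtain ⟨g, hg, hgp, hgb, hgo⟩ := exists_approx hp hb ho hη (by linarith)
  set T : Finset ℤ := Finset.Icc (-((n : ℤ) + 1)) (n + 1) with hT
  have hT0 : insert 0 (T.erase 0) = T :=
    Finset.insert_erase (by rw [hT, Finset.mem_Icc]; omega)
  have hgb2 : ∀ z, ‖g z‖ ^ 2 ≤ 1 / 512 * ‖z‖ ^ 2 + 1 / 512 := fun z => by
    have h1 : ‖g z‖ ^ 2 ≤ (1 / 64 * ‖z‖ + 1 / 64) ^ 2 := by gcongr; exact hgb z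
    nlinarith [sq_nonneg (‖z‖ - 1)]
  obtain ⟨ζ, a, ha0, hw, ha1, ha2, hae⟩ := Modes.exists_galerkin (S := T.erase 0) hm
    (by rw [Finset.mem_erase, hT, Finset.mem_Icc]; omega) (Finset.notMem_erase 0 T) hg
    hgb2 hη.le hgo
  rw [hT0] at ha0 ha2 hae
  refine ⟨g, freq ζ, a, hg.continuous, hgp, hgb, ⟨T, ha0⟩, norm_freq_sub_one_le ζ, ?_, ha1,
    fun T' => ?_, fun k hk => ?_⟩
  · refine hw.trans ?_
    have : 0 < 1 / ((n : ℝ) + 1) := by positivity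
    linarith
  · refine le_trans ?_ ha2
    rw [← Finset.sum_filter_add_sum_filter_not T' (· ∈ T),
      Finset.sum_eq_zero (s := T'.filter (· ∉ T)), add_zero]
    · exact Finset.sum_le_sum_of_subset_of_nonneg
        (fun k hk => (Finset.mem_filter.1 hk).2) fun k _ _ => by positivity
    · intro k hk
      rw [ha0 k (Finset.mem_filter.1 hk).2, norm_zero]
      ring
  · rw [series_eq_trig ha0]
    refine hae k ?_
    rw [hT, Finset.mem_Icc]
    have := abs_le.1 hk
    omega

theorem exists_loop (hm : 0 < m) (hp : Continuous p) (hb : ∀ z, ‖p z‖ ≤ 1 / 64 * ‖z‖)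
    (ho : ∀ z, (inner ℂ z (p z)).re = 0) :
    ∃ (r : ℝ) (u : ℝ → EuclideanSpace ℂ (Fin m)), 0 < r ∧
      Function.Periodic u (2 * Real.pi) ∧
      (∀ t, HasDerivAt (fun t => r • u t) (Complex.I • u t + p (u t)) t) ∧ ∃ t, u t ≠ 0 := by
  choose g w a hg hgp hgb hfin hw hwim ha1 ha2 hae using exists_galerkin_sequence hm hp hb ho
  have hak : ∀ n k, ‖a n k‖ ≤ 5 := by
    intro n k
    have := ha2 n {k}
    rw [Finset.sum_singleton] at this
    have h2 : 0 ≤ (k : ℝ) ^ 2 * ‖a n k‖ ^ 2 := by positivity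
    nlinarith [norm_nonneg (a n k)]
  have hK : IsCompact (Metric.closedBall (1 : ℂ) (1 / 4) ×ˢ
      Set.univ.pi fun _ : ℤ => Metric.closedBall (0 : EuclideanSpace ℂ (Fin m)) 5) :=
    (isCompact_closedBall _ _).prod (isCompact_univ_pi fun _ => isCompact_closedBall _ _)
  obtain ⟨⟨ω, b⟩, -, φ, hφ, hlim⟩ := hK.tendsto_subseq (x := fun n => (w n, a n)) fun n =>
    ⟨by simpa [dist_eq_norm] using hw n, fun k _ => by simpa using hak n k⟩
  have hφt := hφ.tendsto_atTop
  have hlimw : Tendsto (fun n => w (φ n)) atTop (𝓝 ω) :=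
    (continuous_fst.tendsto _).comp hlim
  have hlima : ∀ k, Tendsto (fun n => a (φ n) k) atTop (𝓝 (b k)) := fun k =>
    (((continuous_apply k).comp continuous_snd).tendsto _).comp hlim
  have hb2 : ∀ T : Finset ℤ, ∑ k ∈ T, (1 + (k : ℝ) ^ 2) * ‖b k‖ ^ 2 ≤ 20 := fun T =>
    le_of_tendsto' (tendsto_finsetSum _ fun k _ =>
      (((hlima k).norm.pow 2).const_mul _)) fun n => ha2 (φ n) T
  have hsa : ∀ n, Summable fun k => ‖a n k‖ := fun n =>
    summable_of_weighted (fun k => norm_nonneg _) (ha2 n)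
  have hsb : Summable fun k => ‖b k‖ := summable_of_weighted (fun k => norm_nonneg _) hb2
  have hD : Tendsto (fun n => ∑' k, ‖a (φ n) k - b k‖) atTop (𝓝 0) := by
    refine tendsto_tsum_of_weighted (C := 80) (fun n k => norm_nonneg _) (fun n T => ?_)
      fun k => ?_
    · calc ∑ k ∈ T, (1 + (k : ℝ) ^ 2) * ‖a (φ n) k - b k‖ ^ 2
          ≤ ∑ k ∈ T, (2 * ((1 + (k : ℝ) ^ 2) * ‖a (φ n) k‖ ^ 2) +
            2 * ((1 + (k : ℝ) ^ 2) * ‖b k‖ ^ 2)) := by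
            refine Finset.sum_le_sum fun k _ => ?_
            have h1 : ‖a (φ n) k - b k‖ ^ 2 ≤ (‖a (φ n) k‖ + ‖b k‖) ^ 2 := by
              gcongr
              exact norm_sub_le _ _
            have h2 : ‖a (φ n) k - b k‖ ^ 2 ≤ 2 * ‖a (φ n) k‖ ^ 2 + 2 * ‖b k‖ ^ 2 := by
              nlinarith [sq_nonneg (‖a (φ n) k‖ - ‖b k‖)]
            have h3 := mul_le_mul_of_nonneg_left h2 (show 0 ≤ 1 + (k : ℝ) ^ 2 by positivity)
            linarith
        _ ≤ 80 := by
            rw [Finset.sum_add_distrib, ← Finset.mul_sum, ← Finset.mul_sum]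
            linarith [ha2 (φ n) T, hb2 T]
    · exact tendsto_iff_norm_sub_tendsto_zero.1 (hlima k)
  have hu : ∀ t, Tendsto (fun n => series (a (φ n)) t) atTop (𝓝 (series b t)) := by
    intro t
    refine tendsto_iff_norm_sub_tendsto_zero.2 (squeeze_zero (fun n => norm_nonneg _)
      (fun n => ?_) hD)
    rw [← series_sub (hsa _) hsb]
    exact norm_series_le (.of_nonneg_of_le (fun k => norm_nonneg _) (fun k => norm_sub_le _ _)
      ((hsa (φ n)).add hsb)) t
  have hba : ∀ n t, ‖series (a (φ n)) t‖ ≤ 20 + ∑' k : ℤ, (1 + (k : ℝ) ^ 2)⁻¹ := by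
    intro n t
    refine (norm_series_le (hsa _) t).trans
      ((tsum_le_of_weighted (fun k => norm_nonneg _) (ha2 (φ n)) one_pos).trans ?_)
    rw [one_mul, inv_one]
    simp only [one_mul]
    gcongr
    · exact .of_nonneg_of_le (fun k => le_min (norm_nonneg _) (by positivity))
        (fun k => min_le_left _ _) (hsa (φ n))
    · exact summable_inv_one_add_sq
    · exact min_le_right _ _
  have hca : ∀ n, Continuous (series (a n)) := fun n => continuous_series (hsa n)
  have hcoeff : ∀ k, coeff k (series b) = b k := by
    intro k
    refine tendsto_nhds_unique (tendsto_coeff (fun n => hca (φ n)) hba hu k) ?_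
    have : ∀ n, coeff k (series (a n)) = a n k := by
      intro n
      obtain ⟨T, hT⟩ := hfin n
      rw [series_eq_trig hT, coeff_trig]
      split_ifs with h
      · rfl
      · exact (hT k h).symm
    simpa only [this] using hlima k
  have hη : Tendsto (fun n => 1 / ((φ n : ℝ) + 1)) atTop (𝓝 0) :=
    tendsto_one_div_add_atTop_nhds_zero_nat.comp hφt
  have hgl : ∀ k, Tendsto (fun n => coeff k fun t => g (φ n) (series (a (φ n)) t)) atTop
      (𝓝 (coeff k fun t => p (series b t))) := by
    intro k
    refine tendsto_coeff (C := 1 / 64 * (20 + ∑' k : ℤ, (1 + (k : ℝ) ^ 2)⁻¹) + 1 / 64)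
      (fun n => (hg _).comp (hca _)) (fun n t => (hgb _ _).trans ?_) (fun t => ?_) k
    · gcongr
      exact hba n t
    · have h1 : Tendsto (fun n => g (φ n) (series (a (φ n)) t) - p (series (a (φ n)) t)) atTop
          (𝓝 0) :=
        squeeze_zero_norm (fun n => hgp (φ n) _)
          (by simpa only [mul_zero] using hη.const_mul (1 / 64))
      simpa using h1.add ((hp.tendsto _).comp (hu t))
  have hωim : ω.im = 0 := by
    have h1 : Tendsto (fun n => |(w (φ n)).im|) atTop (𝓝 |ω.im|) :=
      ((Complex.continuous_im.tendsto _).comp hlimw).abs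
    have h2 : |ω.im| ≤ 0 := le_of_tendsto_of_tendsto' h1 hη fun n => hwim (φ n)
    exact abs_nonpos_iff.1 h2
  have hω1 : ‖ω - 1‖ ≤ 1 / 4 := le_of_tendsto' (hlimw.sub_const 1).norm fun n => hw (φ n)
  have hωre : 0 < ω.re := by
    have := (Complex.abs_re_le_norm (ω - 1)).trans hω1
    rw [Complex.sub_re, Complex.one_re] at this
    linarith [(abs_le.1 this).1]
  have hωeq : (ω.re : ℂ) = ω := Complex.ext rfl hωim.symm
  have hflip : ∀ k, flip k ω = ω.re := by
    intro k
    rcases lt_or_ge 0 k with h | h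
    · rw [flip_of_pos h, hωeq]
    · rw [flip_of_nonpos h, ← hωeq, Complex.conj_ofReal, hωeq, hωeq]
  have heq : ∀ k : ℤ, (Complex.I * (1 - ω.re * k)) • b k +
      coeff k (fun t => p (series b t)) = 0 := by
    intro k
    rw [← hflip k]
    have h1 : Tendsto (fun n => (Complex.I * (1 - flip k (w (φ n)) * k)) • a (φ n) k +
        coeff k fun t => g (φ n) (series (a (φ n)) t)) atTop
        (𝓝 ((Complex.I * (1 - flip k ω * k)) • b k + coeff k fun t => p (series b t))) :=
      (((((((flip k).continuous.tendsto _).comp hlimw).mul_const _).const_sub _).const_mul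
        _).smul (hlima k)).add (hgl k)
    refine tendsto_nhds_unique h1 (tendsto_const_nhds.congr' ?_)
    filter_upwards [hφt.eventually_ge_atTop k.natAbs] with n hn
    exact (hae (φ n) k (by rw [Int.abs_eq_natAbs]; exact_mod_cast hn)).symm
  have hcb : Continuous (series b) := continuous_series hsb
  have hper := periodic_series b
  refine ⟨ω.re, series b, hωre, hper, hasDerivAt_of_coeff_eq_vec (by fun_prop) hcb
    (fun t => by rw [hper t]) hper fun k => ?_, ?_⟩
  · have h1 : coeff k (fun t => Complex.I • series b t + p (series b t)) =
        Complex.I • coeff k (series b) + coeff k fun t => p (series b t) := by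
      simp only [coeff, smul_add]
      rw [mean_add (by fun_prop) (by fun_prop)]
      congr 1
      simp only [smul_comm _ Complex.I]
      exact mean_clm ((Complex.I • ContinuousLinearMap.id ℂ (EuclideanSpace ℂ (Fin m))).restrictScalars ℝ)
        (h := fun t => wave (-k) t • series b t) (by fun_prop)
    rw [h1, hcoeff, eq_neg_of_add_eq_zero_right (heq k), ← neg_smul, ← add_smul]
    congr 1
    ring
  · by_contra! h
    have h1 : b 1 = 0 := by
      rw [← hcoeff 1, coeff]
      simp only [h, smul_zero]
      exact mean_const _
    have h2 : 1 / 2 ≤ ‖b 1‖ ^ 2 :=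
      ge_of_tendsto' ((hlima 1).norm.pow 2) fun n => ha1 (φ n)
    rw [h1] at h2
    norm_num at h2

end Limit

end

section

open Filter Topology

section Orbit

variable {m : ℕ}

theorem re_inner_eq_inner (x y : EuclideanSpace ℂ (Fin m)) : (inner ℂ x y).re = ⟪x, y⟫ := by
  simp only [PiLp.inner_apply, Complex.re_sum]
  refine Finset.sum_congr rfl fun i _ => ?_
  rw [Complex.inner, RCLike.inner_apply, mul_comm]

/-- The deviation from the Hopf field of the homogeneous extension of a field on the sphere. -/
noncomputable def deviation (X : EuclideanSpace ℂ (Fin m) → EuclideanSpace ℂ (Fin m))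
    (z : EuclideanSpace ℂ (Fin m)) : EuclideanSpace ℂ (Fin m) :=
  ‖z‖ • X (‖z‖⁻¹ • z) - Complex.I • z

variable {X : EuclideanSpace ℂ (Fin m) → EuclideanSpace ℂ (Fin m)}

theorem norm_deviation_le {ε : ℝ} (h : ∀ z, ‖z‖ = 1 → ‖X z - Complex.I • z‖ < ε)
    (z : EuclideanSpace ℂ (Fin m)) : ‖deviation X z‖ ≤ ε * ‖z‖ := by
  rcases eq_or_ne z 0 with rfl | hz
  · simp [deviation]
  have hz' : ‖z‖ ≠ 0 := norm_ne_zero_iff.2 hz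
  have h1 : deviation X z = ‖z‖ • (X (‖z‖⁻¹ • z) - Complex.I • ‖z‖⁻¹ • z) := by
    rw [deviation, smul_sub, smul_comm Complex.I, smul_inv_smul₀ hz']
  rw [h1, norm_smul, norm_norm, mul_comm]
  exact mul_le_mul_of_nonneg_right (h _ (by rw [norm_smul, norm_inv, norm_norm,
    inv_mul_cancel₀ hz'])).le (norm_nonneg _)

theorem continuous_deviation (hX : Continuous X) {ε : ℝ}
    (h : ∀ z, ‖z‖ = 1 → ‖X z - Complex.I • z‖ < ε) : Continuous (deviation X) := by
  refine continuous_iff_continuousAt.2 fun z => ?_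
  rcases eq_or_ne z 0 with rfl | hz
  · have h0 : deviation X 0 = 0 := by simp [deviation]
    rw [ContinuousAt, h0]
    refine squeeze_zero_norm (norm_deviation_le h) ?_
    have : Tendsto (fun z : EuclideanSpace ℂ (Fin m) => ε * ‖z‖) (𝓝 0) (𝓝 (ε * ‖(0 : EuclideanSpace ℂ (Fin m))‖)) :=
      (continuous_const.mul continuous_norm).tendsto 0
    simpa using this
  · have h1 : ContinuousAt (fun z : EuclideanSpace ℂ (Fin m) => ‖z‖⁻¹ • z) z :=
      (continuous_norm.continuousAt.inv₀ (norm_ne_zero_iff.2 hz)).smul continuousAt_id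
    have h2 : ContinuousAt (fun z => X (‖z‖⁻¹ • z)) z :=
      ContinuousAt.comp (f := fun z : EuclideanSpace ℂ (Fin m) => ‖z‖⁻¹ • z) hX.continuousAt h1
    exact (continuous_norm.continuousAt.smul h2).sub (continuous_const_smul _).continuousAt

theorem inner_homogeneous_extension (h : ∀ z, ‖z‖ = 1 → ⟪X z, z⟫ = 0)
    (z : EuclideanSpace ℂ (Fin m)) : ⟪z, ‖z‖ • X (‖z‖⁻¹ • z)⟫ = 0 := by
  rcases eq_or_ne z 0 with rfl | hz
  · simp
  have hz' : ‖z‖ ≠ 0 := norm_ne_zero_iff.2 hz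
  have h1 := h (‖z‖⁻¹ • z) (by rw [norm_smul, norm_inv, norm_norm, inv_mul_cancel₀ hz'])
  rw [real_inner_smul_right, mul_eq_zero, inv_eq_zero, or_iff_right hz'] at h1
  rw [real_inner_smul_right, real_inner_comm, h1, mul_zero]

theorem re_inner_deviation (h : ∀ z, ‖z‖ = 1 → ⟪X z, z⟫ = 0) (z : EuclideanSpace ℂ (Fin m)) :
    (inner ℂ z (deviation X z)).re = 0 := by
  rw [deviation, inner_sub_right, Complex.sub_re, re_inner_eq_inner,
    inner_homogeneous_extension h, inner_smul_right, inner_self_eq_norm_sq_to_K]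
  simp [← Complex.ofReal_pow]

theorem exists_periodic_orbit (hm : 0 < m) (hX : Continuous X)
    (ho : ∀ z, ‖z‖ = 1 → ⟪X z, z⟫ = 0)
    (hb : ∀ z, ‖z‖ = 1 → ‖X z - Complex.I • z‖ < 1 / 64) :
    ∃ γ : ℝ → EuclideanSpace ℂ (Fin m), (∀ t, ‖γ t‖ = 1) ∧ (∀ t, HasDerivAt γ (X (γ t)) t) ∧
      (∃ T > 0, ∀ t, γ (t + T) = γ t) ∧ ∃ t s, γ t ≠ γ s := by
  obtain ⟨r, u, hr, hper, hd, s, hs⟩ := exists_loop hm (continuous_deviation hX hb)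
    (norm_deviation_le hb) (re_inner_deviation ho)
  have hd' : ∀ t, HasDerivAt u (r⁻¹ • ‖u t‖ • X (‖u t‖⁻¹ • u t)) t := by
    intro t
    have := (hd t).const_smul r⁻¹
    simpa only [Pi.smul_def, smul_smul, inv_mul_cancel₀ hr.ne', one_smul, deviation, add_sub_cancel] using this
  have hconst : ∀ t, ‖u t‖ ^ 2 = ‖u s‖ ^ 2 := by
    have h1 : ∀ t, HasDerivAt (fun t => ‖u t‖ ^ 2) 0 t := by
      intro t
      have := (hd' t).norm_sq
      rwa [real_inner_smul_right, inner_homogeneous_extension ho, mul_zero, mul_zero] at this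
    exact fun t => is_const_of_deriv_eq_zero (fun t => (h1 t).differentiableAt)
      (fun t => (h1 t).deriv) t s
  set ρ := ‖u s‖ with hρ
  have hρ0 : 0 < ρ := norm_pos_iff.2 hs
  have hnorm : ∀ t, ‖u t‖ = ρ := fun t =>
    (pow_left_inj₀ (norm_nonneg _) hρ0.le two_ne_zero).1 (hconst t)
  simp only [hnorm] at hd'
  set γ : ℝ → EuclideanSpace ℂ (Fin m) := fun t => ρ⁻¹ • u (r * t) with hγ
  have hγ1 : ∀ t, ‖γ t‖ = 1 := fun t => by
    rw [hγ, norm_smul, hnorm, norm_inv, Real.norm_of_nonneg hρ0.le, inv_mul_cancel₀ hρ0.ne']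
  have hγd : ∀ t, HasDerivAt γ (X (γ t)) t := by
    intro t
    have h1 : HasDerivAt (fun t => r * t) r t := by simpa using (hasDerivAt_id t).const_mul r
    have h2 := ((hd' (r * t)).scomp t h1).const_smul ρ⁻¹
    rw [smul_inv_smul₀ hr.ne', inv_smul_smul₀ hρ0.ne'] at h2
    exact h2
  refine ⟨γ, hγ1, hγd, ⟨r⁻¹ * (2 * Real.pi), by positivity, fun t => ?_⟩, ?_⟩
  · simp only [hγ, mul_add, mul_inv_cancel_left₀ hr.ne']
    rw [hper]
  · by_contra! hcon
    have h1 : X (γ 0) = 0 :=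
      (hγd 0).unique ((hasDerivAt_const (0 : ℝ) (γ 0)).congr_of_eventuallyEq
        (.of_forall fun t => hcon t 0))
    have h2 := hb (γ 0) (hγ1 0)
    rw [h1, zero_sub, norm_neg, norm_smul, Complex.norm_I, hγ1] at h2
    norm_num at h2

end Orbit

end

end HopfOrbit

/-- **Seifert–Fuller theorem for the Hopf fibration.**
For every `n ≥ 1` there is `ε > 0` such that every `C¹` tangent vector field `X` on the
unit sphere `S^{2n+1} ⊂ ℂ^{n+1}` satisfying `‖X z − i z‖ < ε` on the sphere has at least
one periodic orbit. -/
theorem seifert_fuller_hopf (n : ℕ) (hn : 1 ≤ n) :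
    ∃ ε > (0 : ℝ),
      ∀ X : EuclideanSpace ℂ (Fin (n + 1)) → EuclideanSpace ℂ (Fin (n + 1)),
        ContDiff ℝ 1 X →
        (∀ z : EuclideanSpace ℂ (Fin (n + 1)), ‖z‖ = 1 → ⟪X z, z⟫ = 0) →
        (∀ z : EuclideanSpace ℂ (Fin (n + 1)), ‖z‖ = 1 →
          ‖X z - (Complex.I • z : EuclideanSpace ℂ (Fin (n + 1)))‖ < ε) →
        ∃ γ : ℝ → EuclideanSpace ℂ (Fin (n + 1)),
          (∀ t, ‖γ t‖ = 1) ∧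
          (∀ t, HasDerivAt γ (X (γ t)) t) ∧
          (∃ T > 0, ∀ t, γ (t + T) = γ t) ∧
          (∃ t s, γ t ≠ γ s) := by
  exact ⟨1 / 64, by norm_num, fun X hX ho hb =>
    HopfOrbit.exists_periodic_orbit n.succ_pos hX.continuous ho hb⟩
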